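/- arXiv:1206.3152 — 3 statements merged into one kernel-verified Lean document; each statement's English description precedes it below -/
import Mathlib

section
/- There exist a real number α with 1 < α < 2 and constants c > 0 and d₀ such that for all integers d ≥ d₀: | N_E − |F|/2 | ≤ e^{−cd}·|F|, where N_E denotes the number of f ∈ F for which there exists an integer c₁ with |{v ∈ E : f(v) ≠ c₁}| < α^d (i.e., f is mostly constant on the even side). -/
/-- Two vertices of the Hamming cube `{0,1}^d` are adjacent iff they differ in
exactly one coordinate. -/
def cubeAdj (d : ℕ) (u v : Fin d → Bool) : Prop :=
  (Finset.univ.filter fun i => u i ≠ v i).card = 1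


/-- The set of homomorphisms from `Q_d` to `ℤ` sending the all-zeros vertex to `0`. -/
def HomF (d : ℕ) : Set ((Fin d → Bool) → ℤ) :=
  {f | f (fun _ => false) = 0 ∧ ∀ u v, cubeAdj d u v → |f u - f v| = 1}


/-- The even vertices of the Hamming cube. -/
def evenV (d : ℕ) : Set (Fin d → Bool) :=
  {v | Even (Finset.univ.filter fun i => v i = true).card}

/-- The odd vertices of the Hamming cube. -/
def oddV (d : ℕ) : Set (Fin d → Bool) :=
  {v | ¬ Even (Finset.univ.filter fun i => v i = true).card}

namespace CubeHom

open Finset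
open scoped Classical

/-- The vertex set of the Hamming cube. -/
abbrev Cube (d : ℕ) := Fin d → Bool

variable {d : ℕ} {B : Finset (Fin d)} {ρ : ℝ}

/-- The all-zeros vertex. -/
abbrev org : Cube d := fun _ => false

/-- Change the `i`-th coordinate of `x`. -/
def flip (i : Fin d) (x : Cube d) : Cube d := fun k => xor (x k) (decide (k = i))

/-- Translation of the cube by `a`. -/
def tr (a x : Cube d) : Cube d := fun k => xor (a k) (x k)

/-- The number of nonzero coordinates. -/
def wt (x : Cube d) : ℕ := (univ.filter fun i => x i = true).card

@[simp] lemma flip_flip (i : Fin d) (x : Cube d) : flip i (flip i x) = x := by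
  funext k; simp [flip]

@[simp] lemma tr_tr (a x : Cube d) : tr a (tr a x) = x := by
  funext k; simp [tr]

lemma tr_flip (a x : Cube d) (i : Fin d) : tr a (flip i x) = flip i (tr a x) := by
  funext k; simp [tr, flip]

@[simp] lemma tr_org (a : Cube d) : tr a org = a := by
  funext k; simp [tr]

@[simp] lemma tr_self (a : Cube d) : tr a a = org := by
  funext k; simp [tr]

lemma flip_comp (σ : Equiv.Perm (Fin d)) (i : Fin d) (x : Cube d) :
    flip i x ∘ σ = flip (σ.symm i) (x ∘ σ) := by
  funext k; simp [flip, Equiv.eq_symm_apply]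

lemma flip_injective (i : Fin d) : Function.Injective (flip i) :=
  (show Function.Involutive (flip i) from flip_flip i).injective

lemma flip_apply_self (i : Fin d) (x : Cube d) : flip i x i = !x i := by simp [flip]

lemma flip_apply_ne {i k : Fin d} (h : k ≠ i) (x : Cube d) : flip i x k = x k := by
  simp [flip, h]

lemma cubeAdj_iff (u v : Cube d) : cubeAdj d u v ↔ ∃ i, v = flip i u := by
  unfold cubeAdj
  rw [card_eq_one]
  refine exists_congr fun i => ?_
  constructor
  · intro h
    funext k
    have hk := Finset.ext_iff.1 h k
    simp only [mem_filter, mem_univ, true_and, mem_singleton] at hk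
    by_cases h1 : k = i
    · simp only [h1, iff_true] at hk
      simp only [flip, h1, decide_true]
      revert hk; cases u i <;> cases v i <;> simp
    · have : u k = v k := by simpa [h1] using hk
      simp [flip, h1, this]
  · intro h
    ext k
    simp only [mem_filter, mem_univ, true_and, mem_singleton, h, flip]
    by_cases h1 : k = i <;> cases u k <;> simp [h1]

lemma wt_flip_of_false {i : Fin d} {x : Cube d} (h : x i = false) : wt (flip i x) = wt x + 1 := by
  unfold wt
  rw [← card_insert_of_notMem (s := univ.filter fun k => x k = true) (a := i) (by simp [h])]
  congr 1
  ext k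
  by_cases h1 : k = i <;> simp [flip, h1, h]

lemma wt_flip_of_true {i : Fin d} {x : Cube d} (h : x i = true) : wt (flip i x) + 1 = wt x := by
  have := wt_flip_of_false (i := i) (x := flip i x) (by simp [flip, h])
  rw [flip_flip] at this
  exact this.symm

/-- Membership in the even half of the cube. -/
def Ev (x : Cube d) : Prop := Even (wt x)

@[simp] lemma ev_flip (i : Fin d) (x : Cube d) : Ev (flip i x) ↔ ¬ Ev x := by
  unfold Ev
  cases h : x i
  · rw [wt_flip_of_false h, Nat.even_add_one]
  · rw [← wt_flip_of_true h, Nat.even_add_one, not_not]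

lemma ev_org : Ev (org : Cube d) := by simp [Ev, wt]

lemma eq_org_or_exists (x : Cube d) : x = org ∨ ∃ i, x i = true := by
  by_contra! h
  exact h.1 (funext fun k => by simpa using h.2 k)

/-- Induction along the edges of the cube. -/
lemma flip_induction {P : Cube d → Prop} (h0 : P org)
    (hs : ∀ x i, x i = true → P (flip i x) → P x) (x : Cube d) : P x := by
  induction h : wt x generalizing x with
  | zero =>
    rcases eq_org_or_exists x with rfl | ⟨i, hi⟩
    · exact h0
    · have := wt_flip_of_true hi; omega
  | succ n ih =>
    rcases eq_org_or_exists x with rfl | ⟨i, hi⟩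
    · exact h0
    · exact hs x i hi (ih _ (by have := wt_flip_of_true hi; omega))

lemma ev_tr (a x : Cube d) : Ev (tr a x) ↔ (Ev a ↔ Ev x) := by
  induction x using flip_induction with
  | h0 => simp [ev_org]
  | hs x i _ ih =>
    rw [tr_flip, ev_flip, ev_flip] at ih
    tauto

lemma mem_HomF (f : Cube d → ℤ) :
    f ∈ HomF d ↔ f org = 0 ∧ ∀ x i, |f (flip i x) - f x| = 1 := by
  unfold HomF
  simp only [Set.mem_ofPred_eq]
  refine and_congr_right fun _ => ⟨fun h x i => ?_, fun h u v huv => ?_⟩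
  · rw [abs_sub_comm]; exact h _ _ ((cubeAdj_iff _ _).2 ⟨i, rfl⟩)
  · obtain ⟨i, rfl⟩ := (cubeAdj_iff _ _).1 huv
    rw [abs_sub_comm]; exact h _ _

lemma abs_le_wt {f : Cube d → ℤ} (hf : f ∈ HomF d) (x : Cube d) : |f x| ≤ wt x := by
  rw [mem_HomF] at hf
  induction x using flip_induction with
  | h0 => simp [hf.1]
  | hs x i hi ih =>
    have h1 := hf.2 x i
    have h2 : ((wt (flip i x) : ℤ)) + 1 = wt x := by exact_mod_cast wt_flip_of_true hi
    rw [abs_le] at ih ⊢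
    rcases (abs_eq (by norm_num)).1 h1 with h | h <;> constructor <;> omega

lemma wt_le (x : Cube d) : wt x ≤ d := by
  unfold wt
  exact (card_le_univ _).trans (by simp)

/-- The set `HomF d` as a finset. -/
noncomputable def homs (d : ℕ) : Finset (Cube d → ℤ) :=
  (Fintype.piFinset fun _ => Icc (-d : ℤ) d).filter fun f => f ∈ HomF d

lemma mem_homs' {f : Cube d → ℤ} : f ∈ homs d ↔ f ∈ HomF d := by
  unfold homs
  rw [mem_filter, and_iff_right_iff_imp]
  intro hf
  rw [Fintype.mem_piFinset]
  intro x
  have h1 := abs_le.1 (abs_le_wt hf x)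
  have h2 : (wt x : ℤ) ≤ d := by exact_mod_cast wt_le x
  rw [mem_Icc]; constructor <;> linarith

lemma mem_homs {f : Cube d → ℤ} :
    f ∈ homs d ↔ f org = 0 ∧ ∀ x i, |f (flip i x) - f x| = 1 := by
  rw [mem_homs', mem_HomF]

lemma coe_homs : (homs d : Set (Cube d → ℤ)) = HomF d := by
  ext f; rw [mem_coe, mem_homs']

lemma step {f : Cube d → ℤ} (hf : f ∈ homs d) (x : Cube d) (i : Fin d) :
    f (flip i x) = f x + 1 ∨ f (flip i x) = f x - 1 := by
  rcases (abs_eq (by norm_num)).1 ((mem_homs.1 hf).2 x i) with h | h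
  · left; omega
  · right; omega

lemma step_org {f : Cube d → ℤ} (hf : f ∈ homs d) (i : Fin d) :
    f (flip i org) = 1 ∨ f (flip i org) = -1 := by
  have := step hf org i
  rw [(mem_homs.1 hf).1] at this
  simpa using this

/-- The even vertices, as a finset. -/
noncomputable def evens (d : ℕ) : Finset (Cube d) := univ.filter Ev

/-- The odd vertices, as a finset. -/
noncomputable def odds (d : ℕ) : Finset (Cube d) := univ.filter fun x => ¬ Ev x

lemma card_evens_eq_card_odds [NeZero d] : (evens d).card = (odds d).card := by
  refine card_bij' (fun x _ => flip 0 x) (fun x _ => flip 0 x) ?_ ?_ ?_ ?_ <;>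
    simp [evens, odds]

lemma two_mul_card_odds [NeZero d] : 2 * (odds d).card = 2 ^ d := by
  have h := card_filter_add_card_filter_not (s := (univ : Finset (Cube d))) Ev
  have h' := card_evens_eq_card_odds (d := d)
  unfold evens odds at *
  rw [h', card_univ] at h
  simp at h
  omega

/-- Functions that vanish on the even vertices and take the values `±1` on the odd ones. -/
noncomputable def flat (s : Finset (Cube d)) (x : Cube d) : ℤ :=
  if Ev x then 0 else if x ∈ s then 1 else -1

lemma flat_mem (s : Finset (Cube d)) : flat s ∈ homs d := by
  rw [mem_homs]
  refine ⟨by simp [flat, ev_org], fun x i => ?_⟩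
  unfold flat
  rw [ev_flip]
  by_cases h : Ev x <;> simp [h] <;> split_ifs <;> simp

lemma two_pow_le_card_homs : 2 ^ (odds d).card ≤ (homs d).card := by
  rw [← card_powerset]
  refine card_le_card_of_injOn flat (fun s _ => flat_mem s) ?_
  intro s hs t ht hst
  have key : ∀ s ∈ (odds d).powerset, ∀ x, x ∈ s ↔ flat s x = 1 := by
    intro s hs x
    rw [mem_powerset] at hs
    unfold flat
    by_cases hx : x ∈ s
    · have := hs hx
      simp [odds] at this
      simp [hx, this]
    · split_ifs <;> simp [hx]
  ext x
  rw [key s hs, key t ht, hst]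

lemma card_homs_pos : 0 < (homs d).card := lt_of_lt_of_le (by positivity) two_pow_le_card_homs

/-- Expectation with respect to the uniform measure on `HomF d`. -/
noncomputable def ex (g : (Cube d → ℤ) → ℝ) : ℝ := (∑ f ∈ homs d, g f) / (homs d).card

/-- Probability with respect to the uniform measure on `HomF d`. -/
noncomputable def pr (p : (Cube d → ℤ) → Prop) : ℝ := ex fun f => if p f then 1 else 0

lemma card_homs_pos' : (0 : ℝ) < (homs d).card := by exact_mod_cast card_homs_pos

lemma ex_mono {g h : (Cube d → ℤ) → ℝ} (H : ∀ f ∈ homs d, g f ≤ h f) : ex g ≤ ex h :=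
  div_le_div_of_nonneg_right (sum_le_sum H) (by positivity)

lemma ex_congr {g h : (Cube d → ℤ) → ℝ} (H : ∀ f ∈ homs d, g f = h f) : ex g = ex h := by
  unfold ex; rw [sum_congr rfl H]

lemma ex_add (g h : (Cube d → ℤ) → ℝ) : ex (fun f => g f + h f) = ex g + ex h := by
  unfold ex; rw [sum_add_distrib, add_div]

lemma ex_const_mul (c : ℝ) (g : (Cube d → ℤ) → ℝ) : ex (fun f => c * g f) = c * ex g := by
  unfold ex; rw [← mul_sum, mul_div_assoc]

lemma ex_const (c : ℝ) : ex (fun _ : Cube d → ℤ => c) = c := by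
  unfold ex
  have := card_homs_pos' (d := d)
  rw [sum_const, nsmul_eq_mul]; field_simp

lemma ex_sum {ι : Type*} (s : Finset ι) (g : ι → (Cube d → ℤ) → ℝ) :
    ex (fun f => ∑ i ∈ s, g i f) = ∑ i ∈ s, ex (g i) := by
  unfold ex; rw [sum_comm, sum_div]

lemma ex_nonneg {g : (Cube d → ℤ) → ℝ} (H : ∀ f ∈ homs d, 0 ≤ g f) : 0 ≤ ex g :=
  div_nonneg (sum_nonneg H) (by positivity)

lemma pr_mono {p q : (Cube d → ℤ) → Prop} (H : ∀ f ∈ homs d, p f → q f) : pr p ≤ pr q := by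
  refine ex_mono fun f hf => ?_
  have := H f hf
  split_ifs <;> simp_all

lemma pr_congr {p q : (Cube d → ℤ) → Prop} (H : ∀ f ∈ homs d, p f ↔ q f) : pr p = pr q :=
  le_antisymm (pr_mono fun f hf => (H f hf).1) (pr_mono fun f hf => (H f hf).2)

lemma pr_nonneg (p : (Cube d → ℤ) → Prop) : 0 ≤ pr p :=
  ex_nonneg fun f _ => by split_ifs <;> norm_num

lemma pr_or_le (p q : (Cube d → ℤ) → Prop) : pr (fun f => p f ∨ q f) ≤ pr p + pr q := by
  unfold pr
  rw [← ex_add]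
  refine ex_mono fun f _ => ?_
  by_cases h1 : p f <;> by_cases h2 : q f <;> simp [h1, h2]

lemma pr_or_add_pr_and (p q : (Cube d → ℤ) → Prop) :
    pr (fun f => p f ∨ q f) + pr (fun f => p f ∧ q f) = pr p + pr q := by
  unfold pr
  rw [← ex_add, ← ex_add]
  refine ex_congr fun f _ => ?_
  by_cases h1 : p f <;> by_cases h2 : q f <;> simp [h1, h2]

lemma pr_not (p : (Cube d → ℤ) → Prop) : pr (fun f => ¬ p f) = 1 - pr p := by
  unfold pr
  rw [eq_sub_iff_add_eq, ← ex_add]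
  conv_rhs => rw [← ex_const (d := d) 1]
  refine ex_congr fun f _ => ?_
  by_cases h1 : p f <;> simp [h1]

lemma pr_exists_le {ι : Type*} (s : Finset ι) (p : ι → (Cube d → ℤ) → Prop) :
    pr (fun f => ∃ i ∈ s, p i f) ≤ ∑ i ∈ s, pr (p i) := by
  unfold pr
  rw [← ex_sum]
  refine ex_mono fun f _ => ?_
  split_ifs with h
  · obtain ⟨i, hi, h⟩ := h
    refine le_trans ?_ (single_le_sum (f := fun i => if p i f then (1 : ℝ) else 0) ?_ hi)
    · simp [h]
    · intro j _; split_ifs <;> norm_num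
  · exact sum_nonneg fun j _ => by split_ifs <;> norm_num

lemma pr_eq_div (p : (Cube d → ℤ) → Prop) :
    pr p = (((homs d).filter p).card : ℝ) / (homs d).card := by
  unfold pr ex
  rw [sum_boole]

lemma markov {g : (Cube d → ℤ) → ℝ} (h0 : ∀ f ∈ homs d, 0 ≤ g f) {a : ℝ} (ha : 0 < a) :
    pr (fun f => a ≤ g f) ≤ ex g / a := by
  rw [div_eq_inv_mul, ← ex_const_mul]
  refine ex_mono fun f hf => ?_
  have := h0 f hf
  split_ifs with h
  · rw [← div_eq_inv_mul, le_div_iff₀ ha]; linarith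
  · positivity

lemma ex_comp (φ ψ : (Cube d → ℤ) → Cube d → ℤ) (h1 : ∀ f ∈ homs d, φ f ∈ homs d)
    (h2 : ∀ f ∈ homs d, ψ f ∈ homs d) (h3 : ∀ f ∈ homs d, ψ (φ f) = f)
    (h4 : ∀ f ∈ homs d, φ (ψ f) = f) (g : (Cube d → ℤ) → ℝ) :
    ex (fun f => g (φ f)) = ex g := by
  unfold ex
  congr 1
  exact sum_nbij' φ ψ h1 h2 h3 h4 (fun _ _ => rfl)

/-- Recentering a homomorphism at `a`. -/
def shift (a : Cube d) (f : Cube d → ℤ) : Cube d → ℤ := fun x => f (tr a x) - f a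

lemma shift_mem {f : Cube d → ℤ} (hf : f ∈ homs d) (a : Cube d) : shift a f ∈ homs d := by
  rw [mem_homs] at hf ⊢
  refine ⟨by simp [shift], fun x i => ?_⟩
  simp only [shift, tr_flip]
  rw [sub_sub_sub_cancel_right]
  exact hf.2 _ _

lemma shift_shift {f : Cube d → ℤ} (hf : f ∈ homs d) (a : Cube d) : shift a (shift a f) = f := by
  funext x
  simp [shift, (mem_homs.1 hf).1]

lemma ex_shift (a : Cube d) (g : (Cube d → ℤ) → ℝ) : ex (fun f => g (shift a f)) = ex g :=
  ex_comp (shift a) (shift a) (fun _ h => shift_mem h a) (fun _ h => shift_mem h a)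
    (fun _ h => shift_shift h a) (fun _ h => shift_shift h a) g

lemma pr_shift (a : Cube d) (p : (Cube d → ℤ) → Prop) : pr (fun f => p (shift a f)) = pr p :=
  ex_shift a fun f => if p f then 1 else 0

/-- Permuting the coordinates. -/
def permute (σ : Equiv.Perm (Fin d)) (f : Cube d → ℤ) : Cube d → ℤ := fun x => f (x ∘ σ)

lemma permute_mem {f : Cube d → ℤ} (hf : f ∈ homs d) (σ : Equiv.Perm (Fin d)) :
    permute σ f ∈ homs d := by
  rw [mem_homs] at hf ⊢
  refine ⟨by simpa [permute, Function.comp_def] using hf.1, fun x i => ?_⟩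
  simp only [permute, flip_comp]
  exact hf.2 _ _

lemma ex_permute (σ : Equiv.Perm (Fin d)) (g : (Cube d → ℤ) → ℝ) :
    ex (fun f => g (permute σ f)) = ex g :=
  ex_comp (permute σ) (permute σ.symm) (fun _ h => permute_mem h _) (fun _ h => permute_mem h _)
    (fun f _ => by funext x; simp [permute, Function.comp_def])
    (fun f _ => by funext x; simp [permute, Function.comp_def]) g

lemma pr_permute (σ : Equiv.Perm (Fin d)) (p : (Cube d → ℤ) → Prop) :
    pr (fun f => p (permute σ f)) = pr p :=
  ex_permute σ fun f => if p f then 1 else 0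

lemma neg_mem {f : Cube d → ℤ} (hf : f ∈ homs d) : -f ∈ homs d := by
  rw [mem_homs] at hf ⊢
  refine ⟨by simp [hf.1], fun x i => ?_⟩
  rw [← hf.2 x i, ← abs_neg]
  congr 1
  simp only [Pi.neg_apply]; ring

lemma pr_neg (p : (Cube d → ℤ) → Prop) : pr (fun f => p (-f)) = pr p :=
  ex_comp (fun f => -f) (fun f => -f) (fun _ h => neg_mem h) (fun _ h => neg_mem h)
    (fun f _ => neg_neg f) (fun f _ => neg_neg f) fun f => if p f then 1 else 0

/-- Gibbs' inequality for the uniform distribution on a finite set. -/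
lemma card_mul_log_card_le {α : Type*} (s : Finset α) (q : α → ℝ) (hq : ∀ a ∈ s, 0 < q a)
    (hsum : ∑ a ∈ s, q a ≤ 1) :
    (s.card : ℝ) * Real.log s.card ≤ ∑ a ∈ s, -Real.log (q a) := by
  rcases s.eq_empty_or_nonempty with rfl | hs
  · simp
  have hc : (0 : ℝ) < s.card := by exact_mod_cast hs.card_pos
  have h1 : ∀ a ∈ s, Real.log s.card + Real.log (q a) ≤ s.card * q a - 1 := fun a ha => by
    rw [← Real.log_mul hc.ne' (hq a ha).ne']
    exact Real.log_le_sub_one_of_pos (mul_pos hc (hq a ha))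
  have h2 := sum_le_sum h1
  rw [sum_add_distrib, sum_sub_distrib, ← mul_sum] at h2
  simp only [sum_const, nsmul_eq_mul, mul_one] at h2
  rw [sum_neg_distrib]
  nlinarith [mul_le_mul_of_nonneg_left hsum hc.le]

/-- A product of sequential conditional weights has total mass at most one. -/
lemma sum_prod_weights_le_one {V : Type*} [Fintype V] [DecidableEq V] (r : V → ℕ)
    (w : V → (V → ℤ) → ℝ) (B : Finset ℤ) (hw : ∀ x f, 0 ≤ w x f)
    (hdep : ∀ x f g, (∀ y, r y < r x → f y = g y) → f x = g x → w x f = w x g)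
    (hsum : ∀ x f, ∑ b ∈ B, w x (Function.update f x b) ≤ 1) :
    ∑ f ∈ Fintype.piFinset (fun _ : V => B), ∏ x, w x f ≤ 1 := by
  suffices H : ∀ W : Finset V, ∑ f ∈ Fintype.piFinset (fun x => if x ∈ W then B else {0}),
      ∏ x ∈ W, w x f ≤ 1 by simpa using H univ
  intro W
  induction W using Finset.induction_on_max_value r with
  | empty => simp
  | insert a s ha hmax ih =>
    have hS : Fintype.piFinset (fun x => if x ∈ insert a s then B else {0}) =
        ((Fintype.piFinset (fun x => if x ∈ s then B else {0})) ×ˢ B).image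
          (fun p => Function.update p.1 a p.2) := by
      ext f
      simp only [Fintype.mem_piFinset, mem_image, mem_product, Prod.exists]
      constructor
      · intro h
        refine ⟨Function.update f a 0, f a, ⟨fun x => ?_, by simpa using h a⟩, by simp⟩
        by_cases hx : x = a
        · subst hx; simp [ha]
        · simpa [hx] using h x
      · rintro ⟨g, b, ⟨hg, hb⟩, rfl⟩ x
        by_cases hx : x = a
        · subst hx; simp [hb]
        · simpa [hx] using hg x
    have hinj : Set.InjOn (fun p : (V → ℤ) × ℤ => Function.update p.1 a p.2)
        (((Fintype.piFinset (fun x => if x ∈ s then B else {0})) ×ˢ B : Finset _) : Set _) := by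
      rintro ⟨g, b⟩ hg ⟨g', b'⟩ hg' h
      simp only [coe_product, Set.mem_prod, mem_coe, Fintype.mem_piFinset] at hg hg'
      dsimp only at h
      have h1 := hg.1 a
      have h2 := hg'.1 a
      simp only [ha, if_false, mem_singleton] at h1 h2
      have hb : b = b' := by simpa using congrFun h a
      subst hb
      congr 1
      funext x
      by_cases hx : x = a
      · rw [hx, h1, h2]
      · simpa [hx] using congrFun h x
    rw [hS, sum_image hinj, sum_product]
    refine le_trans (sum_le_sum fun f _ => ?_) ih
    have hx : ∀ x ∈ s, ∀ b, w x (Function.update f a b) = w x f := by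
      intro x hx b
      refine hdep x _ _ (fun y hy => ?_) ?_
      · rw [Function.update_of_ne]
        rintro rfl
        exact absurd (hmax x hx) (not_le.2 hy)
      · rw [Function.update_of_ne]
        rintro rfl
        exact ha hx
    have h3 : ∀ b ∈ B, ∏ x ∈ insert a s, w x (Function.update f a b) =
        w a (Function.update f a b) * ∏ x ∈ s, w x f := fun b _ => by
      rw [prod_insert ha, prod_congr rfl fun x hxs => hx x hxs b]
    rw [sum_congr rfl h3, ← sum_mul]
    exact mul_le_of_le_one_left (prod_nonneg fun x _ => hw x f) (hsum a f)

/-- `f` is constant on the neighbourhood of `x`. -/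
def NbrConst (x : Cube d) (f : Cube d → ℤ) : Prop := ∀ i j, f (flip i x) = f (flip j x)

lemma nbrConst_shift (a x : Cube d) (f : Cube d → ℤ) :
    NbrConst x (shift a f) ↔ NbrConst (tr a x) f := by
  simp [NbrConst, shift, tr_flip]

/-- Weight of the value `b` at a vertex all of whose neighbours are known, with values `g`. -/
noncomputable def fillWeight [NeZero d] (g : Fin d → ℤ) (b : ℤ) : ℝ :=
  if ∀ i j, g i = g j then (if |b - g 0| = 1 then 1 / 2 else 0)
  else if ∀ i, |b - g i| = 1 then 1 else 0

lemma fillWeight_nonneg [NeZero d] (g : Fin d → ℤ) (b : ℤ) : 0 ≤ fillWeight g b := by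
  unfold fillWeight; split_ifs <;> norm_num

lemma sum_fillWeight_le [NeZero d] (g : Fin d → ℤ) (S : Finset ℤ) :
    ∑ b ∈ S, fillWeight g b ≤ 1 := by
  unfold fillWeight
  by_cases h : ∀ i j, g i = g j
  · simp only [if_pos h]
    rw [← sum_filter, sum_const, nsmul_eq_mul]
    have : (S.filter fun b => |b - g 0| = 1) ⊆ {g 0 + 1, g 0 - 1} := by
      intro b hb
      rw [mem_filter] at hb
      rcases (abs_eq (by norm_num)).1 hb.2 with h | h
      · simp; left; omega
      · simp; right; omega
    have h2 : ((S.filter fun b => |b - g 0| = 1).card : ℝ) ≤ 2 := by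
      exact_mod_cast (card_le_card this).trans card_le_two
    linarith
  · simp only [if_neg h]
    rw [← sum_filter, sum_const, nsmul_eq_mul, mul_one]
    suffices H : (S.filter fun b => ∀ i, |b - g i| = 1).card ≤ 1 by exact_mod_cast H
    rw [card_le_one]
    intro a ha b hb
    push Not at h
    obtain ⟨i, j, hij⟩ := h
    simp only [mem_filter] at ha hb
    have h1 := (abs_eq (by norm_num)).1 (ha.2 i)
    have h2 := (abs_eq (by norm_num)).1 (ha.2 j)
    have h3 := (abs_eq (by norm_num)).1 (hb.2 i)
    have h4 := (abs_eq (by norm_num)).1 (hb.2 j)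
    omega

/-- Pairs of distinct nonzero coordinates of `x` outside `B`. -/
def IsPair (B : Finset (Fin d)) (x : Cube d) (a : Fin d × Fin d) : Prop :=
  a.1 ∉ B ∧ a.2 ∉ B ∧ a.1 ≠ a.2 ∧ x a.1 = true ∧ x a.2 = true

lemma card_no_pair_le (B : Finset (Fin d)) :
    (univ.filter fun x : Cube d => ¬ ∃ a, IsPair B x a).card ≤ 2 ^ B.card * (d + 1) := by
  have h : (univ.filter fun x : Cube d => ¬ ∃ a, IsPair B x a) ⊆
      (B.powerset ×ˢ (univ : Finset (Option (Fin d)))).image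
        (fun p k => decide (k ∈ p.1 ∨ p.2 = some k)) := by
    intro x hx
    simp only [mem_filter, mem_univ, true_and, IsPair, not_exists, Prod.forall] at hx
    rw [mem_image]
    by_cases h : ∃ k, k ∉ B ∧ x k = true
    · obtain ⟨k, hk, hxk⟩ := h
      refine ⟨(B.filter fun j => x j = true, some k), by simp, ?_⟩
      funext j
      dsimp only
      rw [eq_comm, ← Bool.coe_iff_coe, decide_eq_true_iff, mem_filter, Option.some_inj]
      constructor
      · intro hj
        by_cases hjB : j ∈ B
        · exact Or.inl ⟨hjB, hj⟩
        · by_contra hn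
          push Not at hn
          exact hx k j ⟨hk, hjB, hn.2, hxk, hj⟩
      · rintro (hj | rfl)
        · exact hj.2
        · exact hxk
    · push Not at h
      refine ⟨(B.filter fun j => x j = true, none), by simp, ?_⟩
      funext j
      dsimp only
      rw [eq_comm, ← Bool.coe_iff_coe, decide_eq_true_iff, mem_filter]
      constructor
      · intro hj
        by_cases hjB : j ∈ B
        · exact Or.inl ⟨hjB, hj⟩
        · exact absurd hj (h j hjB)
      · rintro (hj | hj)
        · exact hj.2
        · simp at hj
  refine (card_le_card h).trans (card_image_le.trans ?_)
  simp

/-- A rule assigning weights to the value at a vertex, given the values on the `B`-neighbours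
of two of its neighbours. -/
structure Predictor (B : Finset (Fin d)) where
  /-- the weight -/
  wgt : (Fin d → ℤ) → (Fin d → ℤ) → ℤ → ℝ
  nonneg : ∀ p p' b, 0 ≤ wgt p p' b
  congr : ∀ p q p' q' b, (∀ j ∈ B, p j = q j) → (∀ j ∈ B, p' j = q' j) → wgt p p' b = wgt q q' b
  sum_le : ∀ p p' (S : Finset ℤ), ∑ b ∈ S, wgt p p' b ≤ 1
  shift : ∀ p p' b c, wgt (fun j => p j + c) (fun j => p' j + c) (b + c) = wgt p p' b

/-- The weight given to the value at `x` by looking at the neighbours `flip i x`, `flip i' x`. -/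
def Predictor.at (K : Predictor B) (i i' : Fin d) (x : Cube d) (f : Cube d → ℤ) : ℝ :=
  K.wgt (fun j => f (flip j (flip i x))) (fun j => f (flip j (flip i' x))) (f x)

lemma Predictor.at_shift (K : Predictor B) (i i' : Fin d) (x a : Cube d) (f : Cube d → ℤ) :
    K.at i i' x (CubeHom.shift a f) = K.at i i' (tr a x) f := by
  unfold Predictor.at CubeHom.shift
  simp only [sub_eq_add_neg, K.shift, tr_flip]

/-- The weight assigned to the value at `x` in the encoding of a homomorphism. -/
noncomputable def codeWeight [NeZero d] (K : Predictor B) (x : Cube d) (f : Cube d → ℤ) : ℝ :=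
  if Ev x then
    if h : ∃ a, IsPair B x a then K.at h.choose.1 h.choose.2 x f else 1 / (2 * d + 1)
  else fillWeight (fun i => f (flip i x)) (f x)

/-- The order in which vertices are encoded. -/
noncomputable def codeRank (B : Finset (Fin d)) (x : Cube d) : ℕ :=
  if Ev x then (univ.filter fun k => k ∉ B ∧ x k = true).card else d + 1

lemma flip_ne (i : Fin d) (x : Cube d) : flip i x ≠ x := fun h => by
  have := congrFun h i
  simp [flip] at this

lemma ev_flip_flip (i j : Fin d) (x : Cube d) : Ev (flip j (flip i x)) ↔ Ev x := by simp

lemma flip_flip_ne {i j : Fin d} (h : i ≠ j) (x : Cube d) : flip j (flip i x) ≠ x := fun h' => by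
  have := congrFun h' i
  simp [flip, h] at this

lemma codeRank_lt {x : Cube d} (hx : Ev x) {i j : Fin d} (hi : i ∉ B) (hxi : x i = true)
    (hj : j ∈ B) : codeRank B (flip j (flip i x)) < codeRank B x := by
  unfold codeRank
  rw [ev_flip_flip, if_pos hx, if_pos hx]
  apply card_lt_card
  rw [ssubset_iff_of_subset]
  · exact ⟨i, by simp [hi, hxi], by
      have : i ≠ j := by rintro rfl; exact hi hj
      simp [flip, this, hxi]⟩
  · intro k
    simp only [mem_filter, mem_univ, true_and]
    rintro ⟨hk, h⟩
    have h1 : k ≠ j := by rintro rfl; exact hk hj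
    refine ⟨hk, ?_⟩
    by_cases h2 : k = i
    · rw [h2, hxi]
    · rwa [flip_apply_ne h1, flip_apply_ne h2] at h

lemma codeRank_lt_of_odd {x : Cube d} (hx : ¬ Ev x) (i : Fin d) :
    codeRank B (flip i x) < codeRank B x := by
  unfold codeRank
  rw [ev_flip, if_pos hx, if_neg hx, Nat.lt_succ_iff]
  exact (card_le_univ _).trans (by simp)

lemma codeWeight_nonneg [NeZero d] (K : Predictor B) (x : Cube d) (f : Cube d → ℤ) :
    0 ≤ codeWeight K x f := by
  unfold codeWeight
  split_ifs
  · exact K.nonneg _ _ _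
  · positivity
  · exact fillWeight_nonneg _ _

lemma codeWeight_congr [NeZero d] (K : Predictor B) (x : Cube d) (f g : Cube d → ℤ)
    (h : ∀ y, codeRank B y < codeRank B x → f y = g y) (hx : f x = g x) :
    codeWeight K x f = codeWeight K x g := by
  unfold codeWeight
  by_cases hE : Ev x
  · rw [if_pos hE, if_pos hE]
    by_cases hP : ∃ a, IsPair B x a
    · rw [dif_pos hP, dif_pos hP]
      obtain ⟨h1, h2, h3, h4, h5⟩ := hP.choose_spec
      unfold Predictor.at
      rw [hx]
      apply K.congr
      · exact fun j hj => h _ (codeRank_lt hE h1 h4 hj)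
      · exact fun j hj => h _ (codeRank_lt hE h2 h5 hj)
    · rw [dif_neg hP, dif_neg hP]
  · rw [if_neg hE, if_neg hE, hx]
    congr 1
    funext i
    exact h _ (codeRank_lt_of_odd hE i)

lemma sum_codeWeight_update_le [NeZero d] (K : Predictor B) (x : Cube d) (f : Cube d → ℤ) :
    ∑ b ∈ Icc (-d : ℤ) d, codeWeight K x (Function.update f x b) ≤ 1 := by
  unfold codeWeight
  by_cases hE : Ev x
  · simp only [if_pos hE]
    by_cases hP : ∃ a, IsPair B x a
    · simp only [dif_pos hP]
      obtain ⟨h1, h2, h3, h4, h5⟩ := hP.choose_spec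
      refine le_trans (sum_le_sum fun b _ => le_of_eq ?_)
        (K.sum_le (fun j => f (flip j (flip hP.choose.1 x)))
          (fun j => f (flip j (flip hP.choose.2 x))) (Icc (-d : ℤ) d))
      unfold Predictor.at
      rw [Function.update_self]
      apply K.congr
      · intro j hj
        rw [Function.update_of_ne (flip_flip_ne (ne_of_mem_of_not_mem hj h1).symm x)]
      · intro j hj
        rw [Function.update_of_ne (flip_flip_ne (ne_of_mem_of_not_mem hj h2).symm x)]
    · simp only [dif_neg hP, sum_const, nsmul_eq_mul, Int.card_Icc]
      have : ((d : ℤ) + 1 - -d).toNat = 2 * d + 1 := by omega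
      rw [this]
      push_cast
      rw [mul_one_div, div_self (by positivity)]
  · simp only [if_neg hE]
    refine le_trans (sum_le_sum fun b _ => le_of_eq ?_)
      (sum_fillWeight_le (fun i => f (flip i x)) (Icc (-d : ℤ) d))
    rw [Function.update_self]
    congr 1
    funext i
    rw [Function.update_of_ne (flip_ne i x)]

lemma sum_codeWeight_le_one [NeZero d] (K : Predictor B) :
    ∑ f ∈ homs d, ∏ x, codeWeight K x f ≤ 1 := by
  have h1 : homs d ⊆ Fintype.piFinset fun _ => Icc (-d : ℤ) d := filter_subset _ _
  have h2 := sum_prod_weights_le_one (codeRank B) (codeWeight K) (Icc (-d : ℤ) d)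
    (codeWeight_nonneg K) (codeWeight_congr K) (sum_codeWeight_update_le K)
  exact le_trans (sum_le_sum_of_subset_of_nonneg h1 fun f _ _ =>
    prod_nonneg fun x _ => codeWeight_nonneg K x f) h2

lemma fillWeight_of_mem [NeZero d] {f : Cube d → ℤ} (hf : f ∈ homs d) (x : Cube d) :
    0 < fillWeight (fun i => f (flip i x)) (f x) ∧
      -Real.log (fillWeight (fun i => f (flip i x)) (f x)) =
        if NbrConst x f then Real.log 2 else 0 := by
  have h : ∀ i, |f x - f (flip i x)| = 1 := fun i => by
    rw [abs_sub_comm]; exact (mem_homs.1 hf).2 x i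
  unfold fillWeight NbrConst
  simp only [h, implies_true, if_true]
  split_ifs <;> simp

/-- Expected cost of predicting the value at `flip i org` from the neighbourhoods of `org` and of
`flip i (flip i' org)`. -/
noncomputable def cost (K : Predictor B) (i i' : Fin d) : ℝ :=
  ex fun f => -Real.log (K.at i i' (flip i org) f)

lemma ex_log_at (K : Predictor B) (i i' : Fin d) (x : Cube d) :
    (ex fun f => -Real.log (K.at i i' x f)) = cost K i i' := by
  unfold cost
  rw [← ex_shift (flip i x) fun f => -Real.log (K.at i i' (flip i org) f)]
  simp only [Predictor.at_shift, tr_flip, tr_org, flip_flip]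

lemma exists_perm {i i' a a' : Fin d} (hi : i ∉ B) (hi' : i' ∉ B) (ha : a ∉ B) (ha' : a' ∉ B)
    (h : i ≠ i') (h' : a ≠ a') :
    ∃ σ : Equiv.Perm (Fin d), σ i = a ∧ σ i' = a' ∧ ∀ j ∈ B, σ j = j := by
  have hB : ∀ j ∈ B, Equiv.swap i a j = j := fun j hj =>
    Equiv.swap_apply_of_ne_of_ne (by rintro rfl; exact hi hj) (by rintro rfl; exact ha hj)
  have h2 : Equiv.swap i a i' ∉ B := fun hj => by
    have := hB _ hj
    rw [Equiv.swap_apply_self] at this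
    rw [← this] at hj
    exact hi' hj
  refine ⟨(Equiv.swap i a).trans (Equiv.swap (Equiv.swap i a i') a'), ?_, by simp, ?_⟩
  · rw [Equiv.trans_apply, Equiv.swap_apply_left, Equiv.swap_apply_of_ne_of_ne _ h']
    rw [ne_comm, Ne, Equiv.swap_apply_eq_iff, Equiv.swap_apply_right]
    exact h.symm
  · intro j hj
    rw [Equiv.trans_apply, hB j hj]
    exact Equiv.swap_apply_of_ne_of_ne (by rintro rfl; exact h2 hj) (by rintro rfl; exact ha' hj)

lemma cost_eq (K : Predictor B) {i i' a a' : Fin d} (hi : i ∉ B) (hi' : i' ∉ B) (ha : a ∉ B)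
    (ha' : a' ∉ B) (h : i ≠ i') (h' : a ≠ a') : cost K i i' = cost K a a' := by
  obtain ⟨σ, h1, h2, h3⟩ := exists_perm ha ha' hi hi' h' h
  rw [← ex_log_at K i i' org, ← ex_log_at K a a' org,
    ← ex_permute σ fun f => -Real.log (K.at i i' org f)]
  refine ex_congr fun f _ => ?_
  congr 2
  unfold Predictor.at permute
  have e : (org : Cube d) ∘ σ = org := rfl
  simp only [flip_comp, e, ← h1, ← h2, Equiv.symm_apply_apply]
  refine K.congr _ _ _ _ _ (fun j hj => ?_) (fun j hj => ?_) <;>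
  · rw [σ.symm_apply_eq.2 (h3 j hj).symm]

/-- The cost of encoding bounds the entropy from above. -/
lemma coding_bound [NeZero d] (K : Predictor B) {i i' : Fin d} (hi : i ∉ B) (hi' : i' ∉ B)
    (h : i ≠ i')
    (hpos : ∀ f ∈ homs d, ∀ a a' x, a ∉ B → a' ∉ B → a ≠ a' → 0 < K.at a a' x f) :
    Real.log 2 ≤ Real.log 2 * pr (NbrConst (org : Cube d)) + cost K i i' +
      2 ^ B.card * (d + 1) * Real.log (2 * d + 1) / (odds d).card := by
  have hcost : 0 ≤ cost K i i' := by
    refine ex_nonneg fun f hf => ?_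
    rw [neg_nonneg]
    refine Real.log_nonpos (K.nonneg _ _ _) ?_
    have := K.sum_le (fun j => f (flip j (flip i (flip i org))))
      (fun j => f (flip j (flip i' (flip i org)))) {f (flip i org)}
    rwa [sum_singleton] at this
  have hw : ∀ f ∈ homs d, ∀ x, 0 < codeWeight K x f := by
    intro f hf x
    unfold codeWeight
    split_ifs with hE hP
    · obtain ⟨h1, h2, h3, h4, h5⟩ := hP.choose_spec
      exact hpos f hf _ _ x h1 h2 h3
    · positivity
    · exact (fillWeight_of_mem hf x).1
  have hN : ((odds d).card : ℝ) * Real.log 2 ≤ Real.log (homs d).card := by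
    rw [← Real.log_pow]
    refine Real.log_le_log (by positivity) ?_
    exact_mod_cast two_pow_le_card_homs
  have hG := card_mul_log_card_le (homs d) (fun f => ∏ x, codeWeight K x f)
    (fun f hf => prod_pos fun x _ => hw f hf x) (sum_codeWeight_le_one K)
  have hlog : Real.log (homs d).card ≤ ∑ x, ex fun f => -Real.log (codeWeight K x f) := by
    rw [← ex_sum]
    unfold ex
    rw [le_div_iff₀ card_homs_pos', mul_comm]
    refine hG.trans (sum_le_sum fun f hf => le_of_eq ?_)
    rw [Real.log_prod fun x _ => (hw f hf x).ne', sum_neg_distrib]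
  have hL : 0 ≤ Real.log (2 * d + 1) := Real.log_nonneg (by
    have : (0 : ℝ) ≤ d := by positivity
    linarith)
  have hodd : ∀ x ∈ odds d, (ex fun f => -Real.log (codeWeight K x f)) =
      Real.log 2 * pr (NbrConst (org : Cube d)) := by
    intro x hx
    simp only [odds, mem_filter, mem_univ, true_and] at hx
    rw [← pr_shift x (NbrConst org), pr, ← ex_const_mul]
    refine ex_congr fun f hf => ?_
    simp only [codeWeight, hx, if_false, (fillWeight_of_mem hf x).2, nbrConst_shift, tr_org,
      mul_ite, mul_one, mul_zero]
  have heven : ∀ x ∈ evens d, (ex fun f => -Real.log (codeWeight K x f)) ≤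
      cost K i i' + if ¬ ∃ a, IsPair B x a then Real.log (2 * d + 1) else 0 := by
    intro x hx
    simp only [evens, mem_filter, mem_univ, true_and] at hx
    by_cases hP : ∃ a, IsPair B x a
    · obtain ⟨h1, h2, h3, h4, h5⟩ := hP.choose_spec
      simp only [codeWeight, hx, if_true, hP, dif_pos, not_true, if_false, add_zero]
      rw [ex_log_at, cost_eq K h1 h2 hi hi' h3 h]
    · simp only [codeWeight, hx, if_true, hP, dif_neg, not_false_iff, ex_const]
      rw [one_div, Real.log_inv, neg_neg]
      linarith
  have hsplit := sum_filter_add_sum_filter_not (univ : Finset (Cube d)) Ev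
    (fun x => ex fun f => -Real.log (codeWeight K x f))
  rw [← hsplit] at hlog
  have he := sum_le_sum heven
  have ho := sum_congr rfl hodd
  rw [sum_add_distrib, sum_const, ← sum_filter, sum_const, nsmul_eq_mul, nsmul_eq_mul,
    card_evens_eq_card_odds] at he
  rw [sum_const, nsmul_eq_mul] at ho
  have hbad : (((evens d).filter fun x => ¬ ∃ a, IsPair B x a).card : ℝ) ≤
      2 ^ B.card * (d + 1) := by
    exact_mod_cast (card_le_card (filter_subset_filter _ (subset_univ _))).trans
      (card_no_pair_le B)
  have hop : (0 : ℝ) < (odds d).card := by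
    have := two_mul_card_odds (d := d)
    have h2 : 0 < 2 ^ d := by positivity
    exact_mod_cast (by omega : 0 < (odds d).card)
  have hb := mul_le_mul_of_nonneg_right hbad hL
  unfold evens at he
  unfold odds at ho
  have hfin : ((odds d).card : ℝ) * Real.log 2 ≤ (odds d).card *
      (Real.log 2 * pr (NbrConst (org : Cube d)) + cost K i i') +
      2 ^ B.card * (d + 1) * Real.log (2 * d + 1) := by
    unfold evens at hb
    unfold odds at *
    linarith
  rw [← mul_le_mul_iff_right₀ hop]
  rw [mul_add, mul_div_cancel₀ _ hop.ne']
  exact hfin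

/-- The unit mass at `x`. -/
noncomputable def pt (x b : ℤ) : ℝ := if b = x then 1 else 0

lemma pt_nonneg (x b : ℤ) : 0 ≤ pt x b := by unfold pt; split_ifs <;> norm_num

@[simp] lemma pt_self (x : ℤ) : pt x x = 1 := by simp [pt]

lemma pt_of_ne {x b : ℤ} (h : b ≠ x) : pt x b = 0 := by simp [pt, h]

lemma sum_pt_le (x : ℤ) (S : Finset ℤ) : ∑ b ∈ S, pt x b ≤ 1 := by
  unfold pt
  rw [sum_ite_eq']
  split_ifs <;> norm_num

lemma pt_add (x b c : ℤ) : pt (x + c) (b + c) = pt x b := by simp [pt]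

/-- Prediction of the value `k`, with a small probability of being wrong. -/
noncomputable def guess (lam : ℝ) (k b : ℤ) : ℝ :=
  (1 - lam) * pt k b + lam / 2 * pt (k + 2) b + lam / 2 * pt (k - 2) b

lemma guess_nonneg {lam : ℝ} (h0 : 0 ≤ lam) (h1 : lam ≤ 1) (k b : ℤ) : 0 ≤ guess lam k b := by
  have := pt_nonneg k b
  have := pt_nonneg (k + 2) b
  have := pt_nonneg (k - 2) b
  have : 0 ≤ 1 - lam := by linarith
  unfold guess; positivity

lemma sum_guess_le {lam : ℝ} (h0 : 0 ≤ lam) (h1 : lam ≤ 1) (k : ℤ) (S : Finset ℤ) :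
    ∑ b ∈ S, guess lam k b ≤ 1 := by
  unfold guess
  rw [sum_add_distrib, sum_add_distrib, ← mul_sum, ← mul_sum, ← mul_sum]
  have h2 : 0 ≤ 1 - lam := by linarith
  have h3 : 0 ≤ lam / 2 := by linarith
  have := mul_le_mul_of_nonneg_left (sum_pt_le k S) h2
  have := mul_le_mul_of_nonneg_left (sum_pt_le (k + 2) S) h3
  have := mul_le_mul_of_nonneg_left (sum_pt_le (k - 2) S) h3
  linarith

lemma guess_add (lam : ℝ) (k b c : ℤ) : guess lam (k + c) (b + c) = guess lam k b := by
  unfold guess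
  rw [show k + c + 2 = k + 2 + c by ring, show k + c - 2 = k - 2 + c by ring, pt_add, pt_add,
    pt_add]

lemma guess_self (lam : ℝ) (k : ℤ) : guess lam k k = 1 - lam := by
  unfold guess
  rw [pt_self, pt_of_ne (by omega), pt_of_ne (by omega)]; ring

lemma guess_add_two (lam : ℝ) (k : ℤ) : guess lam k (k + 2) = lam / 2 := by
  unfold guess
  rw [pt_self, pt_of_ne (by omega), pt_of_ne (by omega)]; ring

lemma guess_sub_two (lam : ℝ) (k : ℤ) : guess lam k (k - 2) = lam / 2 := by
  unfold guess
  rw [pt_self, pt_of_ne (by omega), pt_of_ne (by omega)]; ring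

/-- Prediction of the value `y` with probability `(1 - r) / 2` and `x` with probability
`(1 + r) / 2`. -/
noncomputable def tilt (r : ℝ) (x y b : ℤ) : ℝ := (1 - r) / 2 * pt y b + (1 + r) / 2 * pt x b

lemma tilt_nonneg {r : ℝ} (h0 : 0 ≤ r) (h1 : r ≤ 1) (x y b : ℤ) : 0 ≤ tilt r x y b := by
  have := pt_nonneg x b
  have := pt_nonneg y b
  have : 0 ≤ 1 - r := by linarith
  unfold tilt; positivity

lemma sum_tilt_le {r : ℝ} (h0 : 0 ≤ r) (h1 : r ≤ 1) (x y : ℤ) (S : Finset ℤ) :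
    ∑ b ∈ S, tilt r x y b ≤ 1 := by
  unfold tilt
  rw [sum_add_distrib, ← mul_sum, ← mul_sum]
  have h2 : 0 ≤ (1 - r) / 2 := by linarith
  have h3 : 0 ≤ (1 + r) / 2 := by linarith
  have := mul_le_mul_of_nonneg_left (sum_pt_le y S) h2
  have := mul_le_mul_of_nonneg_left (sum_pt_le x S) h3
  linarith

lemma tilt_add (r : ℝ) (x y b c : ℤ) : tilt r (x + c) (y + c) (b + c) = tilt r x y b := by
  unfold tilt
  rw [pt_add, pt_add]

lemma tilt_left (r : ℝ) {x y : ℤ} (h : x ≠ y) : tilt r x y x = (1 + r) / 2 := by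
  unfold tilt; rw [pt_self, pt_of_ne h]; ring

lemma tilt_right (r : ℝ) {x y : ℤ} (h : x ≠ y) : tilt r x y y = (1 - r) / 2 := by
  unfold tilt; rw [pt_self, pt_of_ne h.symm]; ring

section extremes

variable (hB : B.Nonempty)

lemma sup'_add_const (p : Fin d → ℤ) (c : ℤ) :
    B.sup' hB (fun j => p j + c) = B.sup' hB p + c := by
  apply le_antisymm
  · exact sup'_le _ _ fun j hj => add_le_add_left (le_sup' p hj) c
  · obtain ⟨j, hj, h⟩ := exists_mem_eq_sup' hB p
    rw [h]; exact le_sup' (fun j => p j + c) hj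

lemma inf'_add_const (p : Fin d → ℤ) (c : ℤ) :
    B.inf' hB (fun j => p j + c) = B.inf' hB p + c := by
  apply le_antisymm
  · obtain ⟨j, hj, h⟩ := exists_mem_eq_inf' hB p
    rw [h]; exact inf'_le (fun j => p j + c) hj
  · exact le_inf' _ _ fun j hj => add_le_add_left (inf'_le p hj) c

lemma extremes_cases (p : Fin d → ℤ) (c : ℤ) (h : ∀ j ∈ B, p j = c + 1 ∨ p j = c - 1) :
    (B.inf' hB p = c + 1 ∧ B.sup' hB p = c + 1 ∧ ∀ j ∈ B, p j = c + 1) ∨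
    (B.inf' hB p = c - 1 ∧ B.sup' hB p = c - 1 ∧ ∀ j ∈ B, p j = c - 1) ∨
    (B.inf' hB p = c - 1 ∧ B.sup' hB p = c + 1 ∧ (∃ j ∈ B, p j = c + 1) ∧
      ∃ j ∈ B, p j = c - 1) := by
  obtain ⟨a, ha, h1⟩ := exists_mem_eq_sup' hB p
  obtain ⟨b, hb, h2⟩ := exists_mem_eq_inf' hB p
  have h3 : ∀ j ∈ B, p b ≤ p j ∧ p j ≤ p a := fun j hj =>
    ⟨h2 ▸ inf'_le p hj, h1 ▸ le_sup' p hj⟩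
  rw [h1, h2]
  rcases h a ha with ha' | ha' <;> rcases h b hb with hb' | hb'
  · left
    refine ⟨hb', ha', fun j hj => ?_⟩
    have := h3 j hj; omega
  · right; right
    exact ⟨hb', ha', ⟨a, ha, ha'⟩, ⟨b, hb, hb'⟩⟩
  · have := h3 a ha; omega
  · right; left
    refine ⟨hb', ha', fun j hj => ?_⟩
    have := h3 j hj; omega

/-- Predict from the neighbourhood of a single neighbour: a constant neighbourhood predicts the
same value again, and few occurrences of the larger value predict the smaller one. -/
noncomputable def onePredictor {lam : ℝ} (h0 : 0 ≤ lam) (h1 : lam ≤ 1) {r : ℕ → ℝ}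
    (hr0 : ∀ a, 0 ≤ r a) (hr1 : ∀ a, r a ≤ 1) : Predictor B where
  wgt p _ b := if B.inf' hB p = B.sup' hB p then guess lam (B.sup' hB p) b
    else tilt (r (B.filter fun j => p j = B.sup' hB p).card) (B.inf' hB p) (B.sup' hB p) b
  nonneg p _ b := by
    split_ifs
    · exact guess_nonneg h0 h1 _ _
    · exact tilt_nonneg (hr0 _) (hr1 _) _ _ _
  congr p q _ _ b h _ := by
    have e1 : B.inf' hB p = B.inf' hB q := inf'_congr hB rfl h
    have e2 : B.sup' hB p = B.sup' hB q := sup'_congr hB rfl h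
    have e3 : (B.filter fun j => p j = B.sup' hB q) = B.filter fun j => q j = B.sup' hB q :=
      filter_congr fun j hj => by rw [h j hj]
    rw [e1, e2, e3]
  sum_le p _ S := by
    split_ifs
    · exact sum_guess_le h0 h1 _ _
    · exact sum_tilt_le (hr0 _) (hr1 _) _ _ _
  shift p _ b c := by
    rw [inf'_add_const, sup'_add_const, guess_add, tilt_add]
    simp only [add_left_inj]

/-- Predict from the neighbourhoods of two neighbours, which leaves no uncertainty unless both
neighbourhoods are non-constant around the same value. -/
noncomputable def twoPredictor {lam : ℝ} (h0 : 0 ≤ lam) (h1 : lam ≤ 1) : Predictor B where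
  wgt p p' b := if B.inf' hB p = B.sup' hB p then guess lam (B.sup' hB p) b
    else if B.inf' hB p' = B.sup' hB p' then guess lam (B.sup' hB p') b
    else if B.sup' hB p = B.sup' hB p' then tilt 0 (B.inf' hB p) (B.sup' hB p) b
    else if B.sup' hB p' < B.sup' hB p then pt (B.inf' hB p) b else pt (B.sup' hB p) b
  nonneg p p' b := by
    split_ifs
    · exact guess_nonneg h0 h1 _ _
    · exact guess_nonneg h0 h1 _ _
    · exact tilt_nonneg le_rfl zero_le_one _ _ _
    · exact pt_nonneg _ _
    · exact pt_nonneg _ _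
  congr p q p' q' b h h' := by
    rw [inf'_congr hB rfl h, sup'_congr hB rfl h, inf'_congr hB rfl h', sup'_congr hB rfl h']
  sum_le p p' S := by
    split_ifs
    · exact sum_guess_le h0 h1 _ _
    · exact sum_guess_le h0 h1 _ _
    · exact sum_tilt_le le_rfl zero_le_one _ _ _
    · exact sum_pt_le _ _
    · exact sum_pt_le _ _
  shift p p' b c := by
    simp only [inf'_add_const, sup'_add_const, guess_add, tilt_add, pt_add, add_left_inj,
      add_lt_add_iff_right]

end extremes

/-- The number of directions in `B` in which `f` increases from the origin. -/
noncomputable def ups (B : Finset (Fin d)) (f : Cube d → ℤ) : ℕ :=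
  (B.filter fun j => f (flip j org) = 1).card

/-- `f` is constant on the `B`-neighbours of the origin but not on `flip i org`. -/
def Deviates (B : Finset (Fin d)) (i : Fin d) (f : Cube d → ℤ) : Prop :=
  ((∀ j ∈ B, f (flip j org) = 1) ∧ f (flip i org) = -1) ∨
    ((∀ j ∈ B, f (flip j org) = -1) ∧ f (flip i org) = 1)

lemma filter_swap {Y : Fin d → ℤ} {i j : Fin d} (hi : i ∉ B) (hj : j ∈ B)
    (hYi : Y i = 1) (hYj : Y j = -1) :
    (B.filter fun k => Y (Equiv.swap i j k) = 1).card = (B.filter fun k => Y k = 1).card + 1 := by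
  rw [← card_insert_of_notMem (s := B.filter fun k => Y k = 1) (a := j) (by simp [hYj])]
  congr 1
  ext k
  simp only [mem_filter, mem_insert]
  by_cases hk : k = j
  · subst hk; simp [hj, hYi]
  · by_cases hk' : k ∈ B
    · have : k ≠ i := by rintro rfl; exact hi hk'
      rw [Equiv.swap_apply_of_ne_of_ne this hk]; simp [hk]
    · simp [hk', hk]

lemma permute_flip_org (σ : Equiv.Perm (Fin d)) (f : Cube d → ℤ) (k : Fin d) :
    permute σ f (flip k org) = f (flip (σ.symm k) org) := by
  unfold permute; rw [flip_comp]; rfl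

lemma pr_swap {i j : Fin d} (hi : i ∉ B) (hj : j ∈ B) (a : ℕ) :
    pr (fun f => (ups B f = a ∧ f (flip i org) = 1) ∧ f (flip j org) = -1) =
      pr fun f => (ups B f = a + 1 ∧ f (flip i org) = -1) ∧ f (flip j org) = 1 := by
  rw [← pr_permute (Equiv.swap i j) fun f =>
    (ups B f = a + 1 ∧ f (flip i org) = -1) ∧ f (flip j org) = 1]
  refine pr_congr fun f _ => ?_
  unfold ups
  simp only [permute_flip_org, Equiv.symm_swap, Equiv.swap_apply_left, Equiv.swap_apply_right]
  constructor
  · rintro ⟨⟨h1, h2⟩, h3⟩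
    refine ⟨⟨?_, h3⟩, h2⟩
    rw [filter_swap (Y := fun k => f (flip k org)) hi hj h2 h3, h1]
  · rintro ⟨⟨h1, h3⟩, h2⟩
    rw [filter_swap (Y := fun k => f (flip k org)) hi hj h2 h3] at h1
    exact ⟨⟨by omega, h2⟩, h3⟩

lemma sum_pr_and {ι : Type*} (s : Finset ι) (p : (Cube d → ℤ) → Prop)
    (q : ι → (Cube d → ℤ) → Prop) (n : ℝ)
    (h : ∀ f ∈ homs d, p f → ((s.filter fun j => q j f).card : ℝ) = n) :
    ∑ j ∈ s, pr (fun f => p f ∧ q j f) = n * pr p := by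
  unfold pr
  rw [← ex_sum, ← ex_const_mul]
  refine ex_congr fun f hf => ?_
  by_cases hp : p f
  · simp only [hp, true_and, if_true, mul_one]
    rw [← h f hf hp, sum_boole]
  · simp [hp]

/-- Exchangeability of the directions at the origin. -/
lemma exchange {i : Fin d} (hi : i ∉ B) (a : ℕ) :
    ((B.card : ℝ) - a) * pr (fun f => ups B f = a ∧ f (flip i org) = 1) =
      (a + 1) * pr fun f => ups B f = a + 1 ∧ f (flip i org) = -1 := by
  rw [← sum_pr_and B (fun f => ups B f = a ∧ f (flip i org) = 1) (fun j f => f (flip j org) = -1),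
    ← sum_pr_and B (fun f => ups B f = a + 1 ∧ f (flip i org) = -1)
      (fun j f => f (flip j org) = 1)]
  · exact sum_congr rfl fun j hj => pr_swap hi hj a
  · rintro f _ ⟨h1, _⟩
    exact_mod_cast h1
  · rintro f hf ⟨h1, _⟩
    have h2 := card_filter_add_card_filter_not (s := B) (fun j => f (flip j org) = 1)
    have h3 : (B.filter fun j => ¬ f (flip j org) = 1) = B.filter fun j => f (flip j org) = -1 :=
      filter_congr fun j _ => by have := step_org hf j; omega
    rw [h3] at h2
    unfold ups at h1
    rw [← h2, h1]
    push_cast; ring_nf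

lemma ups_eq_zero {f : Cube d → ℤ} (hf : f ∈ homs d) :
    ups B f = 0 ↔ ∀ j ∈ B, f (flip j org) = -1 := by
  unfold ups
  rw [card_eq_zero, filter_eq_empty_iff]
  exact forall₂_congr fun j _ => by have := step_org hf j; omega

lemma pr_deviates_le (i : Fin d) :
    pr (Deviates B i) ≤ 2 * pr fun f => ups B f = 0 ∧ f (flip i org) = 1 := by
  unfold Deviates
  refine (pr_or_le _ _).trans ?_
  have h1 : pr (fun f => (∀ j ∈ B, f (flip j org) = -1) ∧ f (flip i org) = 1) =
      pr fun f => ups B f = 0 ∧ f (flip i org) = 1 :=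
    pr_congr fun f hf => by rw [ups_eq_zero hf]
  have h2 : pr (fun f => (∀ j ∈ B, f (flip j org) = 1) ∧ f (flip i org) = -1) =
      pr fun f => (∀ j ∈ B, f (flip j org) = -1) ∧ f (flip i org) = 1 := by
    rw [← pr_neg]
    refine pr_congr fun f _ => ?_
    simp only [Pi.neg_apply, neg_eq_iff_eq_neg, neg_neg]
  rw [h2, h1]; linarith

lemma ex_boole (p : (Cube d → ℤ) → Prop) [DecidablePred p] :
    (ex fun f => if p f then 1 else 0) = pr p := by
  unfold pr; congr!

lemma Predictor.at_pos (K : Predictor B)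
    (hpos : ∀ f ∈ homs d, ∀ a a', a ∉ B → a' ∉ B → a ≠ a' → 0 < K.at a a' (flip a org) f) :
    ∀ f ∈ homs d, ∀ a a' x, a ∉ B → a' ∉ B → a ≠ a' → 0 < K.at a a' x f := by
  intro f hf a a' x ha ha' h
  have := hpos _ (shift_mem hf (flip a x)) a a' ha ha' h
  rwa [K.at_shift, tr_flip, tr_org, flip_flip] at this

lemma guess_bounds {lam : ℝ} (h0 : 0 < lam) (h1 : lam ≤ 1 / 2) {k b : ℤ}
    (h : b = k ∨ b = k + 2 ∨ b = k - 2) :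
    0 < guess lam k b ∧
      -Real.log (guess lam k b) ≤ 2 * lam + if b = k then 0 else Real.log (2 / lam) := by
  have hL : -Real.log (lam / 2) = Real.log (2 / lam) := by
    rw [← Real.log_inv, inv_div]
  rcases h with rfl | rfl | rfl
  · rw [guess_self, if_pos rfl]
    refine ⟨by linarith, ?_⟩
    have h2 := Real.one_sub_inv_le_log_of_pos (show 0 < 1 - lam by linarith)
    have h3 : (1 - lam)⁻¹ ≤ 1 + 2 * lam := by
      rw [inv_le_iff_one_le_mul₀ (by linarith)]
      nlinarith
    linarith
  · rw [guess_add_two, if_neg (by omega), hL]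
    exact ⟨by linarith, by linarith⟩
  · rw [guess_sub_two, if_neg (by omega), hL]
    exact ⟨by linarith, by linarith⟩

/-- Truncated geometric sequence. -/
noncomputable def geom (t a : ℕ) : ℝ := if a ∈ Icc 1 t then (1 / 2) ^ a else 0

lemma geom_nonneg (t a : ℕ) : 0 ≤ geom t a := by
  unfold geom; split_ifs <;> positivity

lemma geom_le_half (t a : ℕ) : geom t a ≤ 1 / 2 := by
  unfold geom
  split_ifs with h
  · rw [mem_Icc] at h
    simpa using pow_le_pow_of_le_one (by norm_num : (0 : ℝ) ≤ 1 / 2) (by norm_num) h.1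
  · norm_num

/-- The one-sided predictor with geometric tilts. -/
noncomputable def geomPredictor (hB : B.Nonempty) {lam : ℝ} (h0 : 0 < lam) (h1 : lam ≤ 1 / 2)
    (t : ℕ) : Predictor B :=
  onePredictor hB h0.le (h1.trans (by norm_num)) (geom_nonneg t)
    (fun a => (geom_le_half t a).trans (by norm_num))

lemma neg_log_tilt_up {r : ℝ} (h0 : 0 ≤ r) (h1 : r ≤ 1 / 2) :
    -Real.log ((1 + r) / 2) ≤ Real.log 2 - r / 2 := by
  rw [Real.log_div (by linarith) (by norm_num)]
  have h2 := Real.one_sub_inv_le_log_of_pos (show 0 < 1 + r by linarith)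
  have h3 : (1 + r)⁻¹ ≤ 1 - r / 2 := by
    rw [inv_le_iff_one_le_mul₀ (by linarith)]
    nlinarith
  linarith

lemma neg_log_tilt_down {r : ℝ} (h0 : 0 ≤ r) (h1 : r ≤ 1 / 2) :
    -Real.log ((1 - r) / 2) ≤ Real.log 2 + 2 * r := by
  rw [Real.log_div (by linarith) (by norm_num)]
  have h2 := Real.one_sub_inv_le_log_of_pos (show 0 < 1 - r by linarith)
  have h3 : (1 - r)⁻¹ ≤ 1 + 2 * r := by
    rw [inv_le_iff_one_le_mul₀ (by linarith)]
    nlinarith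
  linarith

lemma geomPredictor_bounds (hB : B.Nonempty) {lam : ℝ} (h0 : 0 < lam) (h1 : lam ≤ 1 / 2)
    {t : ℕ} (ht : t < B.card) {f : Cube d → ℤ} (hf : f ∈ homs d) (i i' : Fin d) :
    0 < (geomPredictor hB h0 h1 t).at i i' (flip i org) f ∧
      -Real.log ((geomPredictor hB h0 h1 t).at i i' (flip i org) f) ≤
        2 * lam + Real.log 2 * (if ¬ NbrConst org f then 1 else 0) +
          Real.log (2 / lam) * (if Deviates B i f then 1 else 0) +
          geom t (ups B f) * (if f (flip i org) = 1 then 2 else -1 / 2) := by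
  have hu := step_org hf i
  have hc := extremes_cases hB (fun j => f (flip j org)) 0
    (fun j _ => by have := step_org hf j; simpa using this)
  simp only [zero_add, zero_sub] at hc
  have hN : 0 ≤ Real.log 2 * (if ¬ NbrConst org f then (1 : ℝ) else 0) := by
    have := Real.log_nonneg (show (1 : ℝ) ≤ 2 by norm_num)
    split_ifs <;> simp [this]
  unfold Predictor.at geomPredictor onePredictor
  simp only [flip_flip]
  rcases hc with ⟨e1, e2, h⟩ | ⟨e1, e2, h⟩ | ⟨e1, e2, ⟨j, hj, hj1⟩, ⟨k, hk, hk1⟩⟩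
  · rw [e1, e2, if_pos rfl]
    have hups : ups B f = B.card := by unfold ups; rw [filter_true_of_mem h]
    have hg : geom t (ups B f) = 0 := if_neg (by rw [mem_Icc]; omega)
    obtain ⟨g1, g2⟩ := guess_bounds h0 h1 (k := 1) (b := f (flip i org)) (by omega)
    refine ⟨g1, g2.trans ?_⟩
    rw [hg, zero_mul]
    rcases hu with hu | hu
    · have hD : ¬ Deviates B i f := by
        rintro (⟨-, h'⟩ | ⟨h', -⟩)
        · omega
        · obtain ⟨j, hj⟩ := hB; have := h j hj; have := h' j hj; omega
      simp only [hu, hD, if_true, if_false]; linarith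
    · have hD : Deviates B i f := Or.inl ⟨h, hu⟩
      simp only [hu, hD, if_true, if_neg (show ¬ (-1 : ℤ) = 1 by norm_num)]; linarith
  · rw [e1, e2, if_pos rfl]
    have hups : ups B f = 0 := (ups_eq_zero hf).2 h
    have hg : geom t (ups B f) = 0 := if_neg (by rw [mem_Icc]; omega)
    obtain ⟨g1, g2⟩ := guess_bounds h0 h1 (k := -1) (b := f (flip i org)) (by omega)
    refine ⟨g1, g2.trans ?_⟩
    rw [hg, zero_mul]
    rcases hu with hu | hu
    · have hD : Deviates B i f := Or.inr ⟨h, hu⟩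
      simp only [hu, hD, if_true, if_neg (show ¬ (1 : ℤ) = -1 by norm_num)]; linarith
    · have hD : ¬ Deviates B i f := by
        rintro (⟨h', -⟩ | ⟨-, h'⟩)
        · obtain ⟨j, hj⟩ := hB; have := h j hj; have := h' j hj; omega
        · omega
      simp only [hu, hD, if_true, if_false]; linarith
  · rw [e1, e2, if_neg (by norm_num)]
    have hNC : ¬ NbrConst org f := fun h => by have := h j k; omega
    have hD : ¬ Deviates B i f := by
      rintro (⟨h, -⟩ | ⟨h, -⟩)
      · have := h k hk; omega
      · have := h j hj; omega
    have g0 := geom_nonneg t (ups B f)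
    have g1 := geom_le_half t (ups B f)
    simp only [hNC, hD, not_false_iff, if_true, if_false, mul_one, mul_zero, add_zero]
    rw [← ups]
    rcases hu with hu | hu
    · rw [hu, if_pos rfl, tilt_right _ (by norm_num)]
      have := neg_log_tilt_down g0 g1
      exact ⟨by linarith, by linarith⟩
    · rw [hu, if_neg (by norm_num), tilt_left _ (by norm_num)]
      have := neg_log_tilt_up g0 g1
      exact ⟨by linarith, by linarith⟩

/-- The average error term in the coding bound. -/
noncomputable def codingError (d m : ℕ) : ℝ :=
  2 ^ m * (d + 1) * Real.log (2 * d + 1) / (odds d).card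

lemma telescope_le (w : ℕ → ℝ) (hw : ∀ a, 0 ≤ w a) (t : ℕ) :
    ∑ a ∈ Icc 1 (t + 1), (w (a + 1) / 4 - w a / 2) ≤ w (t + 2) / 4 - w 1 / 2 := by
  induction t with
  | zero => simp
  | succ t ih =>
    rw [sum_Icc_succ_top (by omega)]
    have := hw (t + 1 + 1)
    linarith

lemma geom_sum_eq (t : ℕ) (f : Cube d → ℤ) (hf : f ∈ homs d) (i : Fin d) :
    geom t (ups B f) * (if f (flip i org) = 1 then 2 else -1 / 2) =
      ∑ a ∈ Icc 1 t, (1 / 2) ^ a * (2 * (if ups B f = a ∧ f (flip i org) = 1 then 1 else 0) +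
        (-1 / 2) * (if ups B f = a ∧ f (flip i org) = -1 then 1 else 0)) := by
  have : ∀ a ∈ Icc 1 t, ((1 : ℝ) / 2) ^ a * (2 * (if ups B f = a ∧ f (flip i org) = 1 then 1 else 0)
      + (-1 / 2) * (if ups B f = a ∧ f (flip i org) = -1 then 1 else 0)) =
      if ups B f = a then (1 / 2) ^ a * (if f (flip i org) = 1 then 2 else -1 / 2) else 0 := by
    intro a _
    by_cases h : ups B f = a
    · rcases step_org hf i with hu | hu <;> simp [h, hu]
    · simp [h]
  rw [sum_congr rfl this, sum_ite_eq]
  unfold geom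
  split_ifs <;> simp

/-- It is unlikely for `f` to be constant on the `B`-neighbours but not on `flip i org`. -/
lemma pr_deviates_bound [NeZero d] {i i' : Fin d} (hi : i ∉ B) (hi' : i' ∉ B) (hii : i ≠ i')
    {lam : ℝ} (h0 : 0 < lam) (h1 : lam ≤ 1 / 2) (hL : Real.log (2 / lam) ≤ B.card / 16) {t : ℕ}
    (ht : 17 * (t + 1) + 16 ≤ B.card) :
    pr (Deviates B i) ≤ 16 * (2 * lam + codingError d B.card + (1 / 2) ^ t) := by
  have hB : B.Nonempty := card_pos.1 (by omega)
  have hL0 : 0 ≤ Real.log (2 / lam) := Real.log_nonneg (by rw [le_div_iff₀ h0]; linarith)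
  have hm : (17 * (t + 1) + 16 : ℝ) ≤ B.card := by exact_mod_cast ht
  have ht0 : (0 : ℝ) ≤ t := by positivity
  set K := geomPredictor hB h0 h1 (t + 1)
  have hK : ∀ f ∈ homs d, ∀ a a', _ := fun f hf a a' =>
    geomPredictor_bounds hB h0 h1 (t := t + 1) (by omega) hf a a'
  have hcode := coding_bound K hi hi' hii (K.at_pos fun f hf a a' _ _ _ => (hK f hf a a').1)
  set y : ℕ → ℝ := fun a => pr fun f => ups B f = a ∧ f (flip i org) = 1 with hy
  set z : ℕ → ℝ := fun a => pr fun f => ups B f = a ∧ f (flip i org) = -1 with hz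
  have hz0 : ∀ a, 0 ≤ z a := fun a => pr_nonneg _
  have hcost : cost K i i' ≤ 2 * lam + Real.log 2 * pr (fun f : Cube d → ℤ => ¬ NbrConst org f) +
      Real.log (2 / lam) * pr (Deviates B i) +
      ∑ a ∈ Icc 1 (t + 1), (1 / 2) ^ a * (2 * y a + (-1 / 2) * z a) := by
    refine (ex_mono fun f hf => (hK f hf i i').2).trans ?_
    rw [ex_add, ex_add, ex_add, ex_const, ex_const_mul, ex_const_mul]
    rw [ex_congr fun f hf => geom_sum_eq (t + 1) f hf i, ex_sum]
    simp only [ex_const_mul, ex_add, ex_boole]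
    rfl
  have hex : ∀ a, ((B.card : ℝ) - a) * y a = (a + 1) * z (a + 1) := fun a => exchange hi a
  have hsum : ∑ a ∈ Icc 1 (t + 1), (1 / 2) ^ a * (2 * y a + (-1 / 2) * z a) ≤
      ∑ a ∈ Icc 1 (t + 1), ((1 / 2) ^ (a + 1) * z (a + 1) / 4 - (1 / 2) ^ a * z a / 2) := by
    refine sum_le_sum fun a ha => ?_
    rw [mem_Icc] at ha
    have ha' : (a : ℝ) ≤ t + 1 := by exact_mod_cast ha.2
    have h3 : 16 * y a ≤ z (a + 1) := by
      have h4 := hex a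
      have h5 : 0 ≤ y a := pr_nonneg _
      have h6 : 16 * ((a : ℝ) + 1) ≤ B.card - a := by linarith
      have h7 := mul_le_mul_of_nonneg_right h6 h5
      have h8 : ((a : ℝ) + 1) * (16 * y a) ≤ (a + 1) * z (a + 1) := by linarith
      exact le_of_mul_le_mul_left h8 (by positivity)
    have h4 : (0 : ℝ) < (1 / 2) ^ a := by positivity
    have := mul_le_mul_of_nonneg_left h3 h4.le
    rw [pow_succ]
    linarith
  have htel := telescope_le (fun a => (1 / 2) ^ a * z a)
    (fun a => mul_nonneg (by positivity) (hz0 a)) t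
  simp only [pow_one] at htel
  have hzt : z (t + 2) ≤ 1 := by
    have := pr_not (d := d) (fun f => ups B f = t + 2 ∧ f (flip i org) = -1)
    have := pr_nonneg (d := d) fun f => ¬ (ups B f = t + 2 ∧ f (flip i org) = -1)
    simp only [hz]; linarith
  have hpt : (0 : ℝ) < (1 / 2) ^ t := by positivity
  have hzt' : (1 / 2 : ℝ) ^ (t + 2) * z (t + 2) ≤ (1 / 2) ^ t / 4 := by
    rw [pow_add]
    nlinarith
  have hD : pr (Deviates B i) ≤ 2 * y 0 := pr_deviates_le i
  have h00 := hex 0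
  simp only [Nat.cast_zero, sub_zero, zero_add, one_mul] at h00
  rw [pr_not] at hcost
  have hLD : Real.log (2 / lam) * pr (Deviates B i) ≤ z 1 / 8 := by
    rw [← h00]
    have := mul_le_mul hL hD (pr_nonneg _) (by positivity)
    linarith
  have hz1 : z 1 ≤ 8 * (2 * lam + codingError d B.card + (1 / 2) ^ t) := by
    unfold codingError
    linarith
  have hy0 : 0 ≤ y 0 := pr_nonneg _
  have : y 0 ≤ z 1 := by
    rw [← h00]
    nlinarith
  linarith

/-- Both `x` and `y` have non-constant neighbourhoods and `f` takes the same value on them. -/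
def SameRough (x y : Cube d) (f : Cube d → ℤ) : Prop :=
  ¬ NbrConst x f ∧ ¬ NbrConst y f ∧ f y = f x

lemma twoPredictor_bounds (hB : B.Nonempty) {lam : ℝ} (h0 : 0 < lam) (h1 : lam ≤ 1 / 2)
    {f : Cube d → ℤ} (hf : f ∈ homs d) (i i' : Fin d) :
    0 < (twoPredictor hB h0.le (h1.trans (by norm_num))).at i i' (flip i org) f ∧
      -Real.log ((twoPredictor hB h0.le (h1.trans (by norm_num))).at i i' (flip i org) f) ≤
        2 * lam + Real.log (2 / lam) * ((if Deviates B i f then 1 else 0) +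
          (if Deviates B i' (shift (flip i' (flip i org)) f) then 1 else 0)) +
          Real.log 2 * (if SameRough org (flip i' (flip i org)) f then 1 else 0) := by
  have hL : 0 ≤ Real.log (2 / lam) := Real.log_nonneg (by rw [le_div_iff₀ h0]; linarith)
  have hl2 := Real.log_nonneg (show (1 : ℝ) ≤ 2 by norm_num)
  have hu := step_org hf i
  set v := flip i' (flip i org) with hv
  have hv' : flip i' v = flip i org := by rw [hv, flip_flip]
  have hu' := step hf v i'
  rw [hv'] at hu'
  have hI : ∀ p : Prop, [Decidable p] → (0 : ℝ) ≤ if p then 1 else 0 := fun p _ => by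
    split_ifs <;> norm_num
  have hD := mul_nonneg hL (hI (Deviates B i f))
  have hD' := mul_nonneg hL (hI (Deviates B i' (shift v f)))
  have hS := mul_nonneg hl2 (hI (SameRough org v f))
  have hc := extremes_cases hB (fun j => f (flip j org)) 0
    (fun j _ => by have := step_org hf j; simpa using this)
  have hc' := extremes_cases hB (fun j => f (flip j v)) (f v) (fun j _ => step hf v j)
  simp only [zero_add, zero_sub] at hc
  unfold Predictor.at twoPredictor
  simp only [flip_flip]
  rw [mul_add]
  by_cases hp : B.inf' hB (fun j => f (flip j org)) = B.sup' hB (fun j => f (flip j org))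
  · rw [if_pos hp]
    obtain ⟨k, hk, hb, hDev⟩ : ∃ k, B.sup' hB (fun j => f (flip j org)) = k ∧
        (f (flip i org) = k ∨ f (flip i org) = k + 2 ∨ f (flip i org) = k - 2) ∧
        (f (flip i org) ≠ k → Deviates B i f) := by
      clear hc'
      rcases hc with ⟨-, e2, h⟩ | ⟨-, e2, h⟩ | ⟨e1, e2, -⟩
      · exact ⟨1, e2, by omega, fun h' => Or.inl ⟨h, by omega⟩⟩
      · exact ⟨-1, e2, by omega, fun h' => Or.inr ⟨h, by omega⟩⟩
      · omega
    rw [hk]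
    obtain ⟨g1, g2⟩ := guess_bounds h0 h1 hb
    refine ⟨g1, g2.trans ?_⟩
    by_cases hfk : f (flip i org) = k
    · rw [if_pos hfk]; linarith
    · rw [if_neg hfk, if_pos (hDev hfk)]; linarith
  rw [if_neg hp]
  by_cases hp' : B.inf' hB (fun j => f (flip j v)) = B.sup' hB (fun j => f (flip j v))
  · rw [if_pos hp']
    obtain ⟨k, hk, hb, hDev⟩ : ∃ k, B.sup' hB (fun j => f (flip j v)) = k ∧
        (f (flip i org) = k ∨ f (flip i org) = k + 2 ∨ f (flip i org) = k - 2) ∧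
        (f (flip i org) ≠ k → Deviates B i' (shift v f)) := by
      clear hc
      have hs : ∀ j, shift v f (flip j org) = f (flip j v) - f v := fun j => by
        simp only [shift, tr_flip, tr_org]
      unfold Deviates
      simp only [hs, hv']
      rcases hc' with ⟨-, e2, h⟩ | ⟨-, e2, h⟩ | ⟨e1, e2, -⟩
      · exact ⟨f v + 1, e2, by omega, fun h' => Or.inl ⟨fun j hj => by
          have := h j hj; omega, by omega⟩⟩
      · exact ⟨f v - 1, e2, by omega, fun h' => Or.inr ⟨fun j hj => by
          have := h j hj; omega, by omega⟩⟩
      · omega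
    rw [hk]
    obtain ⟨g1, g2⟩ := guess_bounds h0 h1 hb
    refine ⟨g1, g2.trans ?_⟩
    by_cases hfk : f (flip i org) = k
    · rw [if_pos hfk]; linarith
    · rw [if_neg hfk, if_pos (hDev hfk)]; linarith
  rw [if_neg hp']
  obtain ⟨e1, e2, ⟨j, -, hj⟩, ⟨k, -, hk⟩⟩ := hc.resolve_left (fun h => hp (by rw [h.1, h.2.1]))
    |>.resolve_left (fun h => hp (by rw [h.1, h.2.1]))
  obtain ⟨e1', e2', ⟨j', -, hj'⟩, ⟨k', -, hk'⟩⟩ :=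
    hc'.resolve_left (fun h => hp' (by rw [h.1, h.2.1]))
    |>.resolve_left (fun h => hp' (by rw [h.1, h.2.1]))
  clear hc hc'
  rw [e1, e2, e2']
  by_cases hs : (1 : ℤ) = f v + 1
  · rw [if_pos hs]
    have hSR : SameRough org v f := by
      refine ⟨fun h => ?_, fun h => ?_, ?_⟩
      · have := h j k; omega
      · have := h j' k'; omega
      · rw [(mem_homs.1 hf).1]; omega
    have ht : tilt 0 (-1) 1 (f (flip i org)) = 1 / 2 := by
      rcases hu with hu | hu
      · rw [hu, tilt_right _ (by norm_num)]; norm_num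
      · rw [hu, tilt_left _ (by norm_num)]; norm_num
    rw [ht, if_pos hSR, one_div, Real.log_inv]
    exact ⟨by norm_num, by linarith⟩
  · rw [if_neg hs]
    have : (if f v + 1 < 1 then pt (-1) (f (flip i org)) else pt 1 (f (flip i org))) = 1 := by
      split_ifs with h
      · rw [show f (flip i org) = -1 by omega, pt_self]
      · rw [show f (flip i org) = 1 by omega, pt_self]
    rw [this, Real.log_one]
    exact ⟨by norm_num, by linarith⟩

/-- If the neighbourhood of the origin is not constant, then with high probability nor is that of
`flip i' (flip i org)`, and `f` takes the same value there. -/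
lemma pr_not_sameRough [NeZero d] {i i' : Fin d} (hi : i ∉ B) (hi' : i' ∉ B) (hii : i ≠ i')
    (hB : B.Nonempty) {lam : ℝ} (h0 : 0 < lam) (h1 : lam ≤ 1 / 2) {δ : ℝ}
    (hD : pr (Deviates B i) ≤ δ) (hD' : pr (Deviates B i') ≤ δ) :
    Real.log 2 * pr (fun f => ¬ NbrConst org f ∧ ¬ SameRough org (flip i' (flip i org)) f) ≤
      2 * lam + 2 * Real.log (2 / lam) * δ + codingError d B.card := by
  have hL : 0 ≤ Real.log (2 / lam) := Real.log_nonneg (by rw [le_div_iff₀ h0]; linarith)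
  set K : Predictor B := twoPredictor hB h0.le (h1.trans (by norm_num))
  have hK : ∀ f ∈ homs d, ∀ a a', _ := fun f hf a a' => twoPredictor_bounds hB h0 h1 hf a a'
  have hcode := coding_bound K hi hi' hii (K.at_pos fun f hf a a' _ _ _ => (hK f hf a a').1)
  set v := flip i' (flip i org)
  have hcost : cost K i i' ≤ 2 * lam + Real.log (2 / lam) * (pr (Deviates B i) +
      pr (Deviates B i')) + Real.log 2 * pr (SameRough org v) := by
    refine (ex_mono fun f hf => (hK f hf i i').2).trans ?_
    rw [ex_add, ex_add, ex_const, ex_const_mul, ex_const_mul, ex_add,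
      ← pr_shift v (Deviates B i')]
    simp only [ex_boole]
    rfl
  have hsplit : pr (fun f : Cube d → ℤ => ¬ NbrConst org f) = pr (SameRough org v) +
      pr fun f => ¬ NbrConst org f ∧ ¬ SameRough org v f := by
    unfold pr
    rw [← ex_add]
    refine ex_congr fun f _ => ?_
    by_cases h2 : SameRough org v f
    · simp [h2, h2.1]
    · simp [h2]
  rw [pr_not] at hsplit
  have h3 : pr (fun f => ¬ NbrConst org f ∧ ¬ SameRough org v f) =
      1 - pr (NbrConst (org : Cube d)) - pr (SameRough org v) := by linarith
  have h4 := mul_le_mul_of_nonneg_left (add_le_add hD hD') hL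
  rw [h3]
  unfold codingError
  linarith

lemma pr_le_one (p : (Cube d → ℤ) → Prop) : pr p ≤ 1 := by
  have := pr_not p
  have := pr_nonneg fun f => ¬ p f
  linarith

lemma sameRough_shift (a x y : Cube d) (f : Cube d → ℤ) :
    SameRough x y (shift a f) ↔ SameRough (tr a x) (tr a y) f := by
  unfold SameRough
  rw [nbrConst_shift, nbrConst_shift]
  simp [shift]

/-- The local type of `f` at `x`: whether the neighbourhood is constant, together with its value,
or the value at `x` if it is not. -/
noncomputable def typ [NeZero d] (x : Cube d) (f : Cube d → ℤ) : Prop × ℤ :=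
  (NbrConst x f, if NbrConst x f then f (flip 0 x) else f x)

lemma typ_shift_eq_iff [NeZero d] (a x y : Cube d) (f : Cube d → ℤ) :
    typ x (shift a f) = typ y (shift a f) ↔ typ (tr a x) f = typ (tr a y) f := by
  unfold typ
  simp only [nbrConst_shift, shift, tr_flip, Prod.mk.injEq]
  refine and_congr_right fun h => ?_
  simp only [h]
  split_ifs <;> simp

lemma typ_ne_imp [NeZero d] {f : Cube d → ℤ} {i i' : Fin d} :
    let v := flip i' (flip i org)
    typ v f ≠ typ org f → (¬ NbrConst org f ∧ ¬ SameRough org v f) ∨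
      (¬ NbrConst v f ∧ ¬ SameRough v org f) := by
  intro v h
  by_cases h1 : NbrConst org f
  · by_cases h2 : NbrConst v f
    · refine absurd ?_ h
      unfold typ
      rw [if_pos h1, if_pos h2, h1 0 i, h2 0 i']
      simp only [v, flip_flip, h1, h2]
    · exact Or.inr ⟨h2, fun h => h.2.1 h1⟩
  · refine Or.inl ⟨h1, fun ⟨_, h3, h4⟩ => h ?_⟩
    unfold typ
    rw [if_neg h1, if_neg h3, h4]
    simp only [h1, h3]

/-- Every pair of vertices at distance two is unlikely to witness a change of structure. -/
def PairBound (d : ℕ) (ρ : ℝ) : Prop := ∀ i i' : Fin d, i ≠ i' →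
  pr (fun f => ¬ NbrConst org f ∧ ¬ SameRough org (flip i' (flip i org)) f) ≤ ρ

lemma pr_typ_pair_ne [NeZero d] (hρ : PairBound d ρ) {i i' : Fin d} (h : i ≠ i') (x : Cube d) :
    pr (fun f => typ (flip i' (flip i x)) f ≠ typ x f) ≤ 2 * ρ := by
  rw [← tr_org x, ← tr_flip, ← tr_flip]
  simp only [Ne, ← typ_shift_eq_iff]
  rw [pr_shift x fun f => ¬ typ (flip i' (flip i org)) f = typ org f]
  set v : Cube d := flip i' (flip i org) with hv
  refine (pr_mono fun f _ => typ_ne_imp (i := i) (i' := i')).trans ((pr_or_le _ _).trans ?_)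
  have h2 : pr (fun f => ¬ NbrConst v f ∧ ¬ SameRough v org f) =
      pr fun f => ¬ NbrConst org f ∧ ¬ SameRough org v f := by
    rw [← pr_shift v fun f => ¬ NbrConst org f ∧ ¬ SameRough org v f]
    simp only [nbrConst_shift, sameRough_shift, tr_org, tr_self]
  have := hρ i i' h
  rw [h2]
  linarith

lemma pr_typ_ne_org [NeZero d] (hρ : PairBound d ρ) (y : Cube d) (hy : Ev y) :
    pr (fun f => typ y f ≠ typ org f) ≤ wt y * ρ := by
  induction h : wt y using Nat.strong_induction_on generalizing y with
  | _ n ih =>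
    rcases eq_org_or_exists y with rfl | ⟨i, hi⟩
    · have : wt (org : Cube d) = 0 := by simp [wt]
      rw [← h, this]
      simp [pr, ex_const]
    · rcases eq_org_or_exists (flip i y) with h' | ⟨i', hi'⟩
      · have := (ev_flip i y).not.2 (not_not.2 hy)
        rw [h'] at this
        exact absurd ev_org this
      · have hii : i ≠ i' := by
          rintro rfl
          rw [flip_apply_self, hi] at hi'
          simp at hi'
        have w1 := wt_flip_of_true hi
        have w2 := wt_flip_of_true hi'
        have h3 := ih _ (by omega) (flip i' (flip i y)) (by simpa using hy) rfl
        have h4 := pr_typ_pair_ne hρ hii y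
        have h5 : (wt (flip i' (flip i y)) : ℝ) + 2 = n := by
          rw [← h, ← w1, ← w2]; push_cast; ring
        have h6 : pr (fun f => typ y f ≠ typ org f) ≤
            pr (fun f => typ (flip i' (flip i y)) f ≠ typ y f) +
            pr (fun f => typ (flip i' (flip i y)) f ≠ typ org f) := by
          refine (pr_mono fun f _ hf => ?_).trans (pr_or_le _ _)
          by_contra! hc
          exact hf (hc.1.symm.trans hc.2)
        rw [← h5]
        linarith

lemma pr_typ_ne [NeZero d] (hρ : PairBound d ρ) (h0 : 0 ≤ ρ) (b z : Cube d) (h : Ev z ↔ Ev b) :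
    pr (fun f => typ z f ≠ typ b f) ≤ d * ρ := by
  have h1 := pr_typ_ne_org hρ (tr b z) ((ev_tr b z).2 h.symm)
  rw [← pr_shift b] at h1
  simp only [Ne, typ_shift_eq_iff, tr_tr, tr_org] at h1
  refine h1.trans (mul_le_mul_of_nonneg_right ?_ h0)
  exact_mod_cast wt_le _

/-- The vertices with the same parity as `b`. -/
noncomputable def side (b : Cube d) : Finset (Cube d) := univ.filter fun z => Ev z ↔ Ev b

lemma mem_side {b z : Cube d} : z ∈ side b ↔ (Ev z ↔ Ev b) := by simp [side]

lemma two_mul_card_side [NeZero d] (b : Cube d) : 2 * (side b).card = 2 ^ d := by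
  by_cases h : Ev b
  · have : side b = evens d := filter_congr fun z _ => by simp [h]
    rw [this, card_evens_eq_card_odds, two_mul_card_odds]
  · have : side b = odds d := filter_congr fun z _ => by simp [h]
    rw [this, two_mul_card_odds]

/-- The vertices on the side of `b` that look different from `b`. -/
noncomputable def atypical [NeZero d] (b : Cube d) (f : Cube d → ℤ) : Finset (Cube d) :=
  (side b).filter fun z => typ z f ≠ typ b f

lemma pr_atypical [NeZero d] (hρ : PairBound d ρ) (h0 : 0 ≤ ρ) (b : Cube d) {A : ℝ} (hA : 0 < A) :
    pr (fun f => A ≤ (atypical b f).card) ≤ 2 ^ d * (d * ρ) / A := by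
  refine (markov (fun f _ => by positivity) hA).trans ?_
  refine div_le_div_of_nonneg_right ?_ hA.le
  have h1 : ∀ f ∈ homs d, ((atypical b f).card : ℝ) =
      ∑ z ∈ side b, if typ z f ≠ typ b f then 1 else 0 := fun f _ => by
    unfold atypical; rw [← sum_boole]
  rw [ex_congr h1, ex_sum]
  simp only [ex_boole]
  refine (sum_le_card_nsmul _ _ (d * ρ) fun z hz => pr_typ_ne hρ h0 b z (mem_side.1 hz)).trans ?_
  rw [nsmul_eq_mul]
  refine mul_le_mul_of_nonneg_right ?_ (by positivity)
  have := two_mul_card_side b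
  exact_mod_cast (by omega : (side b).card ≤ 2 ^ d)

/-- `f` is constant on the side of `b` up to fewer than `A` exceptions. -/
def MostlyConst (A : ℝ) (b : Cube d) (f : Cube d → ℤ) : Prop :=
  ∃ c : ℤ, (((side b).filter fun v => f v ≠ c).card : ℝ) < A

lemma mostlyConst_shift (A : ℝ) (a b : Cube d) (f : Cube d → ℤ) :
    MostlyConst A b (shift a f) ↔ MostlyConst A (tr a b) f := by
  have key : ∀ c, ((side b).filter fun v => shift a f v ≠ c).card =
      ((side (tr a b)).filter fun v => f v ≠ c + f a).card := fun c => by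
    refine card_bij' (fun z _ => tr a z) (fun z _ => tr a z) ?_ ?_ (fun _ _ => tr_tr _ _)
      (fun _ _ => tr_tr _ _)
    · intro z hz
      rw [mem_filter] at hz ⊢
      simp only [mem_side, ev_tr, shift] at hz ⊢
      exact ⟨by rw [hz.1], by have := hz.2; omega⟩
    · intro z hz
      rw [mem_filter] at hz ⊢
      simp only [mem_side, ev_tr, shift, tr_tr] at hz ⊢
      exact ⟨by rw [hz.1]; tauto, by have := hz.2; omega⟩
  constructor
  · rintro ⟨c, hc⟩
    exact ⟨c + f a, by rwa [← key]⟩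
  · rintro ⟨c, hc⟩
    exact ⟨c - f a, by rwa [key, sub_add_cancel]⟩

lemma mostlyConst_or [NeZero d] {A : ℝ} {b : Cube d} {f : Cube d → ℤ}
    (h : ((atypical b f).card : ℝ) < A) :
    MostlyConst A b f ∨ MostlyConst A (flip 0 b) f := by
  by_cases hb : NbrConst b f
  · right
    refine ⟨f (flip 0 b), lt_of_le_of_lt ?_ h⟩
    rw [Nat.cast_le]
    refine card_le_card_of_injOn (flip 0) ?_ (flip_injective 0).injOn
    intro z hz
    simp only [coe_filter, Set.mem_ofPred_eq, mem_side, ev_flip] at hz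
    simp only [atypical, coe_filter, Set.mem_ofPred_eq, mem_side, ev_flip]
    refine ⟨by tauto, fun ht => hz.2 ?_⟩
    unfold typ at ht
    rw [Prod.mk.injEq] at ht
    have : NbrConst (flip 0 z) f := ht.1.mpr hb
    simpa [this, hb] using ht.2
  · left
    refine ⟨f b, lt_of_le_of_lt ?_ h⟩
    rw [Nat.cast_le]
    refine card_le_card fun z hz => ?_
    rw [mem_filter] at hz
    refine mem_filter.2 ⟨hz.1, fun ht => hz.2 ?_⟩
    unfold typ at ht
    rw [Prod.mk.injEq] at ht
    have : ¬ NbrConst z f := fun hz => hb (ht.1.mp hz)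
    simpa [this, hb] using ht.2

lemma nbrConst_of_mostlyConst [NeZero d] {A : ℝ} (hA : 2 * ((d + 1) * A) ≤ 2 ^ d) {b : Cube d}
    {f : Cube d → ℤ} (h : ((atypical b f).card : ℝ) < A) (hf : MostlyConst A (flip 0 b) f) :
    NbrConst b f := by
  by_contra hb
  obtain ⟨c, hc⟩ := hf
  set S := (side (flip 0 b)).filter fun v => f v ≠ c
  have hsub : side b ⊆ atypical b f ∪ (univ ×ˢ S).image fun p : Fin d × Cube d => flip p.1 p.2 := by
    intro z hz
    rw [mem_union, or_iff_not_imp_left]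
    intro hz'
    have ht : typ z f = typ b f := by
      by_contra h'
      exact hz' (mem_filter.2 ⟨hz, h'⟩)
    unfold typ at ht
    rw [Prod.mk.injEq] at ht
    have hzN : ¬ NbrConst z f := fun hz => hb (ht.1.mp hz)
    have : ∃ j, f (flip j z) ≠ c := by
      by_contra! h'
      exact hzN fun i j => by rw [h', h']
    obtain ⟨j, hj⟩ := this
    rw [mem_image]
    refine ⟨(j, flip j z), ?_, flip_flip j z⟩
    rw [mem_side] at hz
    simp only [mem_product, mem_univ, true_and, S, mem_filter, mem_side, ev_flip, hz]
    exact hj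
  have h1 := (card_le_card hsub).trans ((card_union_le _ _).trans
    (Nat.add_le_add_left card_image_le _))
  rw [card_product, card_univ, Fintype.card_fin] at h1
  have h2 : ((side b).card : ℝ) ≤ (atypical b f).card + d * S.card := by exact_mod_cast h1
  have h3 : 2 * ((side b).card : ℝ) = 2 ^ d := by exact_mod_cast two_mul_card_side b
  have h4 : (d : ℝ) * S.card ≤ d * A := mul_le_mul_of_nonneg_left hc.le (by positivity)
  linarith

lemma flip_org_inj {i j : Fin d} : flip i (org : Cube d) = flip j org ↔ i = j := by
  refine ⟨fun h => ?_, fun h => by rw [h]⟩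
  have := congrFun h i
  simpa [flip] using this

/-- Reassign the values at the neighbours of the origin. -/
noncomputable def reassign (s : Finset (Fin d)) (f : Cube d → ℤ) (x : Cube d) : ℤ :=
  if ∃ j, x = flip j org then (if ∃ j ∈ s, x = flip j org then 1 else -1) else f x

lemma reassign_flip_org (s : Finset (Fin d)) (f : Cube d → ℤ) (j : Fin d) :
    reassign s f (flip j org) = if j ∈ s then 1 else -1 := by
  simp [reassign, flip_org_inj]

lemma reassign_of_ev (s : Finset (Fin d)) (f : Cube d → ℤ) {x : Cube d} (hx : Ev x) :
    reassign s f x = f x := by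
  unfold reassign
  rw [if_neg]
  rintro ⟨j, rfl⟩
  rw [ev_flip] at hx
  exact hx ev_org

/-- The ball of radius two around the origin is flat. -/
def Flat (f : Cube d → ℤ) : Prop := NbrConst org f ∧ ∀ j, NbrConst (flip j org) f

lemma reassign_mem {f : Cube d → ℤ} (hf : f ∈ homs d) (h : Flat f) (s : Finset (Fin d)) :
    reassign s f ∈ homs d := by
  have h0 := (mem_homs.1 hf).1
  have key : ∀ i j, |reassign s f (flip i (flip j org)) - reassign s f (flip j org)| = 1 := by
    intro i j
    rw [reassign_of_ev s f (by simp [ev_org]), reassign_flip_org, h.2 j i j, flip_flip, h0]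
    split_ifs <;> simp
  rw [mem_homs]
  refine ⟨by rw [reassign_of_ev s f ev_org, h0], fun x i => ?_⟩
  by_cases h1 : ∃ j, x = flip j org
  · obtain ⟨j, rfl⟩ := h1
    exact key i j
  · by_cases h2 : ∃ j, flip i x = flip j org
    · obtain ⟨j, hj⟩ := h2
      have : x = flip i (flip j org) := by rw [← hj, flip_flip]
      rw [hj, this, abs_sub_comm]
      exact key i j
    · unfold reassign
      rw [if_neg h1, if_neg h2]
      exact (mem_homs.1 hf).2 x i

lemma pr_flat_le [NeZero d] : pr (Flat (d := d)) ≤ 2 * (1 / 2) ^ d := by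
  have hcard : ((homs d).filter Flat).card * 2 ^ d ≤ (homs d).card * 2 := by
    have h1 : ((((homs d).filter Flat) ×ˢ (univ : Finset (Finset (Fin d)))).card) ≤
        (homs d ×ˢ (univ : Finset Bool)).card := by
      refine card_le_card_of_injOn
        (fun p => (reassign p.2 p.1, decide (p.1 (flip 0 org) = 1))) ?_ ?_
      · rintro ⟨f, s⟩ hp
        simp only [coe_product, coe_filter, coe_univ, Set.mem_prod, Set.mem_ofPred_eq,
          Set.mem_univ, and_true] at hp
        simpa [em] using reassign_mem hp.1 hp.2 s
      · rintro ⟨f, s⟩ hp ⟨g, t⟩ hq h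
        simp only [coe_product, coe_filter, coe_univ, Set.mem_prod, Set.mem_ofPred_eq,
          Set.mem_univ, and_true] at hp hq
        simp only [Prod.mk.injEq, decide_eq_decide] at h ⊢
        have hst : s = t := by
          ext j
          have := congrFun h.1 (flip j org)
          rw [reassign_flip_org, reassign_flip_org] at this
          split_ifs at this <;> simp_all
        refine ⟨funext fun x => ?_, hst⟩
        by_cases hx : ∃ j, x = flip j org
        · obtain ⟨j, rfl⟩ := hx
          rw [hp.2.1 j 0, hq.2.1 j 0]
          have := step_org hp.1 0
          have := step_org hq.1 0
          omega
        · have := congrFun h.1 x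
          simpa only [reassign, if_neg hx] using this
    simpa [card_product] using h1
  have h2 : (((homs d).filter Flat).card : ℝ) * 2 ^ d ≤ (homs d).card * 2 := by
    exact_mod_cast hcard
  rw [pr_eq_div, div_le_iff₀ card_homs_pos', one_div, inv_pow]
  rw [← le_div_iff₀ (by positivity)] at h2
  refine h2.trans (le_of_eq ?_)
  ring

lemma pr_nbrConst_and [NeZero d] (hρ : PairBound d ρ) (h0 : 0 ≤ ρ) :
    pr (fun f => NbrConst (org : Cube d) f ∧ NbrConst (flip 0 org) f) ≤
      2 * (1 / 2) ^ d + d * (d * ρ) := by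
  have h1 : pr (fun f => NbrConst (org : Cube d) f ∧ NbrConst (flip 0 org) f) ≤
      pr (fun f : Cube d → ℤ => Flat f ∨
        ∃ j ∈ (univ : Finset (Fin d)), typ (flip j org) f ≠ typ (flip 0 org) f) := by
    refine pr_mono fun f _ hf => ?_
    by_contra! hc
    refine hc.1 ⟨hf.1, fun j => ?_⟩
    have := hc.2 j (mem_univ j)
    unfold typ at this
    rw [Prod.mk.injEq] at this
    exact this.1.mpr hf.2
  have h2 := pr_exists_le univ fun (j : Fin d) (f : Cube d → ℤ) =>
    typ (flip j org) f ≠ typ (flip 0 org) f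
  have h3 := sum_le_card_nsmul univ _ (d * ρ) fun (j : Fin d) _ =>
    pr_typ_ne hρ h0 (flip 0 org) (flip j org) (by simp)
  rw [nsmul_eq_mul, card_univ, Fintype.card_fin] at h3
  have h4 := pr_or_le (Flat (d := d)) fun f =>
    ∃ j ∈ (univ : Finset (Fin d)), typ (flip j org) f ≠ typ (flip 0 org) f
  have h5 := pr_flat_le (d := d)
  linarith

lemma abs_pr_mostlyConst_sub_half_le [NeZero d] (hρ : PairBound d ρ) (h0 : 0 ≤ ρ) {A : ℝ}
    (hA : 0 < A)
    (hA2 : 2 * ((d + 1) * A) ≤ 2 ^ d) :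
    |pr (MostlyConst A (org : Cube d)) - 1 / 2| ≤
      2 ^ d * (d * ρ) / A + (1 / 2) ^ d + d * (d * ρ) := by
  have hσ : 0 ≤ (d : ℝ) * (d * ρ) := by positivity
  have h1 : pr (MostlyConst A (flip 0 (org : Cube d))) = pr (MostlyConst A (org : Cube d)) := by
    rw [← pr_shift (flip 0 org) (MostlyConst A org)]
    simp only [mostlyConst_shift, tr_org]
  have h2 := pr_or_add_pr_and (MostlyConst A (org : Cube d)) (MostlyConst A (flip 0 org))
  have h3 := pr_le_one fun f => MostlyConst A (org : Cube d) f ∨ MostlyConst A (flip 0 org) f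
  have h4 : 1 - 2 ^ d * (d * ρ) / A ≤
      pr fun f => MostlyConst A (org : Cube d) f ∨ MostlyConst A (flip 0 org) f := by
    have h5 := pr_atypical hρ h0 org hA
    have h6 := pr_not fun f => A ≤ ((atypical (org : Cube d) f).card : ℝ)
    have h7 := pr_mono (d := d) (p := fun f => ¬ A ≤ ((atypical (org : Cube d) f).card : ℝ))
      fun f _ hf => mostlyConst_or (not_le.1 hf)
    linarith
  have h5 : pr (fun f => MostlyConst A (org : Cube d) f ∧ MostlyConst A (flip 0 org) f) ≤
      2 * (2 ^ d * (d * ρ) / A) + (2 * (1 / 2) ^ d + d * (d * ρ)) := by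
    have h6 := pr_atypical hρ h0 org hA
    have h7 := pr_atypical hρ h0 (flip 0 org) hA
    have h8 := pr_nbrConst_and hρ h0
    have h9 : pr (fun f => MostlyConst A (org : Cube d) f ∧ MostlyConst A (flip 0 org) f) ≤
        pr (fun f => A ≤ ((atypical (org : Cube d) f).card : ℝ) ∨
          (A ≤ ((atypical (flip 0 (org : Cube d)) f).card : ℝ) ∨
            (NbrConst (org : Cube d) f ∧ NbrConst (flip 0 org) f))) := by
      refine pr_mono fun f _ hf => ?_
      by_contra! hc
      refine hc.2.2 (nbrConst_of_mostlyConst hA2 hc.1 hf.2)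
        (nbrConst_of_mostlyConst hA2 hc.2.1 ?_)
      rw [flip_flip]; exact hf.1
    have h10 := pr_or_le (fun f => A ≤ ((atypical (org : Cube d) f).card : ℝ)) fun f =>
      (A ≤ ((atypical (flip 0 (org : Cube d)) f).card : ℝ) ∨
        (NbrConst (org : Cube d) f ∧ NbrConst (flip 0 org) f))
    have h11 := pr_or_le (fun f => A ≤ ((atypical (flip 0 (org : Cube d)) f).card : ℝ)) fun f =>
      NbrConst (org : Cube d) f ∧ NbrConst (flip 0 org) f
    linarith
  have h6 := pr_nonneg fun f => MostlyConst A (org : Cube d) f ∧ MostlyConst A (flip 0 org) f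
  have h7 : 0 ≤ 2 ^ d * (d * ρ) / A := by positivity
  have h8 : (0 : ℝ) ≤ (1 / 2) ^ d := by positivity
  rw [abs_le]
  constructor <;> linarith

lemma half_pow_le (n : ℕ) : ((1 : ℝ) / 2) ^ n ≤ Real.exp (-(n / 2)) := by
  have h : (1 : ℝ) / 2 ≤ Real.exp (-(1 / 2)) := by
    have := Real.add_one_le_exp (-(1 / 2) : ℝ)
    linarith
  refine (pow_le_pow_left₀ (by norm_num) h n).trans (le_of_eq ?_)
  rw [← Real.exp_nat_mul]
  congr 1
  ring

lemma exists_avoiding (i i' : Fin d) {m : ℕ} (hm : m + 2 ≤ d) :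
    ∃ B : Finset (Fin d), i ∉ B ∧ i' ∉ B ∧ B.card = m := by
  obtain ⟨B, hB, hc⟩ := exists_subset_card_eq (s := ({i, i'} : Finset (Fin d))ᶜ) (n := m) (by
    rw [card_compl, Fintype.card_fin]
    have := card_le_two (a := i) (b := i')
    omega)
  refine ⟨B, fun h => ?_, fun h => ?_, hc⟩ <;>
  · have := hB h
    simp at this

lemma codingError_le [NeZero d] (hd : 1 ≤ d) :
    codingError d (d / 2) ≤ 8 * d ^ 2 * Real.exp (-(d / 512)) := by
  have hd1 : (1 : ℝ) ≤ d := by exact_mod_cast hd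
  have hodd : 2 * ((odds d).card : ℝ) = 2 ^ d := by exact_mod_cast two_mul_card_odds
  have hodd' : ((odds d).card : ℝ) = 2 ^ d / 2 := by linarith
  have hlog : Real.log (2 * d + 1) ≤ 2 * d := by
    have := Real.log_le_sub_one_of_pos (show (0 : ℝ) < 2 * d + 1 by linarith)
    linarith
  have hpow : (2 : ℝ) ^ (d / 2) / (2 ^ d / 2) ≤ 2 * Real.exp (-(d / 512)) := by
    have h1 : (2 : ℝ) ^ (d / 2) / (2 ^ d / 2) = 2 * (1 / 2) ^ (d - d / 2) := by
      have : (2 : ℝ) ^ d = 2 ^ (d / 2) * 2 ^ (d - d / 2) := by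
        rw [← pow_add]; congr 1; omega
      rw [this, one_div, inv_pow]
      field_simp
    rw [h1]
    refine mul_le_mul_of_nonneg_left ((half_pow_le _).trans ?_) (by norm_num)
    rw [Real.exp_le_exp]
    have h2 : d ≤ 2 * (d - d / 2) := by omega
    have h3 : (d : ℝ) ≤ 2 * ((d - d / 2 : ℕ) : ℝ) := by exact_mod_cast h2
    linarith
  unfold codingError
  rw [hodd']
  have h4 : (2 : ℝ) ^ (d / 2) * (d + 1) * Real.log (2 * d + 1) / (2 ^ d / 2) =
      2 ^ (d / 2) / (2 ^ d / 2) * ((d + 1) * Real.log (2 * d + 1)) := by ring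
  rw [h4]
  have h5 : ((d : ℝ) + 1) * Real.log (2 * d + 1) ≤ 4 * d ^ 2 := by
    have := mul_le_mul_of_nonneg_left hlog (show (0 : ℝ) ≤ d + 1 by linarith)
    nlinarith
  have h6 := mul_le_mul hpow h5
    (mul_nonneg (by linarith) (Real.log_nonneg (by linarith))) (by positivity)
  linarith

lemma pairBound [NeZero d] (hd : 100 ≤ d) :
    PairBound d (80 * d ^ 3 * Real.exp (-(d / 512))) := by
  intro i i' hii
  obtain ⟨B, hi, hi', hB⟩ := exists_avoiding i i' (m := d / 2) (by omega)
  set E := Real.exp (-(d / 512 : ℝ)) with hE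
  have hE0 : 0 < E := Real.exp_pos _
  have hd1 : (100 : ℝ) ≤ d := by exact_mod_cast hd
  have hm : ((d / 2 : ℕ) : ℝ) ≤ d := by exact_mod_cast Nat.div_le_self d 2
  have hm2 : (d : ℝ) ≤ 4 * (d / 2 : ℕ) := by exact_mod_cast (by omega : d ≤ 4 * (d / 2))
  have hm48 : (48 : ℝ) ≤ (d / 2 : ℕ) := by exact_mod_cast (by omega : 48 ≤ d / 2)
  set lam : ℝ := 2 * Real.exp (-((d / 2 : ℕ) / 16 : ℝ)) with hlam
  have h0 : 0 < lam := by positivity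
  have h1 : lam ≤ 1 / 2 := by
    have h2 := Real.add_one_le_exp ((d / 2 : ℕ) / 16 : ℝ)
    have h3 : Real.exp (-((d / 2 : ℕ) / 16 : ℝ)) ≤ 1 / 4 := by
      rw [Real.exp_neg, inv_le_comm₀ (Real.exp_pos _) (by norm_num)]
      linarith
    linarith
  have hL : Real.log (2 / lam) = (d / 2 : ℕ) / 16 := by
    rw [hlam, div_mul_cancel_left₀ (by norm_num), ← Real.exp_neg, neg_neg, Real.log_exp]
  have hlamE : lam ≤ 2 * E := by
    refine mul_le_mul_of_nonneg_left (Real.exp_le_exp.2 ?_) (by norm_num)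
    linarith
  have ht : (1 / 2 : ℝ) ^ (d / 128) ≤ 2 * E := by
    have h2 := half_pow_le (d / 128 + 1)
    have h3 : Real.exp (-((d / 128 + 1 : ℕ) / 2 : ℝ)) ≤ E := by
      rw [hE, Real.exp_le_exp]
      have : (d : ℝ) ≤ 128 * (d / 128 + 1 : ℕ) := by
        exact_mod_cast (by omega : d ≤ 128 * (d / 128 + 1))
      linarith
    rw [pow_succ] at h2
    linarith
  have herr := codingError_le (d := d) (by omega)
  rw [← hB] at herr
  have hsq : 1 ≤ (d : ℝ) ^ 2 := one_le_pow₀ (by linarith)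
  have hEsq : E ≤ d ^ 2 * E := by nlinarith
  have hδ : ∀ j j', j ∉ B → j' ∉ B → j ≠ j' → pr (Deviates B j) ≤ 224 * d ^ 2 * E := by
    intro j j' hj hj' hjj
    have := pr_deviates_bound hj hj' hjj h0 h1 (by rw [hL, hB]) (t := d / 128) (by omega)
    linarith
  have key := pr_not_sameRough hi hi' hii (card_pos.1 (by omega)) h0 h1 (hδ i i' hi hi' hii)
    (hδ i' i hi' hi hii.symm)
  rw [hL] at key
  have h2 : (2 : ℝ) * ((d / 2 : ℕ) / 16) * (224 * d ^ 2 * E) ≤ 28 * d ^ 3 * E := by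
    have : (2 : ℝ) * ((d / 2 : ℕ) / 16) ≤ d / 8 := by linarith
    have := mul_le_mul_of_nonneg_right this (show 0 ≤ 224 * d ^ 2 * E by positivity)
    refine this.trans (le_of_eq ?_)
    ring
  have h3 : (d : ℝ) ^ 2 * E ≤ d ^ 3 * E := by
    refine mul_le_mul_of_nonneg_right ?_ hE0.le
    exact pow_le_pow_right₀ (by linarith) (by norm_num)
  have hlog2 : (1 : ℝ) / 2 ≤ Real.log 2 := by
    have := Real.log_two_gt_d9
    linarith
  have h4 := mul_le_mul_of_nonneg_right hlog2
    (pr_nonneg fun f => ¬ NbrConst org f ∧ ¬ SameRough org (flip i' (flip i org)) f)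
  linarith

lemma eventually_poly_mul_exp_le_one :
    ∀ᶠ d : ℕ in Filter.atTop, 161 * (d : ℝ) ^ 5 * Real.exp (-(d / 2048)) ≤ 1 := by
  have h1 := (Real.tendsto_pow_mul_exp_neg_atTop_nhds_zero 5).comp
    ((tendsto_natCast_atTop_atTop (R := ℝ)).atTop_div_const (show (0 : ℝ) < 2048 by norm_num))
  have h2 := h1.const_mul (161 * 2048 ^ 5 : ℝ)
  rw [mul_zero] at h2
  filter_upwards [h2.eventually (ge_mem_nhds one_pos)] with d hd
  refine le_trans (le_of_eq ?_) hd
  simp only [Function.comp_apply]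
  ring

lemma abs_pr_mostlyConst_le [NeZero d] (hd : 100 ≤ d)
    (h : 161 * (d : ℝ) ^ 5 * Real.exp (-(d / 2048)) ≤ 1) :
    |pr (MostlyConst ((2 * Real.exp (-(1 / 1024))) ^ d) (org : Cube d)) - 1 / 2| ≤
      Real.exp (-(1 / 2048) * d) := by
  have hd1 : (1 : ℝ) ≤ d := by exact_mod_cast (by omega : 1 ≤ d)
  set e := Real.exp (-(d / 2048 : ℝ)) with he
  have he0 : 0 < e := Real.exp_pos _
  have he1 : e ≤ 1 := Real.exp_le_one_iff.2 (by linarith)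
  have h1024 : Real.exp (-(1 / 1024)) ^ d = e ^ 2 := by
    rw [he, ← Real.exp_nat_mul, ← Real.exp_nat_mul]; congr 1; push_cast; ring
  have h512 : Real.exp (-(d / 512 : ℝ)) = e ^ 4 := by
    rw [he, ← Real.exp_nat_mul]; congr 1; push_cast; ring
  have hgoal : Real.exp (-(1 / 2048) * d : ℝ) = e := by rw [he]; congr 1; ring
  have hpow : ∀ k ≤ 5, (d : ℝ) ^ k ≤ d ^ 5 := fun k hk => pow_le_pow_right₀ hd1 hk
  have hA2 : 2 * (((d : ℝ) + 1) * (2 * Real.exp (-(1 / 1024))) ^ d) ≤ 2 ^ d := by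
    rw [mul_pow, h1024]
    have h2 : 2 * ((d : ℝ) + 1) * e ^ 2 ≤ 1 := by
      have h3 : 2 * ((d : ℝ) + 1) ≤ 161 * d ^ 5 := by
        have := hpow 1 (by norm_num)
        rw [pow_one] at this
        linarith
      have h4 : e ^ 2 ≤ e := by nlinarith
      exact (mul_le_mul h3 h4 (by positivity) (by positivity)).trans h
    have h5 : (0 : ℝ) < 2 ^ d := by positivity
    nlinarith
  have key := abs_pr_mostlyConst_sub_half_le (pairBound hd) (by positivity)
    (A := (2 * Real.exp (-(1 / 1024))) ^ d) (by positivity) hA2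
  refine key.trans ?_
  rw [hgoal, h512, mul_pow, h1024]
  have h2 : (2 : ℝ) ^ d * (d * (80 * d ^ 3 * e ^ 4)) / (2 ^ d * e ^ 2) = 80 * d ^ 4 * e ^ 2 := by
    field_simp
  have h3 : ((1 : ℝ) / 2) ^ d ≤ e ^ 2 := by
    refine (half_pow_le d).trans ?_
    rw [he, ← Real.exp_nat_mul, Real.exp_le_exp]
    push_cast
    linarith
  have h4 : 80 * (d : ℝ) ^ 4 * e ^ 2 ≤ 80 * d ^ 5 * e ^ 2 := by
    have := hpow 4 (by norm_num)
    gcongr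
  have h5 : (d : ℝ) * (d * (80 * d ^ 3 * e ^ 4)) ≤ 80 * d ^ 5 * e ^ 2 := by
    have : e ^ 4 ≤ e ^ 2 := pow_le_pow_of_le_one he0.le he1 (by norm_num)
    calc (d : ℝ) * (d * (80 * d ^ 3 * e ^ 4)) = 80 * d ^ 5 * e ^ 4 := by ring
      _ ≤ _ := by gcongr
  have h6 : e ^ 2 ≤ d ^ 5 * e ^ 2 := by
    have : (1 : ℝ) ≤ d ^ 5 := one_le_pow₀ hd1
    have : 0 < e ^ 2 := by positivity
    nlinarith
  have h7 : 161 * (d : ℝ) ^ 5 * e ^ 2 ≤ e := by nlinarith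
  rw [h2]
  linarith

lemma ncard_eq (α : ℝ) :
    (({f ∈ HomF d | ∃ c₁ : ℤ,
      (({v ∈ evenV d | f v ≠ c₁} : Set _).ncard : ℝ) < α ^ d} : Set _).ncard : ℝ) =
      pr (MostlyConst (α ^ d) (org : Cube d)) * (HomF d).ncard := by
  have h1 : ∀ (f : Cube d → ℤ) (c : ℤ), ({v ∈ evenV d | f v ≠ c} : Set _).ncard =
      ((side org).filter fun v => f v ≠ c).card := fun f c => by
    rw [← Set.ncard_coe_finset]
    congr 1
    ext v
    simp only [coe_filter, mem_side, ev_org, iff_true]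
    rfl
  simp only [h1]
  have h2 : ({f ∈ HomF d | ∃ c₁ : ℤ, ((((side org).filter fun v => f v ≠ c₁).card : ℕ) : ℝ) <
      α ^ d} : Set _) = ((homs d).filter (MostlyConst (α ^ d) org) : Finset _) := by
    ext f
    simp only [coe_filter, mem_homs']
    rfl
  rw [h2, ← coe_homs, Set.ncard_coe_finset, Set.ncard_coe_finset, pr_eq_div,
    div_mul_cancel₀ _ card_homs_pos'.ne']

end CubeHom

theorem mostly_constant_on_even_half :
    ∃ α : ℝ, 1 < α ∧ α < 2 ∧ ∃ c > (0:ℝ), ∃ d₀ : ℕ, ∀ d : ℕ, d₀ ≤ d →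
      |(({f ∈ HomF d | ∃ c₁ : ℤ,
            (({v ∈ evenV d | f v ≠ c₁} : Set _).ncard : ℝ) < α ^ d} : Set _).ncard : ℝ)
          - ((HomF d).ncard : ℝ) / 2| ≤
        Real.exp (-c * d) * (HomF d).ncard := by
  obtain ⟨d₁, hd₁⟩ := Filter.eventually_atTop.1 CubeHom.eventually_poly_mul_exp_le_one
  have h1 := Real.add_one_le_exp (-(1 / 1024) : ℝ)
  have h2 : Real.exp (-(1 / 1024)) < 1 := Real.exp_lt_one_iff.2 (by norm_num)
  refine ⟨2 * Real.exp (-(1 / 1024)), by linarith, by linarith, 1 / 2048, by norm_num,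
    max 100 d₁, fun d hd => ?_⟩
  have hd100 := le_of_max_le_left hd
  have : NeZero d := ⟨by omega⟩
  have key := CubeHom.abs_pr_mostlyConst_le hd100 (hd₁ d (le_of_max_le_right hd))
  rw [CubeHom.ncard_eq, show ∀ p n : ℝ, p * n - n / 2 = (p - 1 / 2) * n from fun p n => by ring,
    abs_mul, Nat.abs_cast]
  exact mul_le_mul_of_nonneg_right key (Nat.cast_nonneg _)
end

section
/- For all constants α with 1 < α < 2, c > 0 and c₁ > 0 there exist constants c₂ > 0 and d₀ such that the following holds for all integers d ≥ d₀. Suppose g assigns a nonnegative real number to every subset of E and satisfies: (i) g(A) = ∏ g(A_i), the product over the 2-components A_i of A, for every A ⊆ E; (ii) g({y}) = c·2^{−d} for every y ∈ E; and (iii) ∑_{A ⊆ E nice} g(A) ≤ e^{−c₁ d}. Then for every D ⊆ E, | ∑_{A ⊆ D, |A| < α^d} g(A) − (1 + c·2^{−d})^{|D|} | ≤ e^{−c₂ d}. -/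
/-- Graph (Hamming) distance in the cube `Q_d`. -/
def hamDist {d : ℕ} (u v : Fin d → Bool) : ℕ :=
  (Finset.univ.filter fun i => u i ≠ v i).card

/-- `A` is 2-linked: any two of its vertices are connected by a chain of steps,
inside `A`, of Hamming distance at most 2 each. -/
def twoLinked {d : ℕ} (A : Set (Fin d → Bool)) : Prop :=
  ∀ u ∈ A, ∀ v ∈ A, Relation.ReflTransGen (fun x y => y ∈ A ∧ hamDist x y ≤ 2) u v

/-- `C` is a 2-component of `A`: a maximal 2-linked (nonempty) subset of `A`. -/
def twoComponent {d : ℕ} (C A : Set (Fin d → Bool)) : Prop :=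
  C.Nonempty ∧ C ⊆ A ∧ twoLinked C ∧
    ∀ C' : Set (Fin d → Bool), C ⊆ C' → C' ⊆ A → twoLinked C' → C' = C

/-- Every subset of a finite set is covered by its 2-components. -/
lemma exists_twoComponent_mem {d : ℕ} {A : Set (Fin d → Bool)} {v : Fin d → Bool}
    (hv : v ∈ A) : ∃ C, twoComponent C A ∧ v ∈ C := by
  have hfin : {C : Set (Fin d → Bool) | C ⊆ A ∧ twoLinked C}.Finite := Set.toFinite _
  have hsing : {v} ∈ {C : Set (Fin d → Bool) | C ⊆ A ∧ twoLinked C} := by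
    refine ⟨by simpa using hv, ?_⟩
    rintro _ rfl _ rfl
    exact Relation.ReflTransGen.refl
  obtain ⟨C, hvC, hC⟩ := hfin.exists_le_maximal hsing
  have hmem : v ∈ C := hvC rfl
  exact ⟨C, ⟨⟨v, hmem⟩, hC.prop.1, hC.prop.2, fun C' h₁ h₂ h₃ =>
    (hC.eq_of_le ⟨h₂, h₃⟩ h₁).symm⟩, hmem⟩

/-- A 2-linked subset of a set whose distinct points are at distance more than 2 is
a subsingleton. -/
lemma twoLinked.eq_of_separated {d : ℕ} {C : Set (Fin d → Bool)} (hC : twoLinked C)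
    (hsep : ∀ u ∈ C, ∀ v ∈ C, hamDist u v ≤ 2 → u = v) {u v : Fin d → Bool}
    (hu : u ∈ C) (hv : v ∈ C) : u = v := by
  have key : ∀ w, Relation.ReflTransGen (fun x y => y ∈ C ∧ hamDist x y ≤ 2) u w → u = w := by
    intro w h
    induction h with
    | refl => rfl
    | tail _ hbc ih => subst ih; exact hsep _ hu _ hbc.1 hbc.2
  exact key v (hC u hu v hv)

lemma twoComponent_iff_of_separated {d : ℕ} {T C : Set (Fin d → Bool)}
    (hsep : ∀ u ∈ T, ∀ v ∈ T, hamDist u v ≤ 2 → u = v) :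
    twoComponent C T ↔ ∃ v ∈ T, C = {v} := by
  have hsub : ∀ C ⊆ T, twoLinked C → ∀ v ∈ C, C = {v} := fun C hCT hC v hv =>
    Set.eq_singleton_iff_unique_mem.2 ⟨hv, fun u hu =>
      hC.eq_of_separated (fun x hx y hy => hsep x (hCT hx) y (hCT hy)) hu hv⟩
  constructor
  · rintro ⟨⟨v, hv⟩, hCT, hC, -⟩
    exact ⟨v, hCT hv, hsub C hCT hC v hv⟩
  · rintro ⟨v, hv, rfl⟩
    refine ⟨Set.singleton_nonempty v, by simpa using hv, ?_, fun C' h₁ h₂ h₃ =>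
      hsub C' h₂ h₃ v (h₁ rfl)⟩
    rintro _ rfl _ rfl
    exact Relation.ReflTransGen.refl

lemma finprod_prop_eq_prod_filter {ι M : Type*} [Fintype ι] [CommMonoid M] (P : ι → Prop)
    [DecidablePred P] (f : ι → M) : ∏ᶠ (i) (_ : P i), f i = ∏ i with P i, f i := by
  rw [finprod_eq_prod_of_fintype, Finset.prod_filter]
  exact Finset.prod_congr rfl fun i _ => finprod_eq_if

lemma finsum_prop_eq_sum_filter {ι M : Type*} [Fintype ι] [AddCommMonoid M] (P : ι → Prop)
    [DecidablePred P] (f : ι → M) : ∑ᶠ (i) (_ : P i), f i = ∑ i with P i, f i := by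
  rw [finsum_eq_sum_of_fintype, Finset.sum_filter]
  exact Finset.sum_congr rfl fun i _ => finsum_eq_if

open Classical in
/-- Multiplicativity over 2-components makes the weight of a separated set a power. -/
lemma weight_eq_pow_of_separated {d : ℕ} {g : Set (Fin d → Bool) → ℝ} {p : ℝ}
    {T : Finset (Fin d → Bool)}
    (hmul : g T = ∏ᶠ (C : Set (Fin d → Bool)) (_ : twoComponent C T), g C)
    (hsing : ∀ y ∈ T, g {y} = p)
    (hsep : ∀ u ∈ T, ∀ v ∈ T, hamDist u v ≤ 2 → u = v) : g T = p ^ T.card := by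
  have himage : Finset.univ.filter (fun C => twoComponent C (T : Set (Fin d → Bool)))
      = T.image (fun v => ({v} : Set (Fin d → Bool))) := by
    ext C
    simp only [Finset.mem_filter, Finset.mem_univ, true_and, Finset.mem_image,
      twoComponent_iff_of_separated (T := (T : Set (Fin d → Bool))) hsep, Finset.mem_coe]
    exact ⟨fun ⟨v, hv, h⟩ => ⟨v, hv, h.symm⟩, fun ⟨v, hv, h⟩ => ⟨v, hv, h.symm⟩⟩
  rw [hmul, finprod_prop_eq_prod_filter, himage,
    Finset.prod_image (Set.singleton_injective.injOn), Finset.prod_congr rfl hsing,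
    Finset.prod_const]

open Classical in
/-- The sum of a multiplicative weight over small sets is at most the product of
`1 + g C` over small 2-linked sets `C`. -/
lemma sum_weight_le_prod {d : ℕ} {g : Set (Fin d → Bool) → ℝ} {D : Finset (Fin d → Bool)}
    {m : ℝ} (hnonneg : ∀ A ⊆ (D : Set (Fin d → Bool)), 0 ≤ g A)
    (hmul : ∀ A ⊆ (D : Set (Fin d → Bool)),
      g A = ∏ᶠ (C : Set (Fin d → Bool)) (_ : twoComponent C A), g C) :
    ∑ T ∈ D.powerset with (T.card : ℝ) < m, g T ≤
      ∏ C : Set (Fin d → Bool) with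
        C ⊆ (D : Set (Fin d → Bool)) ∧ C.Nonempty ∧ (C.ncard : ℝ) < m ∧ twoLinked C, (1 + g C) := by
  set comps : Finset (Fin d → Bool) → Finset (Set (Fin d → Bool)) :=
    fun T => Finset.univ.filter (fun C => twoComponent C (T : Set (Fin d → Bool))) with hcomps
  have hsub : ∀ T T', comps T = comps T' → T ⊆ T' := by
    intro T T' h v hv
    obtain ⟨C, hC, hvC⟩ := exists_twoComponent_mem (A := (T : Set (Fin d → Bool))) hv
    have : C ∈ comps T' := h ▸ (by simpa [hcomps] using hC)
    have hC' : twoComponent C (T' : Set (Fin d → Bool)) := by simpa [hcomps] using this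
    exact hC'.2.1 hvC
  have hinj : Function.Injective comps := fun T T' h =>
    (hsub T T' h).antisymm (hsub T' T h.symm)
  rw [Finset.prod_one_add]
  calc ∑ T ∈ D.powerset with (T.card : ℝ) < m, g T
      = ∑ T ∈ D.powerset with (T.card : ℝ) < m, ∏ C ∈ comps T, g C := by
        refine Finset.sum_congr rfl fun T hT => ?_
        rw [Finset.mem_filter, Finset.mem_powerset] at hT
        rw [hmul T (by exact_mod_cast hT.1), finprod_prop_eq_prod_filter]
    _ = ∑ F ∈ (D.powerset.filter fun T => (T.card : ℝ) < m).image comps, ∏ C ∈ F, g C := by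
        rw [Finset.sum_image hinj.injOn]
    _ ≤ _ := by
        refine Finset.sum_le_sum_of_subset_of_nonneg ?_ ?_
        · intro F hF
          obtain ⟨T, hT, rfl⟩ := Finset.mem_image.1 hF
          rw [Finset.mem_filter, Finset.mem_powerset] at hT
          rw [Finset.mem_powerset]
          intro C hC
          have hC : twoComponent C (T : Set (Fin d → Bool)) := by simpa [hcomps] using hC
          simp only [Finset.mem_filter, Finset.mem_univ, true_and]
          refine ⟨hC.2.1.trans (by exact_mod_cast hT.1), hC.1, lt_of_le_of_lt ?_ hT.2, hC.2.2.1⟩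
          have := Set.ncard_le_ncard hC.2.1
          rw [Set.ncard_coe_finset] at this
          exact_mod_cast this
        · intro F hF _
          refine Finset.prod_nonneg fun C hC => hnonneg C ?_
          have := Finset.mem_powerset.1 hF hC
          simp only [Finset.mem_filter, Finset.mem_univ, true_and] at this
          exact this.1

open Classical in
/-- Splitting the 2-linked sets into singletons and nice sets. -/
lemma sum_weight_le {d : ℕ} {g : Set (Fin d → Bool) → ℝ} {D : Finset (Fin d → Bool)}
    {m p ε : ℝ} (hp : 0 ≤ p) (hnonneg : ∀ A ⊆ (D : Set (Fin d → Bool)), 0 ≤ g A)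
    (hmul : ∀ A ⊆ (D : Set (Fin d → Bool)),
      g A = ∏ᶠ (C : Set (Fin d → Bool)) (_ : twoComponent C A), g C)
    (hsing : ∀ y ∈ D, g {y} = p)
    (hnice : ∑ A : Set (Fin d → Bool) with
      A ⊆ (D : Set (Fin d → Bool)) ∧ (A.ncard : ℝ) < m ∧ twoLinked A ∧ 2 ≤ A.ncard, g A ≤ ε) :
    ∑ T ∈ D.powerset with (T.card : ℝ) < m, g T ≤ (1 + p) ^ D.card * Real.exp ε := by
  refine (sum_weight_le_prod hnonneg hmul).trans ?_
  set S₁ : Finset (Set (Fin d → Bool)) := D.image fun v => ({v} : Set (Fin d → Bool)) with hS₁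
  set S₂ : Finset (Set (Fin d → Bool)) := Finset.univ.filter fun A =>
    A ⊆ (D : Set (Fin d → Bool)) ∧ (A.ncard : ℝ) < m ∧ twoLinked A ∧ 2 ≤ A.ncard with hS₂
  have hsub₂ : ∀ A ∈ S₂, A ⊆ (D : Set (Fin d → Bool)) := fun A hA => (Finset.mem_filter.1 hA).2.1
  have hsub₁ : ∀ A ∈ S₁, A ⊆ (D : Set (Fin d → Bool)) := by
    intro A hA
    obtain ⟨v, hv, rfl⟩ := Finset.mem_image.1 hA
    simpa using hv
  have hdisj : Disjoint S₁ S₂ := by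
    rw [Finset.disjoint_left]
    intro A hA hA'
    obtain ⟨v, hv, rfl⟩ := Finset.mem_image.1 hA
    have := (Finset.mem_filter.1 hA').2.2.2.2
    simp at this
  calc _ ≤ ∏ C ∈ S₁ ∪ S₂, (1 + g C) := by
        refine Finset.prod_le_prod_of_subset_of_one_le ?_ ?_ ?_
        · intro C hC
          simp only [Finset.mem_filter, Finset.mem_univ, true_and] at hC
          rw [Finset.mem_union]
          obtain ⟨hCD, ⟨v, hv⟩, hm, hl⟩ := hC
          by_cases h2 : 2 ≤ C.ncard
          · exact Or.inr (by simp [hS₂, hCD, hm, hl, h2])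
          · left
            have hpos : 0 < C.ncard := (Set.ncard_pos).2 ⟨v, hv⟩
            obtain ⟨w, rfl⟩ := Set.ncard_eq_one.1 (show C.ncard = 1 by omega)
            exact Finset.mem_image.2 ⟨w, by simpa using hCD, rfl⟩
        · intro C hC
          have := hnonneg C (by simp only [Finset.mem_filter] at hC; exact hC.2.1)
          linarith
        · intro C hC _
          have := hnonneg C ((Finset.mem_union.1 hC).elim (hsub₁ C) (hsub₂ C))
          linarith
    _ = (∏ C ∈ S₁, (1 + g C)) * ∏ C ∈ S₂, (1 + g C) := Finset.prod_union hdisj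
    _ ≤ (1 + p) ^ D.card * Real.exp ε := by
        have h₁ : ∏ C ∈ S₁, (1 + g C) = (1 + p) ^ D.card := by
          rw [hS₁, Finset.prod_image Set.singleton_injective.injOn,
            Finset.prod_congr rfl (fun v hv => by rw [hsing v hv]), Finset.prod_const]
        have h₂ : ∏ C ∈ S₂, (1 + g C) ≤ Real.exp ε := by
          refine le_trans ?_ (Real.exp_le_exp.2 hnice)
          rw [Real.exp_sum]
          refine Finset.prod_le_prod (fun C hC => ?_) (fun C hC => ?_)
          · have := hnonneg C (hsub₂ C hC); linarith
          · have := Real.add_one_le_exp (g C); linarith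
        rw [h₁]
        gcongr

/-- Binomial expansion over the subsets of a finite set. -/
lemma sum_powerset_pow_card {ι : Type*} (D : Finset ι) (p : ℝ) :
    ∑ T ∈ D.powerset, p ^ T.card = (1 + p) ^ D.card := by
  have := Finset.prod_one_add (f := fun _ : ι => p) D
  simpa using this.symm

/-- Exponential tail bound for the binomial expansion. -/
lemma sum_pow_card_large_le {ι : Type*} (D : Finset ι) {p m : ℝ} (hp : 0 ≤ p) :
    ∑ T ∈ D.powerset with m ≤ (T.card : ℝ), p ^ T.card ≤
      Real.exp (-m) * (1 + Real.exp 1 * p) ^ D.card := by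
  rw [← sum_powerset_pow_card, Finset.mul_sum]
  calc ∑ T ∈ D.powerset with m ≤ (T.card : ℝ), p ^ T.card
      ≤ ∑ T ∈ D.powerset with m ≤ (T.card : ℝ), Real.exp (-m) * (Real.exp 1 * p) ^ T.card := by
        refine Finset.sum_le_sum fun T hT => ?_
        have hm := (Finset.mem_filter.1 hT).2
        rw [mul_pow, ← mul_assoc, ← Real.exp_nat_mul, ← Real.exp_add]
        refine le_mul_of_one_le_left (by positivity) (Real.one_le_exp ?_)
        linarith
    _ ≤ _ := Finset.sum_le_sum_of_subset_of_nonneg (Finset.filter_subset _ _)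
        fun _ _ _ => by positivity

/-- The subsets containing two prescribed points contribute at most `p ^ 2 (1 + p) ^ |D|`. -/
lemma sum_pow_card_pair_le {ι : Type*} [DecidableEq ι] (D : Finset ι) {p : ℝ} (hp : 0 ≤ p)
    {u v : ι} (huv : u ≠ v) :
    ∑ T ∈ D.powerset with u ∈ T ∧ v ∈ T, p ^ T.card ≤ p ^ 2 * (1 + p) ^ D.card := by
  rw [← sum_powerset_pow_card, Finset.mul_sum]
  set F := D.powerset.filter fun T => u ∈ T ∧ v ∈ T with hF
  have hpair : ∀ T ∈ F, {u, v} ⊆ T := by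
    intro T hT
    have := (Finset.mem_filter.1 hT).2
    simp [Finset.insert_subset_iff, this.1, this.2]
  have hinj : Set.InjOn (fun T : Finset ι => T \ {u, v}) F := by
    intro T hT T' hT' h
    have h' : T \ {u, v} = T' \ {u, v} := h
    rw [← Finset.sdiff_union_of_subset (hpair T hT), h',
      Finset.sdiff_union_of_subset (hpair T' hT')]
  calc ∑ T ∈ F, p ^ T.card = ∑ T ∈ F, p ^ 2 * p ^ (T \ {u, v}).card := by
        refine Finset.sum_congr rfl fun T hT => ?_
        rw [← pow_add]
        congr 1
        have h₁ := Finset.card_sdiff_add_card_eq_card (hpair T hT)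
        rw [Finset.card_pair huv] at h₁
        omega
    _ = ∑ T ∈ F.image (fun T => T \ {u, v}), p ^ 2 * p ^ T.card :=
        (Finset.sum_image (f := fun T : Finset ι => p ^ 2 * p ^ T.card) hinj).symm
    _ ≤ _ := by
        refine Finset.sum_le_sum_of_subset_of_nonneg ?_ fun _ _ _ => by positivity
        intro T hT
        obtain ⟨T', hT', rfl⟩ := Finset.mem_image.1 hT
        exact Finset.mem_powerset.2 (Finset.sdiff_subset.trans
          (Finset.mem_powerset.1 (Finset.mem_filter.1 hT').1))

/-- The vertex obtained from `u` by flipping the coordinates `i` and `j` (only once when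
`i = j`). -/
def flipTwo {d : ℕ} (u : Fin d → Bool) (i j : Fin d) : Fin d → Bool :=
  fun k => if k = i ∨ k = j then !u k else u k

lemma ne_flipTwo {d : ℕ} (u : Fin d → Bool) (i j : Fin d) : u ≠ flipTwo u i j := by
  intro h
  have := congrFun h i
  simp [flipTwo] at this

lemma exists_eq_flipTwo {d : ℕ} {u v : Fin d → Bool} (h : hamDist u v ≤ 2) (huv : u ≠ v) :
    ∃ i j, v = flipTwo u i j := by
  obtain ⟨i, j, hij⟩ : ∃ i j, (Finset.univ.filter fun k => u k ≠ v k) = {i, j} := by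
    unfold hamDist at h
    have hpos : 0 < (Finset.univ.filter fun k => u k ≠ v k).card := by
      obtain ⟨k, hk⟩ := Function.ne_iff.1 huv
      exact Finset.card_pos.2 ⟨k, by simpa using hk⟩
    obtain h1 | h2 : (Finset.univ.filter fun k => u k ≠ v k).card = 1 ∨
        (Finset.univ.filter fun k => u k ≠ v k).card = 2 := by omega
    · obtain ⟨i, hi⟩ := Finset.card_eq_one.1 h1
      exact ⟨i, i, by simpa using hi⟩
    · obtain ⟨i, j, -, hij⟩ := Finset.card_eq_two.1 h2
      exact ⟨i, j, hij⟩
  refine ⟨i, j, funext fun k => ?_⟩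
  have hk : u k ≠ v k ↔ k = i ∨ k = j := by simpa using Finset.ext_iff.1 hij k
  unfold flipTwo
  split_ifs with hk'
  · have := hk.2 hk'
    cases hu : u k <;> cases hv : v k <;> simp_all
  · have := mt hk.1 hk'
    push Not at this
    exact this.symm

open Classical in
/-- Separated small sets already account for most of the binomial expansion. -/
lemma pow_card_sub_le_sum_weight {d : ℕ} {g : Set (Fin d → Bool) → ℝ}
    {D : Finset (Fin d → Bool)} {m p : ℝ} (hp : 0 ≤ p)
    (hnonneg : ∀ A ⊆ (D : Set (Fin d → Bool)), 0 ≤ g A)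
    (hmul : ∀ A ⊆ (D : Set (Fin d → Bool)),
      g A = ∏ᶠ (C : Set (Fin d → Bool)) (_ : twoComponent C A), g C)
    (hsing : ∀ y ∈ D, g {y} = p) :
    (1 + p) ^ D.card ≤ ∑ T ∈ D.powerset with (T.card : ℝ) < m, g T
      + (Real.exp (-m) * (1 + Real.exp 1 * p) ^ D.card
        + 2 ^ d * d ^ 2 * (p ^ 2 * (1 + p) ^ D.card)) := by
  set sep : Finset (Fin d → Bool) → Prop :=
    fun T => ∀ u ∈ T, ∀ v ∈ T, hamDist u v ≤ 2 → u = v with hsep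
  set near : (Fin d → Bool) × Fin d × Fin d → Finset (Finset (Fin d → Bool)) :=
    fun q => D.powerset.filter fun T => q.1 ∈ T ∧ flipTwo q.1 q.2.1 q.2.2 ∈ T with hnear
  have hcover : D.powerset ⊆ (D.powerset.filter fun T => (T.card : ℝ) < m ∧ sep T) ∪
      ((D.powerset.filter fun T => m ≤ (T.card : ℝ)) ∪ Finset.univ.biUnion near) := by
    intro T hT
    by_cases hm : (T.card : ℝ) < m
    · by_cases hs : sep T
      · exact Finset.mem_union_left _ (Finset.mem_filter.2 ⟨hT, hm, hs⟩)
      · refine Finset.mem_union_right _ (Finset.mem_union_right _ ?_)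
        simp only [hsep] at hs
        push Not at hs
        obtain ⟨u, hu, v, hv, huv, hne⟩ := hs
        obtain ⟨i, j, rfl⟩ := exists_eq_flipTwo huv hne
        exact Finset.mem_biUnion.2 ⟨(u, i, j), Finset.mem_univ _,
          Finset.mem_filter.2 ⟨hT, hu, hv⟩⟩
    · exact Finset.mem_union_right _ (Finset.mem_union_left _
        (Finset.mem_filter.2 ⟨hT, not_lt.1 hm⟩))
  have hunion : ∀ S₁ S₂ : Finset (Finset (Fin d → Bool)),
      ∑ T ∈ S₁ ∪ S₂, p ^ T.card ≤ ∑ T ∈ S₁, p ^ T.card + ∑ T ∈ S₂, p ^ T.card := by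
    intro S₁ S₂
    rw [← Finset.sum_union_inter]
    exact le_add_of_nonneg_right (Finset.sum_nonneg fun _ _ => by positivity)
  have hbiUnion : ∀ s : Finset ((Fin d → Bool) × Fin d × Fin d),
      ∑ T ∈ s.biUnion near, p ^ T.card ≤ ∑ q ∈ s, ∑ T ∈ near q, p ^ T.card := by
    intro s
    induction s using Finset.induction_on with
    | empty => simp
    | insert q s hq ih =>
      rw [Finset.biUnion_insert, Finset.sum_insert hq]
      exact (hunion _ _).trans (by gcongr)
  have hseparated : ∑ T ∈ D.powerset with (T.card : ℝ) < m ∧ sep T, p ^ T.card ≤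
      ∑ T ∈ D.powerset with (T.card : ℝ) < m, g T := by
    calc _ = ∑ T ∈ D.powerset with (T.card : ℝ) < m ∧ sep T, g T := by
          refine Finset.sum_congr rfl fun T hT => ?_
          obtain ⟨hTD, -, hs⟩ := Finset.mem_filter.1 hT
          rw [Finset.mem_powerset] at hTD
          exact (weight_eq_pow_of_separated (hmul T (by exact_mod_cast hTD))
            (fun y hy => hsing y (hTD hy)) hs).symm
      _ ≤ _ := by
          refine Finset.sum_le_sum_of_subset_of_nonneg ?_ fun T hT _ => hnonneg T ?_
          · exact Finset.monotone_filter_right _ fun T _ h => h.1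
          · exact_mod_cast Finset.mem_powerset.1 (Finset.mem_filter.1 hT).1
  have hclose : ∑ T ∈ Finset.univ.biUnion near, p ^ T.card ≤
      2 ^ d * d ^ 2 * (p ^ 2 * (1 + p) ^ D.card) := by
    calc _ ≤ ∑ q, ∑ T ∈ near q, p ^ T.card := hbiUnion _
      _ ≤ ∑ _q : (Fin d → Bool) × Fin d × Fin d, p ^ 2 * (1 + p) ^ D.card :=
          Finset.sum_le_sum fun q _ => sum_pow_card_pair_le D hp (ne_flipTwo _ _ _)
      _ = _ := by
          rw [Finset.sum_const, nsmul_eq_mul, Finset.card_univ]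
          simp only [Fintype.card_prod, Fintype.card_pi, Fintype.card_bool, Fintype.card_fin,
            Finset.prod_const, Finset.card_univ]
          push_cast
          ring
  calc (1 + p) ^ D.card = ∑ T ∈ D.powerset, p ^ T.card := (sum_powerset_pow_card D p).symm
    _ ≤ _ := Finset.sum_le_sum_of_subset_of_nonneg hcover fun _ _ _ => by positivity
    _ ≤ _ := (hunion _ _).trans (add_le_add hseparated ((hunion _ _).trans
        (add_le_add (sum_pow_card_large_le D hp) hclose)))

/-- A power `(1 + c 2 ^ (-d)) ^ N` with `N ≤ 2 ^ d` is at most `exp c`. -/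
lemma one_add_pow_le_exp {d N : ℕ} (hN : N ≤ 2 ^ d) {c p : ℝ} (hp : 0 ≤ p)
    (hpc : 2 ^ d * p = c) : (1 + p) ^ N ≤ Real.exp c := by
  have h1 : 1 + p ≤ Real.exp p := by linarith [Real.add_one_le_exp p]
  calc (1 + p) ^ N ≤ (1 + p) ^ (2 ^ d) := pow_le_pow_right₀ (by linarith) hN
    _ ≤ Real.exp p ^ (2 ^ d) := pow_le_pow_left₀ (by linarith) h1 _
    _ = Real.exp c := by rw [← Real.exp_nat_mul, ← hpc]; push_cast; rfl

open Filter Topology in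
/-- The error terms of both bounds are eventually exponentially small. -/
lemma exists_error_bounds {α c c₁ : ℝ} (hα : 1 < α) (hc₁ : 0 < c₁) :
    ∃ c₂ > (0 : ℝ), ∃ d₀ : ℕ, ∀ d : ℕ, d₀ ≤ d →
      Real.exp c * (2 * Real.exp (-c₁ * d)) ≤ Real.exp (-c₂ * d) ∧
      Real.exp (-α ^ d) * Real.exp (Real.exp 1 * c)
        + c ^ 2 * Real.exp c * (d ^ 2 * (1 / 2) ^ d) ≤ Real.exp (-c₂ * d) := by
  set c₂ : ℝ := min (c₁ / 2) (1 / 4) with hc₂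
  have hc₂pos : 0 < c₂ := lt_min (by positivity) (by norm_num)
  have hc₂c₁ : c₂ ≤ c₁ / 2 := min_le_left _ _
  have hc₂q : c₂ ≤ 1 / 4 := min_le_right _ _
  have hexp : Real.exp (1 / 4) < 2 := by
    have h : (1 / 4 : ℝ) < Real.log 2 := by linarith [Real.log_two_gt_d9]
    rw [← Real.exp_log (show (0 : ℝ) < 2 by norm_num)]
    exact Real.exp_lt_exp.2 h
  have hpoly : Tendsto (fun d : ℕ => c ^ 2 * Real.exp c *
      ((d : ℝ) ^ 2 * (Real.exp (1 / 4) / 2) ^ d)) atTop (𝓝 0) := by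
    have := (tendsto_pow_const_mul_const_pow_of_abs_lt_one 2
      (r := Real.exp (1 / 4) / 2) (by rw [abs_of_pos (by positivity)]; linarith)).const_mul
      (c ^ 2 * Real.exp c)
    simpa using this
  have hlin : Tendsto (fun d : ℕ => (d : ℝ) ^ 1 * (1 / α) ^ d) atTop (𝓝 0) :=
    tendsto_pow_const_mul_const_pow_of_abs_lt_one 1 (by
      rw [abs_of_pos (by positivity), div_lt_one (by linarith)]; exact hα)
  have hlarge : Tendsto (fun d : ℕ => (d : ℝ)) atTop atTop := tendsto_natCast_atTop_atTop
  have hlarge₁ : Tendsto (fun d : ℕ => c₁ / 2 * (d : ℝ)) atTop atTop :=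
    hlarge.const_mul_atTop (by positivity)
  obtain ⟨d₀, hd₀⟩ := eventually_atTop.1
    ((hpoly.eventually_le_const (show (0 : ℝ) < 1 / 2 by norm_num)).and
    ((hlin.eventually_le_const (show (0 : ℝ) < 1 / 2 by norm_num)).and
    ((hlarge.eventually_ge_atTop (Real.exp 1 * c + Real.log 2)).and
    (hlarge₁.eventually_ge_atTop (c + Real.log 2)))))
  refine ⟨c₂, hc₂pos, d₀, fun d hd => ?_⟩
  obtain ⟨h₁, h₂, h₃, h₄⟩ := hd₀ d hd
  have hd0 : (0 : ℝ) ≤ d := Nat.cast_nonneg d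
  have htwo : Real.exp (Real.log 2) = 2 := Real.exp_log (by norm_num)
  constructor
  · rw [← htwo, ← Real.exp_add, ← Real.exp_add, Real.exp_le_exp]
    nlinarith
  · have hαd : 2 * (d : ℝ) ≤ α ^ d := by
      rw [pow_one, one_div, inv_pow, ← div_eq_mul_inv, div_le_iff₀ (by positivity)] at h₂
      linarith
    have htail : Real.exp (-α ^ d) * Real.exp (Real.exp 1 * c) ≤ Real.exp (-c₂ * d) / 2 := by
      have h : Real.exp (-α ^ d + Real.exp 1 * c + Real.log 2) ≤ Real.exp (-c₂ * d) :=
        Real.exp_le_exp.2 (by nlinarith)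
      rw [Real.exp_add, Real.exp_add, htwo] at h
      linarith
    have hquad : c ^ 2 * Real.exp c * (d ^ 2 * (1 / 2) ^ d) ≤ Real.exp (-c₂ * d) / 2 := by
      have hle : Real.exp (-(1 / 4 * d)) ≤ Real.exp (-c₂ * d) :=
        Real.exp_le_exp.2 (by nlinarith)
      have hsplit : c ^ 2 * Real.exp c * (d ^ 2 * (1 / 2) ^ d) =
          c ^ 2 * Real.exp c * ((d : ℝ) ^ 2 * (Real.exp (1 / 4) / 2) ^ d)
            * Real.exp (-(1 / 4 * d)) := by
        have : (Real.exp (1 / 4)) ^ d * Real.exp (-(1 / 4 * d)) = 1 := by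
          rw [← Real.exp_nat_mul, ← Real.exp_add, mul_comm (d : ℝ), add_neg_cancel, Real.exp_zero]
        rw [div_pow, div_pow, one_pow]
        linear_combination -(c ^ 2 * Real.exp c * (d : ℝ) ^ 2 / 2 ^ d) * this
      rw [hsplit]
      have := mul_le_mul h₁ hle (Real.exp_pos _).le (by norm_num)
      linarith
    linarith

theorem sums_over_small_subsets (α : ℝ) (hα1 : 1 < α) (hα2 : α < 2)
    (c c₁ : ℝ) (hc : 0 < c) (hc₁ : 0 < c₁) :
    ∃ c₂ > (0:ℝ), ∃ d₀ : ℕ, ∀ d : ℕ, d₀ ≤ d →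
      ∀ g : Set (Fin d → Bool) → ℝ,
        (∀ A, A ⊆ evenV d → 0 ≤ g A) →
        (∀ A, A ⊆ evenV d →
            g A = ∏ᶠ (C : Set (Fin d → Bool)) (_ : twoComponent C A), g C) →
        (∀ y ∈ evenV d, g {y} = c * 2 ^ (-(d:ℝ))) →
        (∑ᶠ (A : Set (Fin d → Bool))
            (_ : A ⊆ evenV d ∧ (A.ncard : ℝ) < α ^ d ∧ twoLinked A ∧ 2 ≤ A.ncard),
          g A) ≤ Real.exp (-c₁ * d) →
        ∀ D, D ⊆ evenV d →
          |(∑ᶠ (A : Set (Fin d → Bool)) (_ : A ⊆ D ∧ (A.ncard : ℝ) < α ^ d), g A)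
              - (1 + c * 2 ^ (-(d:ℝ))) ^ D.ncard| ≤ Real.exp (-c₂ * d) := by
  classical
  obtain ⟨c₂, hc₂, d₀, herr⟩ := exists_error_bounds (c := c) hα1 hc₁
  refine ⟨c₂, hc₂, d₀, fun d hd g hnonneg hmul hsing hnice D hD => ?_⟩
  obtain ⟨herr₁, herr₂⟩ := herr d hd
  set p : ℝ := c * 2 ^ (-(d : ℝ)) with hp_def
  have hp : 0 ≤ p := by positivity
  have hpc : 2 ^ d * p = c := by
    rw [hp_def, Real.rpow_neg (by norm_num), Real.rpow_natCast]
    field_simp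
  lift D to Finset (Fin d → Bool) using Set.toFinite D
  have hcard : D.card ≤ 2 ^ d := by simpa using Finset.card_le_univ D
  have hsum : ∑ᶠ (A : Set (Fin d → Bool)) (_ : A ⊆ (D : Set (Fin d → Bool)) ∧ (A.ncard : ℝ) < α ^ d), g A =
      ∑ T ∈ D.powerset with (T.card : ℝ) < α ^ d, g T := by
    rw [finsum_prop_eq_sum_filter]
    have himage : (Finset.univ.filter fun A : Set (Fin d → Bool) =>
        A ⊆ (D : Set (Fin d → Bool)) ∧ (A.ncard : ℝ) < α ^ d) =
        Finset.image (fun T : Finset (Fin d → Bool) => (T : Set (Fin d → Bool)))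
          (D.powerset.filter fun T => (T.card : ℝ) < α ^ d) := by
      ext A
      lift A to Finset (Fin d → Bool) using Set.toFinite A
      simp
    rw [himage, Finset.sum_image Finset.coe_injective.injOn]
  have hnonneg' : ∀ A ⊆ (D : Set (Fin d → Bool)), 0 ≤ g A := fun A hA => hnonneg A (hA.trans hD)
  have hmul' : ∀ A ⊆ (D : Set (Fin d → Bool)),
      g A = ∏ᶠ (C : Set (Fin d → Bool)) (_ : twoComponent C A), g C :=
    fun A hA => hmul A (hA.trans hD)
  have hsing' : ∀ y ∈ D, g {y} = p := fun y hy => hsing y (hD hy)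
  rw [finsum_prop_eq_sum_filter] at hnice
  have hnice' : ∑ A : Set (Fin d → Bool) with
      A ⊆ (D : Set (Fin d → Bool)) ∧ (A.ncard : ℝ) < α ^ d ∧ twoLinked A ∧ 2 ≤ A.ncard, g A ≤ Real.exp (-c₁ * d) := by
    refine le_trans (Finset.sum_le_sum_of_subset_of_nonneg ?_ fun A hA _ => ?_) hnice
    · exact Finset.monotone_filter_right _ fun A _ h => ⟨h.1.trans hD, h.2⟩
    · exact hnonneg A (Finset.mem_filter.1 hA).2.1
  have hupper := sum_weight_le hp hnonneg' hmul' hsing' hnice'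
  have hlower := pow_card_sub_le_sum_weight (m := α ^ d) hp hnonneg' hmul' hsing'
  have hpow := one_add_pow_le_exp hcard hp hpc
  have hpow' := one_add_pow_le_exp (c := Real.exp 1 * c) (p := Real.exp 1 * p) hcard
    (by positivity) (by rw [← hpc]; ring)
  rw [hsum, Set.ncard_coe_finset, abs_le]
  constructor
  · have htail : Real.exp (-α ^ d) * (1 + Real.exp 1 * p) ^ D.card ≤
        Real.exp (-α ^ d) * Real.exp (Real.exp 1 * c) := by gcongr
    have hpairs : 2 ^ d * (d : ℝ) ^ 2 * (p ^ 2 * (1 + p) ^ D.card) ≤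
        c ^ 2 * Real.exp c * (d ^ 2 * (1 / 2) ^ d) := by
      have hsq : 2 ^ d * p ^ 2 = c ^ 2 * (1 / 2 : ℝ) ^ d := by
        rw [← hpc, one_div, inv_pow]
        field_simp
      calc 2 ^ d * (d : ℝ) ^ 2 * (p ^ 2 * (1 + p) ^ D.card)
          ≤ 2 ^ d * (d : ℝ) ^ 2 * (p ^ 2 * Real.exp c) := by gcongr
        _ = _ := by linear_combination (d : ℝ) ^ 2 * Real.exp c * hsq
    linarith
  · have hε : Real.exp (Real.exp (-c₁ * d)) - 1 ≤ 2 * Real.exp (-c₁ * d) := by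
      have hle : Real.exp (-c₁ * d) ≤ 1 := Real.exp_le_one_iff.2 (by
        have : (0 : ℝ) ≤ c₁ * d := by positivity
        linarith)
      have habs := Real.abs_exp_sub_one_le (x := Real.exp (-c₁ * d))
        (by rwa [abs_of_pos (Real.exp_pos _)])
      rw [abs_of_pos (Real.exp_pos _)] at habs
      exact (le_abs_self _).trans habs
    have hone : 0 ≤ Real.exp (Real.exp (-c₁ * d)) - 1 :=
      sub_nonneg.2 (Real.one_le_exp (Real.exp_pos _).le)
    have := mul_le_mul hpow hε hone (Real.exp_pos c).le
    linarith
end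

section
/- For every real number α with 1 < α < 2 there exist constants c > 0 and d₀ such that for all integers d ≥ d₀: ∑_{A ⊆ E nice} 2^{−|N(A)| + |B(A)|} ≤ e^{−cd}. -/
/-- `nbhd d A` is the set of vertices having at least one neighbour in `A`. -/
def nbhd (d : ℕ) (A : Set (Fin d → Bool)) : Set (Fin d → Bool) :=
  {v | ∃ u ∈ A, cubeAdj d u v}

/-- `bset d A` is the set of vertices all of whose neighbours lie in `A`. -/
def bset (d : ℕ) (A : Set (Fin d → Bool)) : Set (Fin d → Bool) :=
  {v | ∀ u, cubeAdj d v u → u ∈ A}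

section CubeLemmas

variable {d : ℕ}

/-- The vertex obtained from `v` by flipping coordinate `i`. -/
def flipAt (v : Fin d → Bool) (i : Fin d) : Fin d → Bool :=
  Function.update v i (!v i)

lemma flipAt_same (v : Fin d → Bool) (i : Fin d) : flipAt v i i = !v i := by
  simp [flipAt]

lemma flipAt_ne (v : Fin d → Bool) {i j : Fin d} (h : j ≠ i) : flipAt v i j = v j := by
  simp [flipAt, h]

lemma flipAt_flipAt (v : Fin d → Bool) (i : Fin d) : flipAt (flipAt v i) i = v := by
  simp [flipAt]

lemma flipAt_injective (v : Fin d → Bool) : Function.Injective (flipAt v) := by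
  intro i j h
  by_contra hij
  have h1 := congrFun h i
  rw [flipAt_same, flipAt_ne v hij] at h1
  simp at h1

lemma cubeAdj_iff_flipAt (u v : Fin d → Bool) : cubeAdj d u v ↔ ∃ i, flipAt u i = v := by
  unfold cubeAdj
  rw [Finset.card_eq_one]
  refine exists_congr fun i => ?_
  constructor
  · intro h
    have h' : ∀ j, u j ≠ v j ↔ j = i := fun j => by
      simpa using congrArg (fun s => j ∈ s) h
    funext j
    by_cases hj : j = i
    · subst hj
      have := (h' j).2 rfl
      rw [flipAt_same]
      revert this
      cases u j <;> cases v j <;> simp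
    · rw [flipAt_ne u hj]
      by_contra hne
      exact hj ((h' j).1 hne)
  · rintro rfl
    ext j
    by_cases hj : j = i
    · subst hj
      simp [flipAt_same]
    · simp [flipAt_ne u hj, hj]

lemma flipAt_mem_evenV (v : Fin d → Bool) (i : Fin d) :
    flipAt v i ∈ evenV d ↔ v ∉ evenV d := by
  have key : ∀ w : Fin d → Bool, w i = false → (flipAt w i ∈ evenV d ↔ w ∉ evenV d) := by
    intro w hw
    have h : (Finset.univ.filter fun j => flipAt w i j = true) =
        insert i (Finset.univ.filter fun j => w j = true) := by
      ext j
      by_cases hj : j = i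
      · subst hj
        simp [flipAt_same, hw]
      · simp [flipAt_ne w hj, hj]
    simp only [evenV, Set.mem_ofPred_eq, h]
    rw [Finset.card_insert_of_notMem (by simp [hw]), Nat.even_add_one]
  cases hv : v i
  · exact key v hv
  · have := key (flipAt v i) (by rw [flipAt_same, hv]; rfl)
    rw [flipAt_flipAt] at this
    tauto

/-- The neighbourhood of a finite set of vertices. -/
def nbrs (A : Finset (Fin d → Bool)) : Finset (Fin d → Bool) :=
  A.biUnion fun v => Finset.univ.image (flipAt v)

/-- The vertices all of whose neighbours lie in `A`. -/
def interiorVerts (A : Finset (Fin d → Bool)) : Finset (Fin d → Bool) :=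
  Finset.univ.filter fun v => ∀ i, flipAt v i ∈ A

lemma mem_nbrs {A : Finset (Fin d → Bool)} {v : Fin d → Bool} :
    v ∈ nbrs A ↔ ∃ u ∈ A, ∃ i, flipAt u i = v := by
  simp [nbrs]

lemma flipAt_mem_nbrs {A : Finset (Fin d → Bool)} {u : Fin d → Bool} (hu : u ∈ A) (i : Fin d) :
    flipAt u i ∈ nbrs A :=
  mem_nbrs.2 ⟨u, hu, i, rfl⟩

lemma nbrs_mono {A B : Finset (Fin d → Bool)} (h : A ⊆ B) : nbrs A ⊆ nbrs B := by
  intro v hv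
  obtain ⟨u, hu, i, rfl⟩ := mem_nbrs.1 hv
  exact flipAt_mem_nbrs (h hu) i

lemma nbhd_coe (A : Finset (Fin d → Bool)) : nbhd d (A : Set (Fin d → Bool)) = nbrs A := by
  ext v
  simp [nbhd, mem_nbrs, cubeAdj_iff_flipAt]

lemma bset_coe (A : Finset (Fin d → Bool)) :
    bset d (A : Set (Fin d → Bool)) = interiorVerts A := by
  ext v
  simp [bset, interiorVerts, cubeAdj_iff_flipAt]

lemma card_nbrs_le (A : Finset (Fin d → Bool)) : (nbrs A).card ≤ A.card * d := by
  refine Finset.card_biUnion_le_card_mul _ _ _ fun v _ => ?_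
  exact Finset.card_image_le.trans (by simp)

/-- Two distinct vertices have at most two common neighbours. -/
lemma two_mul_sub_two_le_card_nbrs {A : Finset (Fin d → Bool)} (hA : 2 ≤ A.card) :
    2 * d - 2 ≤ (nbrs A).card := by
  obtain ⟨u, hu, v, hv, huv⟩ := Finset.one_lt_card.1 hA
  set Nu := Finset.univ.image (flipAt u)
  set Nv := Finset.univ.image (flipAt v)
  have hNu : Nu.card = d := by
    rw [Finset.card_image_of_injective _ (flipAt_injective u)]; simp
  have hNv : Nv.card = d := by
    rw [Finset.card_image_of_injective _ (flipAt_injective v)]; simp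
  have hsub : Nu ∪ Nv ⊆ nbrs A := by
    intro w hw
    simp only [Nu, Nv, Finset.mem_union, Finset.mem_image, Finset.mem_univ, true_and] at hw
    rcases hw with ⟨i, rfl⟩ | ⟨i, rfl⟩
    · exact flipAt_mem_nbrs hu i
    · exact flipAt_mem_nbrs hv i
  have hdiff : ∀ i j, flipAt u i = flipAt v j → i ≠ j ∧ ∀ k, u k ≠ v k ↔ k = i ∨ k = j := by
    intro i j hij
    have hne : i ≠ j := by
      rintro rfl
      apply huv
      rw [← flipAt_flipAt u i, hij, flipAt_flipAt]
    refine ⟨hne, fun k => ?_⟩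
    have hk := congrFun hij k
    by_cases h1 : k = i
    · subst h1
      rw [flipAt_same, flipAt_ne v hne] at hk
      simp [← hk]
    · by_cases h2 : k = j
      · subst h2
        rw [flipAt_same, flipAt_ne u h1] at hk
        simp [hk]
      · rw [flipAt_ne u h1, flipAt_ne v h2] at hk
        simp [hk, h1, h2]
  have hinter : (Nu ∩ Nv).card ≤ 2 := by
    rcases (Nu ∩ Nv).eq_empty_or_nonempty with h | ⟨w, hw⟩
    · simp [h]
    · simp only [Nu, Nv, Finset.mem_inter, Finset.mem_image, Finset.mem_univ, true_and] at hw
      obtain ⟨⟨i, rfl⟩, j, hj⟩ := hw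
      obtain ⟨-, hd⟩ := hdiff i j hj.symm
      refine (Finset.card_le_card (t := ({i, j} : Finset (Fin d)).image (flipAt u)) ?_).trans
        (Finset.card_image_le.trans Finset.card_le_two)
      intro x hx
      simp only [Nu, Nv, Finset.mem_inter, Finset.mem_image, Finset.mem_univ, true_and] at hx
      obtain ⟨⟨k, rfl⟩, l, hl⟩ := hx
      obtain ⟨-, hd'⟩ := hdiff k l hl.symm
      refine Finset.mem_image_of_mem _ ?_
      have := (hd k).1 ((hd' k).2 (Or.inl rfl))
      simpa using this
  have h1 := Finset.card_union_add_card_inter Nu Nv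
  have h2 := Finset.card_le_card hsub
  omega

lemma mul_log_add_mul_log_le {x y : ℝ} (hx : 0 ≤ x) (hxy : x ≤ y) :
    x * Real.log x + y * Real.log y + 2 * x * Real.log 2 ≤ (x + y) * Real.log (x + y) := by
  rcases hx.eq_or_lt with rfl | hx
  · simp
  have hy : 0 < y := hx.trans_le hxy
  have h1 : Real.log 2 + Real.log x ≤ Real.log (x + y) := by
    rw [← Real.log_mul (by norm_num) hx.ne']
    exact Real.log_le_log (by positivity) (by linarith)
  have h2 : x * Real.log 2 ≤ y * (Real.log (x + y) - Real.log y) := by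
    have h3 : (x / y) * Real.log 2 ≤ Real.log (1 + x / y) := by
      rw [← Real.log_rpow (by norm_num)]
      refine Real.log_le_log (by positivity) ?_
      have := rpow_one_add_le_one_add_mul_self (s := 1) (by norm_num)
        (p := x / y) (by positivity) (by rw [div_le_one hy]; exact hxy)
      norm_num at this
      exact this
    have h4 : Real.log (x + y) - Real.log y = Real.log (1 + x / y) := by
      rw [← Real.log_div (by positivity) hy.ne']
      congr 1
      field_simp
      ring
    rw [h4]
    calc x * Real.log 2 = y * ((x / y) * Real.log 2) := by field_simp
      _ ≤ _ := by gcongr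
  nlinarith

/-- Edge-isoperimetric inequality in the cube. -/
lemma edge_isoperimetry (I : Finset (Fin d)) (X : Finset (Fin d → Bool)) :
    ((∑ i ∈ I, (X.filter fun v => flipAt v i ∈ X).card : ℕ) : ℝ) * Real.log 2 ≤
      X.card * Real.log X.card := by
  induction I using Finset.induction_on generalizing X with
  | empty =>
    simp only [Finset.sum_empty, Nat.cast_zero, zero_mul]
    exact mul_nonneg (Nat.cast_nonneg _) (Real.log_natCast_nonneg _)
  | insert i I hi ih =>
    set X₀ := X.filter fun v => v i = false
    set X₁ := X.filter fun v => v i = true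
    have hdisj : Disjoint X₀ X₁ := by
      rw [Finset.disjoint_left]
      simp only [X₀, X₁, Finset.mem_filter]
      rintro v ⟨-, h⟩ ⟨-, h'⟩
      simp [h] at h'
    have hunion : X = X₀ ∪ X₁ := by
      ext v
      simp only [X₀, X₁, Finset.mem_filter, Finset.mem_union]
      cases v i <;> simp
    have hcard : X.card = X₀.card + X₁.card := by
      rw [← Finset.card_union_of_disjoint hdisj, ← hunion]
    have hI : ∑ j ∈ I, (X.filter fun v => flipAt v j ∈ X).card =
        ∑ j ∈ I, (X₀.filter fun v => flipAt v j ∈ X₀).card +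
          ∑ j ∈ I, (X₁.filter fun v => flipAt v j ∈ X₁).card := by
      rw [← Finset.sum_add_distrib]
      refine Finset.sum_congr rfl fun j hj => ?_
      have hij : i ≠ j := by rintro rfl; exact hi hj
      rw [← Finset.card_union_of_disjoint]
      · congr 1
        ext v
        simp only [X₀, X₁, Finset.mem_filter, Finset.mem_union, flipAt_ne v hij]
        cases v i <;> simp
      · exact Finset.disjoint_filter_filter hdisj
    have hflip : ∀ b, (X.filter fun v => flipAt v i ∈ X).card ≤
        2 * (X.filter fun v => v i = b).card := by
      intro b
      have hsub : (X.filter fun v => flipAt v i ∈ X) ⊆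
          (X.filter fun v => v i = b) ∪
            (X.filter fun v => v i = b).image fun v => flipAt v i := by
        intro v hv
        simp only [Finset.mem_filter, Finset.mem_union, Finset.mem_image] at hv ⊢
        by_cases hb : v i = b
        · exact Or.inl ⟨hv.1, hb⟩
        · refine Or.inr ⟨flipAt v i, ⟨hv.2, ?_⟩, flipAt_flipAt v i⟩
          rw [flipAt_same]
          revert hb
          cases v i <;> cases b <;> simp
      have h1 := Finset.card_le_card hsub
      have h2 := Finset.card_union_le (X.filter fun v => v i = b)
        ((X.filter fun v => v i = b).image fun v => flipAt v i)
      have h3 := Finset.card_image_le (s := X.filter fun v => v i = b)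
        (f := fun v => flipAt v i)
      omega
    rw [Finset.sum_insert hi, hI, hcard]
    have h0 := ih X₀
    have h1 := ih X₁
    have hl : (0:ℝ) ≤ Real.log 2 := Real.log_nonneg (by norm_num)
    push_cast at h0 h1 ⊢
    rcases le_total X₀.card X₁.card with hle | hle
    · have h2 : ((X.filter fun v => flipAt v i ∈ X).card : ℝ) ≤ 2 * X₀.card := by
        exact_mod_cast hflip false
      have h3 := mul_log_add_mul_log_le (x := X₀.card) (y := X₁.card) (Nat.cast_nonneg _)
        (Nat.cast_le.2 hle)
      have h4 := mul_le_mul_of_nonneg_right h2 hl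
      linarith
    · have h2 : ((X.filter fun v => flipAt v i ∈ X).card : ℝ) ≤ 2 * X₁.card := by
        exact_mod_cast hflip true
      have h3 := mul_log_add_mul_log_le (x := X₁.card) (y := X₀.card) (Nat.cast_nonneg _)
        (Nat.cast_le.2 hle)
      have h4 := mul_le_mul_of_nonneg_right h2 hl
      rw [add_comm (X₁.card : ℝ)] at h3
      linarith

lemma sum_card_filter_flipAt (S F : Finset (Fin d → Bool)) :
    ∑ i, (S.filter fun v => flipAt v i ∈ F).card =
      ∑ v ∈ S, (Finset.univ.filter fun i => flipAt v i ∈ F).card := by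
  simp only [Finset.card_filter]
  exact Finset.sum_comm

lemma card_filter_flipAt_comm (S F : Finset (Fin d → Bool)) (i : Fin d) :
    (S.filter fun v => flipAt v i ∈ F).card = (F.filter fun v => flipAt v i ∈ S).card := by
  refine Finset.card_bij' (fun v _ => flipAt v i) (fun v _ => flipAt v i) ?_ ?_ ?_ ?_ <;>
    simp +contextual [flipAt_flipAt]

/-- If every vertex of `S` has at least `r` neighbours in a disjoint set `F`, then double counting
and isoperimetry bound the size of `S`. -/
lemma card_bounds_of_dense {S F : Finset (Fin d → Bool)} (hSF : Disjoint S F) {r : ℝ}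
    (h : ∀ u ∈ S, r ≤ (Finset.univ.filter fun i => flipAt u i ∈ F).card) :
    r * S.card ≤ d * F.card ∧
      2 * (r * S.card) * Real.log 2 ≤ (S.card + F.card) * Real.log (S.card + F.card) := by
  set e := ∑ i, (S.filter fun v => flipAt v i ∈ F).card with he
  have hre : r * S.card ≤ e := by
    rw [he, sum_card_filter_flipAt]
    push_cast
    rw [mul_comm, ← nsmul_eq_mul]
    exact Finset.card_nsmul_le_sum _ _ _ h
  have hed : e ≤ d * F.card := by
    rw [he]
    simp only [card_filter_flipAt_comm S F]
    refine (Finset.sum_le_card_nsmul _ _ F.card fun i _ => Finset.card_filter_le _ _).trans ?_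
    simp
  refine ⟨hre.trans (by exact_mod_cast hed), ?_⟩
  have hiso := edge_isoperimetry Finset.univ (S ∪ F)
  rw [Finset.card_union_of_disjoint hSF] at hiso
  have h2e : 2 * e ≤ ∑ i, ((S ∪ F).filter fun v => flipAt v i ∈ S ∪ F).card := by
    rw [two_mul, he]
    nth_rewrite 2 [Finset.sum_congr rfl fun i _ => card_filter_flipAt_comm S F i]
    rw [← Finset.sum_add_distrib]
    refine Finset.sum_le_sum fun i _ => ?_
    rw [← Finset.card_union_of_disjoint (Finset.disjoint_filter_filter hSF)]
    refine Finset.card_le_card fun v => ?_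
    simp only [Finset.mem_filter, Finset.mem_union]
    tauto
  have h2e' : 2 * (e : ℝ) ≤
      ((∑ i, ((S ∪ F).filter fun v => flipAt v i ∈ S ∪ F).card : ℕ) : ℝ) := by
    exact_mod_cast h2e
  have hl : (0:ℝ) ≤ Real.log 2 := Real.log_nonneg (by norm_num)
  push_cast at hiso h2e'
  refine le_trans ?_ hiso
  gcongr
  linarith

/-- A small subset of `X` whose neighbourhood contains most neighbours of each vertex of `X`. -/
lemma exists_greedy_cover (X : Finset (Fin d → Bool)) {m : ℝ} (hm : 0 < m) :
    ∃ T ⊆ X, T.card * m ≤ (nbrs T).card ∧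
      ∀ u ∈ X, ((Finset.univ.filter fun i => flipAt u i ∉ nbrs T).card : ℝ) < m := by
  classical
  obtain ⟨T, hT, hmax⟩ := Finset.exists_max_image
    (X.powerset.filter fun T => (T.card : ℝ) * m ≤ (nbrs T).card) Finset.card
    ⟨∅, by simp⟩
  simp only [Finset.mem_filter, Finset.mem_powerset] at hT hmax
  refine ⟨T, hT.1, hT.2, fun u hu => ?_⟩
  by_contra! hge
  have huT : u ∉ T := by
    intro huT
    have : (Finset.univ.filter fun i => flipAt u i ∉ nbrs T) = ∅ := by
      simp [flipAt_mem_nbrs huT]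
    rw [this] at hge
    simp at hge
    linarith
  have hsub : nbrs T ∪ (Finset.univ.filter fun i => flipAt u i ∉ nbrs T).image (flipAt u) ⊆
      nbrs (insert u T) := by
    intro w hw
    simp only [Finset.mem_union, Finset.mem_image, Finset.mem_filter] at hw
    rcases hw with hw | ⟨i, -, rfl⟩
    · exact nbrs_mono (Finset.subset_insert _ _) hw
    · exact flipAt_mem_nbrs (Finset.mem_insert_self _ _) i
  have hcard := Finset.card_le_card hsub
  rw [Finset.card_union_of_disjoint, Finset.card_image_of_injective _ (flipAt_injective u)]
    at hcard
  · have hins := Finset.card_insert_of_notMem huT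
    have := hmax (insert u T) ⟨Finset.insert_subset hu hT.1, by
      rw [hins]
      have : ((nbrs T).card : ℝ) +
        (Finset.univ.filter fun i => flipAt u i ∉ nbrs T).card ≤ (nbrs (insert u T)).card := by
        exact_mod_cast hcard
      push_cast
      linarith [hT.2]⟩
    omega
  · rw [Finset.disjoint_right]
    simp only [Finset.mem_image, Finset.mem_filter]
    rintro w ⟨i, ⟨-, hi⟩, rfl⟩
    exact hi

open Classical in
/-- The vertices of `P` with fewer than `m` neighbours outside the neighbourhood of `T`. -/
noncomputable def hull (m : ℝ) (P : Set (Fin d → Bool)) (T : Finset (Fin d → Bool)) :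
    Finset (Fin d → Bool) :=
  Finset.univ.filter fun u =>
    u ∈ P ∧ ((Finset.univ.filter fun i => flipAt u i ∉ nbrs T).card : ℝ) < m

lemma mem_hull {m : ℝ} {P : Set (Fin d → Bool)} {T : Finset (Fin d → Bool)}
    {u : Fin d → Bool} : u ∈ hull m P T ↔
      u ∈ P ∧ ((Finset.univ.filter fun i => flipAt u i ∉ nbrs T).card : ℝ) < m := by
  simp [hull]

lemma card_hull_bound {P : Set (Fin d → Bool)} (hP : ∀ v ∈ P, ∀ i, flipAt v i ∉ P)
    {T : Finset (Fin d → Bool)} (hT : (T : Set (Fin d → Bool)) ⊆ P) (hd : 0 < d)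
    {ε θ : ℝ} (hε : ε ≤ 1 / 2)
    (hF : 3 * ((nbrs T).card : ℝ) ≤ (2:ℝ) ^ (θ * d)) :
    2 * (1 - ε) * (hull (ε * d) P T).card ≤ θ * ((hull (ε * d) P T).card + (nbrs T).card) := by
  have hdisj : Disjoint (hull (ε * d) P T) (nbrs T) := by
    rw [Finset.disjoint_right]
    intro v hv hv'
    obtain ⟨u, hu, i, rfl⟩ := mem_nbrs.1 hv
    exact hP u (hT hu) i (mem_hull.1 hv').1
  obtain ⟨h1, h2⟩ := card_bounds_of_dense hdisj (r := (1 - ε) * d) (by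
    intro u hu
    have h := (mem_hull.1 hu).2
    have hc := Finset.card_filter_add_card_filter_not (s := (Finset.univ : Finset (Fin d)))
      (fun i => flipAt u i ∈ nbrs T)
    rw [Finset.card_univ, Fintype.card_fin] at hc
    have hc' : ((Finset.univ.filter fun i => flipAt u i ∈ nbrs T).card : ℝ) +
      (Finset.univ.filter fun i => flipAt u i ∉ nbrs T).card = d := by exact_mod_cast hc
    linarith)
  set s : ℝ := ((hull (ε * d) P T).card : ℝ)
  set f : ℝ := ((nbrs T).card : ℝ)
  have hs : 0 ≤ s := Nat.cast_nonneg _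
  have hf : 0 ≤ f := Nat.cast_nonneg _
  have hd' : (0:ℝ) < d := by exact_mod_cast hd
  have h3 : (1 - ε) * s ≤ f := by
    refine le_of_mul_le_mul_left ?_ hd'
    linarith
  have h4 : s ≤ 2 * f := by nlinarith
  rcases hf.eq_or_lt with h0 | hf
  · have : s = 0 := by linarith
    rw [this, ← h0]
    simp
  have hl : (0:ℝ) < Real.log 2 := Real.log_pos (by norm_num)
  have h5 : Real.log (s + f) ≤ θ * d * Real.log 2 := by
    rw [← Real.log_rpow (by norm_num)]
    exact Real.log_le_log (by linarith) (by linarith)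
  have h6 : 2 * ((1 - ε) * d * s) * Real.log 2 ≤ (s + f) * (θ * d * Real.log 2) :=
    h2.trans (by gcongr)
  refine le_of_mul_le_mul_left ?_ (mul_pos hd' hl)
  linarith

/-- `T` cannot be split into two parts with no pair `R v w` across. -/
def CutLinked {β : Type*} (R : β → β → Prop) (T : Finset β) : Prop :=
  ∀ U ⊆ T, U.Nonempty → U ≠ T → ∃ v ∈ U, ∃ w ∈ T, w ∉ U ∧ R v w

lemma CutLinked.exists_isChain {β : Type*} [DecidableEq β] {R : β → β → Prop}
    (hR : ∀ v w, R v w → R w v) {T : Finset β} (hT : CutLinked R T) (hne : T.Nonempty) :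
    ∃ l : List β, l.length + 1 = 2 * T.card ∧ l.IsChain R ∧ l.toFinset = T := by
  have key : ∀ j, j + 1 ≤ T.card → ∃ l : List β, l.length = 2 * j + 1 ∧ l.IsChain R ∧
      l.toFinset ⊆ T ∧ l.toFinset.card = j + 1 := by
    intro j
    induction j with
    | zero =>
      intro _
      obtain ⟨v, hv⟩ := hne
      exact ⟨[v], by simp, by simp, by simpa using hv, by simp⟩
    | succ j ih =>
      intro hj
      obtain ⟨l, hlen, hch, hsub, hcard⟩ := ih (by omega)
      obtain ⟨v, hv, w, hw, hwU, hvw⟩ := hT l.toFinset hsub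
        (Finset.card_pos.1 (by omega)) (by intro h; rw [h] at hcard; omega)
      obtain ⟨s, t, rfl⟩ := List.append_of_mem (List.mem_toFinset.1 hv)
      have hins : (s ++ v :: w :: v :: t).toFinset = insert w (s ++ v :: t).toFinset := by
        ext x
        simp only [List.mem_toFinset, List.mem_append, List.mem_cons, Finset.mem_insert]
        tauto
      refine ⟨s ++ v :: w :: v :: t, ?_, ?_, ?_, ?_⟩
      · simp only [List.length_append, List.length_cons] at hlen ⊢
        omega
      · rw [List.isChain_append] at hch ⊢
        refine ⟨hch.1, ?_, by simpa using hch.2.2⟩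
        exact List.IsChain.cons_cons hvw (List.IsChain.cons_cons (hR _ _ hvw) hch.2.1)
      · rw [hins]
        exact Finset.insert_subset hw hsub
      · rw [hins, Finset.card_insert_of_notMem hwU, hcard]
  have hpos := hne.card_pos
  obtain ⟨l, hlen, hch, hsub, hcard⟩ := key (T.card - 1) (by omega)
  exact ⟨l, by omega, hch, Finset.eq_of_subset_of_card_le hsub (by omega)⟩

/-- The lists of length `n + 1` that start at `v` and move within the finite sets `ball`. -/
def chainsFrom {β : Type*} [DecidableEq β] (ball : β → Finset β) : ℕ → β → Finset (List β)
  | 0, v => {[v]}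
  | n + 1, v => (ball v).biUnion fun w => (chainsFrom ball n w).image (List.cons v)

lemma card_chainsFrom_le {β : Type*} [DecidableEq β] {ball : β → Finset β} {D : ℕ}
    (hD : ∀ v, (ball v).card ≤ D) (n : ℕ) (v : β) : (chainsFrom ball n v).card ≤ D ^ n := by
  induction n generalizing v with
  | zero => simp [chainsFrom]
  | succ n ih =>
    rw [chainsFrom, pow_succ']
    exact (Finset.card_biUnion_le_card_mul _ _ _ fun w _ =>
      Finset.card_image_le.trans (ih w)).trans (Nat.mul_le_mul_right _ (hD v))

lemma mem_chainsFrom {β : Type*} [DecidableEq β] {R : β → β → Prop} {ball : β → Finset β}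
    (hball : ∀ v w, R v w → w ∈ ball v) (v : β) (l : List β) (hl : (v :: l).IsChain R) :
    v :: l ∈ chainsFrom ball l.length v := by
  induction l generalizing v with
  | nil => simp [chainsFrom]
  | cons w l ih =>
    rw [List.isChain_cons_cons] at hl
    simp only [List.length_cons, chainsFrom, Finset.mem_biUnion, Finset.mem_image]
    exact ⟨w, hball v w hl.1, w :: l, ih w hl.2, rfl⟩

/-- Weighted count of linked sets in a structure of bounded degree. -/
lemma sum_cutLinked_le {β : Type*} [Fintype β] [DecidableEq β] {R : β → β → Prop}
    (hR : ∀ v w, R v w → R w v) {ball : β → Finset β} {D : ℕ} (hD1 : 1 ≤ D)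
    (hball : ∀ v w, R v w → w ∈ ball v) (hD : ∀ v, (ball v).card ≤ D)
    (𝒯 : Finset (Finset β)) (h𝒯 : ∀ T ∈ 𝒯, T.Nonempty ∧ CutLinked R T) :
    ∑ T ∈ 𝒯, ((2 * (D:ℝ) ^ 2)⁻¹) ^ T.card ≤ 2 * (Fintype.card β : ℝ) := by
  have hcount : ∀ k, (𝒯.filter fun T => T.card = k).card ≤ Fintype.card β * D ^ (2 * k) := by
    intro k
    have hsub : (𝒯.filter fun T => T.card = k) ⊆
        (Finset.univ.biUnion fun v => chainsFrom ball (2 * k - 2) v).image List.toFinset := by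
      intro T hT
      obtain ⟨hT𝒯, rfl⟩ := Finset.mem_filter.1 hT
      obtain ⟨hne, hcut⟩ := h𝒯 T hT𝒯
      obtain ⟨l, hlen, hch, hl⟩ := hcut.exists_isChain hR hne
      refine Finset.mem_image.2 ⟨l, Finset.mem_biUnion.2 ?_, hl⟩
      cases l with
      | nil =>
        simp only [List.length_nil] at hlen
        omega
      | cons v l =>
        refine ⟨v, Finset.mem_univ _, ?_⟩
        have := mem_chainsFrom hball v l hch
        rwa [show l.length = 2 * T.card - 2 by simp only [List.length_cons] at hlen; omega]
          at this
    refine (Finset.card_le_card hsub).trans (Finset.card_image_le.trans ?_)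
    refine (Finset.card_biUnion_le_card_mul _ _ _ fun v _ =>
      card_chainsFrom_le hD (2 * k - 2) v).trans ?_
    exact Nat.mul_le_mul_left _ (Nat.pow_le_pow_right hD1 (by omega))
  have hmaps : ∀ T ∈ 𝒯, T.card ∈ Finset.range (Fintype.card β + 1) := fun T _ =>
    Finset.mem_range.2 (Nat.lt_succ_of_le (Finset.card_le_univ T))
  have hD0 : (0:ℝ) < D := by exact_mod_cast hD1
  rw [← Finset.sum_fiberwise_of_maps_to hmaps]
  have hk : ∀ k, ∑ T ∈ 𝒯.filter (fun T => T.card = k), ((2 * (D:ℝ) ^ 2)⁻¹) ^ T.card ≤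
      Fintype.card β * (1 / 2 : ℝ) ^ k := by
    intro k
    rw [Finset.sum_congr rfl fun T hT => by rw [(Finset.mem_filter.1 hT).2], Finset.sum_const,
      nsmul_eq_mul]
    have h1 : ((𝒯.filter fun T => T.card = k).card : ℝ) ≤
        Fintype.card β * (D:ℝ) ^ (2 * k) := by exact_mod_cast hcount k
    calc _ ≤ Fintype.card β * (D:ℝ) ^ (2 * k) * ((2 * (D:ℝ) ^ 2)⁻¹) ^ k := by gcongr
      _ = _ := by
        rw [inv_pow, mul_pow, pow_mul, one_div, inv_pow]
        field_simp
  calc _ ≤ ∑ k ∈ Finset.range (Fintype.card β + 1), Fintype.card β * (1 / 2 : ℝ) ^ k :=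
        Finset.sum_le_sum fun k _ => hk k
    _ ≤ _ := by
        rw [← Finset.mul_sum, mul_comm]
        gcongr
        exact sum_geometric_two_le _

lemma hamDist_comm (u v : Fin d → Bool) : hamDist u v = hamDist v u :=
  hammingDist_comm u v

lemma hamDist_triangle (u v w : Fin d → Bool) : hamDist u w ≤ hamDist u v + hamDist v w :=
  hammingDist_triangle u v w

lemma hamDist_flipAt (v : Fin d → Bool) (i : Fin d) : hamDist v (flipAt v i) = 1 :=
  (cubeAdj_iff_flipAt v _).2 ⟨i, rfl⟩

lemma card_ball_le (n : ℕ) (v : Fin d → Bool) :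
    (Finset.univ.filter fun w => hamDist v w ≤ n).card ≤ (d + 1) ^ n := by
  induction n with
  | zero =>
    rw [pow_zero, Finset.card_le_one]
    intro a ha b hb
    simp only [Finset.mem_filter, Nat.le_zero] at ha hb
    rw [← hammingDist_eq_zero.1 ha.2, ← hammingDist_eq_zero.1 hb.2]
  | succ n ih =>
    have hsub : (Finset.univ.filter fun w => hamDist v w ≤ n + 1) ⊆
        (Finset.univ.filter fun w => hamDist v w ≤ n).biUnion fun w =>
          insert w (Finset.univ.image (flipAt w)) := by
      intro w hw
      simp only [Finset.mem_filter, Finset.mem_univ, true_and, Finset.mem_biUnion] at hw ⊢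
      rcases Nat.lt_or_ge n (hamDist v w) with hlt | hle
      · have hpos : (Finset.univ.filter fun i => v i ≠ w i).Nonempty :=
          Finset.card_pos.1 (lt_of_le_of_lt (Nat.zero_le n) hlt)
        obtain ⟨i, hi⟩ := hpos
        refine ⟨flipAt w i, ?_, Finset.mem_insert_of_mem
          (Finset.mem_image.2 ⟨i, Finset.mem_univ _, flipAt_flipAt w i⟩)⟩
        have hss : (Finset.univ.filter fun j => v j ≠ flipAt w i j) ⊂
            Finset.univ.filter fun j => v j ≠ w j := by
          rw [Finset.ssubset_iff_of_subset]
          · refine ⟨i, hi, ?_⟩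
            simp only [Finset.mem_filter, Finset.mem_univ, true_and] at hi
            simp only [Finset.mem_filter, Finset.mem_univ, true_and, flipAt_same]
            revert hi
            cases v i <;> cases w i <;> simp
          · intro j hj
            simp only [Finset.mem_filter, Finset.mem_univ, true_and] at hi hj ⊢
            by_cases hji : j = i
            · rwa [hji]
            · rwa [flipAt_ne w hji] at hj
        have := Finset.card_lt_card hss
        unfold hamDist at hw ⊢
        omega
      · exact ⟨w, hle, Finset.mem_insert_self _ _⟩
    refine (Finset.card_le_card hsub).trans ((Finset.card_biUnion_le_card_mul _ _ (d + 1)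
      fun w _ => (Finset.card_insert_le _ _).trans ?_).trans ?_)
    · exact Nat.succ_le_succ (Finset.card_image_le.trans (by simp))
    · rw [pow_succ]
      exact Nat.mul_le_mul_right _ ih

/-- A set of vertices that is within distance two of a 2-linked set, and vice versa, is linked at
scale six. -/
lemma twoLinked.cutLinked {A : Set (Fin d → Bool)} (hA : twoLinked A)
    {T : Finset (Fin d → Bool)} (hAT : ∀ a ∈ A, ∃ t ∈ T, hamDist a t ≤ 2)
    (hTA : ∀ t ∈ T, ∃ a ∈ A, hamDist t a ≤ 2) :
    CutLinked (fun u v : Fin d → Bool => hamDist u v ≤ 6) T := by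
  intro U hU hne hUT
  by_contra! hcross
  obtain ⟨v, hv⟩ := hne
  obtain ⟨w, hw, hwU⟩ := Finset.exists_of_ssubset (hU.ssubset_of_ne hUT)
  obtain ⟨a, ha, hva⟩ := hTA v (hU hv)
  obtain ⟨b, hb, hwb⟩ := hTA w hw
  have hnear : ∀ y, Relation.ReflTransGen (fun x y => y ∈ A ∧ hamDist x y ≤ 2) a y →
      ∃ u ∈ U, hamDist u y ≤ 2 := by
    intro y hy
    induction hy with
    | refl => exact ⟨v, hv, hva⟩
    | @tail x y _ hxy ih =>
      obtain ⟨u, hu, hux⟩ := ih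
      obtain ⟨t, ht, hyt⟩ := hAT y hxy.1
      by_cases htU : t ∈ U
      · exact ⟨t, htU, by rwa [hamDist_comm]⟩
      · have h1 := hamDist_triangle u x t
        have h2 := hamDist_triangle x y t
        have h3 := hcross u hu t ht htU
        have h4 := hxy.2
        omega
  obtain ⟨u, hu, hub⟩ := hnear b (hA a ha b hb)
  have h1 := hamDist_triangle u b w
  rw [hamDist_comm b w] at h1
  have h2 := hcross u hu w hw hwU
  omega

open Classical in
/-- `T` encodes the pair `(A, C)`: its even part approximates `A` and its odd part
approximates `C`. -/
structure Encodes (m : ℝ) (A C T : Finset (Fin d → Bool)) : Prop where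
  nonempty : T.Nonempty
  cutLinked : CutLinked (fun u v : Fin d → Bool => hamDist u v ≤ 6) T
  card_le : T.card * m ≤ (nbrs (T.filter (· ∈ evenV d))).card +
    ((nbrs (T.filter (· ∈ (evenV d)ᶜ))).card : ℝ)
  nbrs_even_subset : nbrs (T.filter (· ∈ evenV d)) ⊆ nbrs A
  subset_hull_even : A ⊆ hull m (evenV d) (T.filter (· ∈ evenV d))
  nbrs_odd_subset : nbrs (T.filter (· ∈ (evenV d)ᶜ)) ⊆ A
  subset_hull_odd : C ⊆ hull m (evenV d)ᶜ (T.filter (· ∈ (evenV d)ᶜ))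

lemma exists_encodes {ε : ℝ} (hε : 0 < ε) (hε1 : ε ≤ 1 / 2) (hd : 0 < d)
    {A C : Finset (Fin d → Bool)} (hA : (A : Set (Fin d → Bool)) ⊆ evenV d)
    (hlink : twoLinked (A : Set (Fin d → Bool))) (hne : A.Nonempty)
    (hC : C ⊆ interiorVerts A) : ∃ T, Encodes (ε * d) A C T := by
  classical
  have hd' : (0:ℝ) < d := by exact_mod_cast hd
  have hm : 0 < ε * d := by positivity
  have hint : ∀ c ∈ C, ∀ i, flipAt c i ∈ A := fun c hc => (Finset.mem_filter.1 (hC hc)).2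
  obtain ⟨T₁, hT₁, hcard₁, hcov₁⟩ := exists_greedy_cover A hm
  obtain ⟨T₂, hT₂, hcard₂, hcov₂⟩ := exists_greedy_cover C hm
  have heven : ∀ t ∈ T₁, t ∈ evenV d := fun t ht => hA (hT₁ ht)
  have hodd : ∀ t ∈ T₂, t ∉ evenV d := fun t ht =>
    (flipAt_mem_evenV t ⟨0, hd⟩).1 (hA (hint t (hT₂ ht) _))
  have hoddC : ∀ c ∈ C, c ∉ evenV d := fun c hc =>
    (flipAt_mem_evenV c ⟨0, hd⟩).1 (hA (hint c hc _))
  have hE : (T₁ ∪ T₂).filter (· ∈ evenV d) = T₁ := by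
    ext t
    simp only [Finset.mem_filter, Finset.mem_union]
    have h1 := heven t
    have h2 := hodd t
    tauto
  have hO : (T₁ ∪ T₂).filter (· ∈ (evenV d)ᶜ) = T₂ := by
    ext t
    simp only [Finset.mem_filter, Finset.mem_union, Set.mem_compl_iff]
    have h1 := heven t
    have h2 := hodd t
    tauto
  have hnear : ∀ a ∈ A, ∃ t ∈ T₁, hamDist a t ≤ 2 := by
    intro a ha
    have hlt := hcov₁ a ha
    obtain ⟨i, hi⟩ : ∃ i, flipAt a i ∈ nbrs T₁ := by
      by_contra! hall
      rw [Finset.filter_true_of_mem fun i _ => hall i] at hlt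
      simp only [Finset.card_univ, Fintype.card_fin] at hlt
      nlinarith
    obtain ⟨t, ht, j, hj⟩ := mem_nbrs.1 hi
    refine ⟨t, ht, ?_⟩
    have h1 := hamDist_triangle a (flipAt a i) t
    have h2 := hamDist_flipAt t j
    rw [hj, hamDist_comm] at h2
    have h3 := hamDist_flipAt a i
    omega
  refine ⟨T₁ ∪ T₂, ?_, ?_, ?_, ?_, ?_, ?_, ?_⟩
  · obtain ⟨a, ha⟩ := hne
    obtain ⟨t, ht, -⟩ := hnear a ha
    exact ⟨t, Finset.mem_union_left _ ht⟩
  · refine hlink.cutLinked (fun a ha => ?_) fun t ht => ?_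
    · obtain ⟨t, ht, hat⟩ := hnear a ha
      exact ⟨t, Finset.mem_union_left _ ht, hat⟩
    · rcases Finset.mem_union.1 ht with ht | ht
      · exact ⟨t, hT₁ ht, by rw [show hamDist t t = 0 from hammingDist_self t]; omega⟩
      · exact ⟨flipAt t ⟨0, hd⟩, hint t (hT₂ ht) _, by rw [hamDist_flipAt]; omega⟩
  · rw [hE, hO]
    have : ((T₁ ∪ T₂).card : ℝ) ≤ T₁.card + T₂.card := by
      exact_mod_cast Finset.card_union_le T₁ T₂
    nlinarith
  · rw [hE]
    exact nbrs_mono hT₁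
  · rw [hE]
    exact fun a ha => mem_hull.2 ⟨hA ha, hcov₁ a ha⟩
  · rw [hO]
    intro v hv
    obtain ⟨c, hc, i, rfl⟩ := mem_nbrs.1 hv
    exact hint c (hT₂ hc) i
  · rw [hO]
    exact fun c hc => mem_hull.2 ⟨hoddC c hc, hcov₂ c hc⟩

/-- The numerical conditions, valid for all large `d`, under which the estimates hold. -/
structure LargeDim (α η : ℝ) (d : ℕ) : Prop where
  twelve_le : 12 ≤ d
  three_le : 3 ≤ η * d
  volume_le : 3 * (d * α ^ d) ≤ (2:ℝ) ^ ((1 - η) * d)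
  sq_le : 3 * (d:ℝ) ^ 2 ≤ (2:ℝ) ^ ((1 / 32 : ℝ) * d)
  degree_le : 2 * (((d + 1) ^ 6 : ℕ) : ℝ) ^ 2 ≤ (2:ℝ) ^ (η ^ 2 / 64 * d)

/-- Total weight of the pairs encoded by a given set. -/
lemma sum_encodes_le {α η : ℝ} (hα : 1 < α) (hη : 0 < η) (hη1 : η ≤ 1) (hd : LargeDim α η d)
    {T : Finset (Fin d → Bool)} {𝒬 : Finset (Finset (Fin d → Bool) × Finset (Fin d → Bool))}
    (h𝒬 : ∀ p ∈ 𝒬, Encodes (η / 2 * d) p.1 p.2 T ∧ (p.1.card : ℝ) < α ^ d ∧ 2 ≤ p.1.card) :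
    ∑ p ∈ 𝒬, (1 / 2 : ℝ) ^ (nbrs p.1).card ≤
      (2:ℝ) ^ (-(3 / 2 * d : ℝ)) * ((2 * (((d + 1) ^ 6 : ℕ) : ℝ) ^ 2)⁻¹) ^ T.card := by
  classical
  rcases 𝒬.eq_empty_or_nonempty with rfl | ⟨⟨A, C⟩, hAC⟩
  · simp only [Finset.sum_empty]
    positivity
  obtain ⟨henc, hsmall, hA2⟩ := h𝒬 _ hAC
  simp only at henc hsmall hA2
  set T₁ := T.filter (· ∈ evenV d) with hT₁
  set T₂ := T.filter (· ∈ (evenV d)ᶜ) with hT₂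
  set S₁ := hull (η / 2 * d) (evenV d) T₁ with hS₁
  set S₂ := hull (η / 2 * d) (evenV d)ᶜ T₂ with hS₂
  have hd0 : 0 < d := by have := hd.twelve_le; omega
  have hd12 : (12:ℝ) ≤ d := by exact_mod_cast hd.twelve_le
  have hαd : (0:ℝ) < α ^ d := by positivity
  have hE : ∀ v ∈ evenV d, ∀ i, flipAt v i ∉ evenV d := fun v hv i h =>
    (flipAt_mem_evenV v i).1 h hv
  have hO : ∀ v ∈ (evenV d)ᶜ, ∀ i, flipAt v i ∉ (evenV d)ᶜ := fun v hv i h =>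
    h ((flipAt_mem_evenV v i).2 hv)
  have hT₁E : (T₁ : Set (Fin d → Bool)) ⊆ evenV d := fun t ht =>
    (Finset.mem_filter.1 (Finset.mem_coe.1 ht)).2
  have hT₂O : (T₂ : Set (Fin d → Bool)) ⊆ (evenV d)ᶜ := fun t ht =>
    (Finset.mem_filter.1 (Finset.mem_coe.1 ht)).2
  have hf₁ : ((nbrs T₁).card : ℝ) ≤ d * α ^ d := by
    have h1 : ((nbrs T₁).card : ℝ) ≤ (A.card : ℝ) * d := by
      exact_mod_cast (Finset.card_le_card henc.nbrs_even_subset).trans (card_nbrs_le A)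
    nlinarith
  have hf₂A : (nbrs T₂).card ≤ A.card := Finset.card_le_card henc.nbrs_odd_subset
  have hAS : A.card ≤ S₁.card := Finset.card_le_card henc.subset_hull_even
  have hf₂ : ((nbrs T₂).card : ℝ) ≤ d * α ^ d := by
    have : ((nbrs T₂).card : ℝ) ≤ A.card := by exact_mod_cast hf₂A
    nlinarith
  have hb₁ := card_hull_bound hE hT₁E hd0 (ε := η / 2) (θ := 1 - η) (by linarith)
    (by linarith [hd.volume_le])
  have hb₂ := card_hull_bound hO hT₂O hd0 (ε := η / 2) (θ := 1 - η) (by linarith)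
    (by linarith [hd.volume_le])
  rw [← hS₁] at hb₁
  rw [← hS₂] at hb₂
  have hs₁ : (S₁.card : ℝ) ≤ (1 - η) * (nbrs T₁).card := by linarith
  have hs₂ : S₂.card ≤ (nbrs T₂).card := by
    have h1 : (0:ℝ) ≤ (nbrs T₂).card := Nat.cast_nonneg _
    have : (S₂.card : ℝ) ≤ (nbrs T₂).card := by nlinarith
    exact_mod_cast this
  have hcard : 𝒬.card ≤ 2 ^ S₁.card := by
    have hsub : 𝒬 ⊆ Finset.Icc (nbrs T₂) S₁ ×ˢ S₂.powerset := by
      rintro p hp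
      obtain ⟨hp, -, -⟩ := h𝒬 p hp
      exact Finset.mem_product.2 ⟨Finset.mem_Icc.2 ⟨hp.nbrs_odd_subset, hp.subset_hull_even⟩,
        Finset.mem_powerset.2 hp.subset_hull_odd⟩
    refine (Finset.card_le_card hsub).trans ?_
    have hIcc : (Finset.Icc (nbrs T₂) S₁).card = 2 ^ (S₁.card - (nbrs T₂).card) :=
      Finset.card_Icc_finset (henc.nbrs_odd_subset.trans henc.subset_hull_even)
    rw [Finset.card_product, Finset.card_powerset, hIcc, ← pow_add]
    exact Nat.pow_le_pow_right (by norm_num) (by omega)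
  set M := max (nbrs T₁).card (2 * d - 2) with hM
  have hw : ∀ p ∈ 𝒬, (1 / 2 : ℝ) ^ (nbrs p.1).card ≤ (1 / 2 : ℝ) ^ M := by
    intro p hp
    obtain ⟨hp, -, hp2⟩ := h𝒬 p hp
    refine pow_le_pow_of_le_one (by norm_num) (by norm_num) (max_le ?_ ?_)
    · exact Finset.card_le_card hp.nbrs_even_subset
    · exact two_mul_sub_two_le_card_nbrs hp2
  have hMf : ((nbrs T₁).card : ℝ) ≤ M := by exact_mod_cast le_max_left _ _
  have hMd : 2 * (d:ℝ) - 2 ≤ M := by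
    have : 2 * d ≤ M + 2 := by omega
    have : (2 * d : ℝ) ≤ M + 2 := by exact_mod_cast this
    linarith
  have hfnn : (0:ℝ) ≤ (nbrs T₁).card := Nat.cast_nonneg _
  have ht : T.card * (η ^ 2 / 64 * d) ≤ η / 16 * (nbrs T₁).card := by
    have h1 := henc.card_le
    rw [← hT₁, ← hT₂] at h1
    have h2 : ((nbrs T₂).card : ℝ) ≤ S₁.card := by exact_mod_cast hf₂A.trans hAS
    have h3 : T.card * (η / 2 * d) ≤ 2 * (nbrs T₁).card := by nlinarith
    calc T.card * (η ^ 2 / 64 * d) = η / 32 * (T.card * (η / 2 * d)) := by ring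
      _ ≤ η / 32 * (2 * (nbrs T₁).card) := by gcongr
      _ = _ := by ring
  have hexp : (S₁.card : ℝ) + 3 / 2 * d + T.card * (η ^ 2 / 64 * d) ≤ M := by
    rcases le_or_gt ((nbrs T₁).card : ℝ) ((d:ℝ) ^ 2) with hle | hgt
    · have hb := card_hull_bound hE hT₁E hd0 (ε := η / 2) (θ := 1 / 32) (by linarith)
        (by linarith [hd.sq_le])
      rw [← hS₁] at hb
      have hsnn : (0:ℝ) ≤ S₁.card := Nat.cast_nonneg _
      nlinarith
    · have h1 : 3 * (d:ℝ) ≤ η * (d:ℝ) ^ 2 := by nlinarith [hd.three_le]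
      nlinarith
  calc ∑ p ∈ 𝒬, (1 / 2 : ℝ) ^ (nbrs p.1).card ≤ 𝒬.card * (1 / 2 : ℝ) ^ M := by
        rw [← nsmul_eq_mul]
        exact Finset.sum_le_card_nsmul _ _ _ hw
    _ ≤ (2:ℝ) ^ S₁.card * (1 / 2 : ℝ) ^ M := by
        gcongr
        exact_mod_cast hcard
    _ = (2:ℝ) ^ ((S₁.card : ℝ) - M) := by
        rw [Real.rpow_sub (by norm_num), Real.rpow_natCast, Real.rpow_natCast, one_div, inv_pow,
          div_eq_mul_inv]
    _ ≤ (2:ℝ) ^ (-(3 / 2 * d : ℝ) + -(η ^ 2 / 64 * d * T.card)) :=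
        Real.rpow_le_rpow_of_exponent_le (by norm_num) (by linarith)
    _ = (2:ℝ) ^ (-(3 / 2 * d : ℝ)) * (((2:ℝ) ^ (η ^ 2 / 64 * d))⁻¹) ^ T.card := by
        rw [Real.rpow_add (by norm_num), Real.rpow_neg (by norm_num) (η ^ 2 / 64 * d * T.card),
          Real.rpow_mul (by norm_num), Real.rpow_natCast, inv_pow]
    _ ≤ _ := by
        gcongr
        exact hd.degree_le

lemma sum_nice_le {α η : ℝ} (hα : 1 < α) (hη : 0 < η) (hη1 : η ≤ 1) (hd : LargeDim α η d)
    {𝒜 : Finset (Finset (Fin d → Bool))}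
    (h𝒜 : ∀ A ∈ 𝒜, (A : Set (Fin d → Bool)) ⊆ evenV d ∧ (A.card : ℝ) < α ^ d ∧
      twoLinked (A : Set (Fin d → Bool)) ∧ 2 ≤ A.card) :
    ∑ A ∈ 𝒜, (2:ℝ) ^ (((interiorVerts A).card : ℤ) - ((nbrs A).card : ℤ)) ≤
      2 * (2:ℝ) ^ (-(1 / 2 * d : ℝ)) := by
  classical
  have hd0 : 0 < d := by have := hd.twelve_le; omega
  set 𝒬 := (Finset.univ : Finset (Finset (Fin d → Bool) × Finset (Fin d → Bool))).filter
    fun p => p.1 ∈ 𝒜 ∧ p.2 ⊆ interiorVerts p.1 with h𝒬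
  have hsum : ∑ A ∈ 𝒜, (2:ℝ) ^ (((interiorVerts A).card : ℤ) - ((nbrs A).card : ℤ)) =
      ∑ p ∈ 𝒬, (1 / 2 : ℝ) ^ (nbrs p.1).card := by
    rw [Finset.sum_finset_product 𝒬 𝒜 (fun A => (interiorVerts A).powerset)
      (by simp [h𝒬])]
    refine Finset.sum_congr rfl fun A _ => ?_
    simp only [Finset.sum_const]
    rw [Finset.card_powerset, nsmul_eq_mul, zpow_sub₀ (by norm_num),
      zpow_natCast, zpow_natCast, one_div, inv_pow, div_eq_mul_inv]
    push_cast
    rfl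
  have hex : ∀ p : Finset (Fin d → Bool) × Finset (Fin d → Bool), ∃ T, p ∈ 𝒬 →
      Encodes (η / 2 * d) p.1 p.2 T := by
    intro p
    by_cases hp : p ∈ 𝒬
    · obtain ⟨hpA, hpC⟩ := (Finset.mem_filter.1 hp).2
      obtain ⟨hE, -, hlink, h2⟩ := h𝒜 _ hpA
      obtain ⟨T, hT⟩ := exists_encodes (ε := η / 2) (by linarith) (by linarith) hd0 hE hlink
        (Finset.card_pos.1 (by omega)) hpC
      exact ⟨T, fun _ => hT⟩
    · exact ⟨∅, fun h => absurd h hp⟩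
  choose code hcode using hex
  set 𝒯 := 𝒬.image code
  rw [hsum, ← Finset.sum_fiberwise_of_maps_to
    (fun p hp => Finset.mem_image_of_mem code hp : ∀ p ∈ 𝒬, code p ∈ 𝒯)]
  have hfib : ∀ T ∈ 𝒯, ∑ p ∈ 𝒬.filter (fun p => code p = T), (1 / 2 : ℝ) ^ (nbrs p.1).card ≤
      (2:ℝ) ^ (-(3 / 2 * d : ℝ)) * ((2 * (((d + 1) ^ 6 : ℕ) : ℝ) ^ 2)⁻¹) ^ T.card := by
    intro T _
    refine sum_encodes_le hα hη hη1 hd fun p hp => ?_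
    obtain ⟨hp𝒬, rfl⟩ := Finset.mem_filter.1 hp
    obtain ⟨-, hs, -, h2⟩ := h𝒜 _ (Finset.mem_filter.1 hp𝒬).2.1
    exact ⟨hcode p hp𝒬, hs, h2⟩
  refine (Finset.sum_le_sum hfib).trans ?_
  rw [← Finset.mul_sum]
  have hcount := sum_cutLinked_le (R := fun u v : Fin d → Bool => hamDist u v ≤ 6)
    (ball := fun v => Finset.univ.filter fun w => hamDist v w ≤ 6) (D := (d + 1) ^ 6)
    (fun v w h => by rwa [hamDist_comm]) (Nat.one_le_pow _ _ (Nat.succ_pos d))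
    (fun v w h => by simpa using h) (card_ball_le 6) 𝒯 (by
      intro T hT
      obtain ⟨p, hp, rfl⟩ := Finset.mem_image.1 hT
      exact ⟨(hcode p hp).nonempty, (hcode p hp).cutLinked⟩)
  have hV : (Fintype.card (Fin d → Bool) : ℝ) = (2:ℝ) ^ (d:ℝ) := by simp
  rw [hV] at hcount
  calc _ ≤ (2:ℝ) ^ (-(3 / 2 * d : ℝ)) * (2 * (2:ℝ) ^ (d:ℝ)) := by gcongr
    _ = 2 * ((2:ℝ) ^ (-(3 / 2 * d : ℝ)) * (2:ℝ) ^ (d:ℝ)) := by ring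
    _ = _ := by
      rw [← Real.rpow_add (by norm_num)]
      congr 2
      ring

open Filter in
lemma eventually_const_mul_pow_le {b C : ℝ} (hb : 1 < b) (hC : 0 < C) (k : ℕ) :
    ∀ᶠ n : ℕ in atTop, C * (n:ℝ) ^ k ≤ b ^ n := by
  have h := (tendsto_pow_const_div_const_pow_of_one_lt k hb).eventually
    (gt_mem_nhds (inv_pos.2 hC))
  filter_upwards [h] with n hn
  have hbn : 0 < b ^ n := by positivity
  rw [div_lt_iff₀ hbn] at hn
  calc C * (n:ℝ) ^ k ≤ C * (C⁻¹ * b ^ n) := by gcongr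
    _ = b ^ n := by field_simp

open Filter in
lemma eventually_largeDim {α : ℝ} (hα1 : 1 < α) (hα2 : α < 2) :
    ∃ η : ℝ, 0 < η ∧ η ≤ 1 ∧ ∀ᶠ d : ℕ in atTop, LargeDim α η d := by
  have hα0 : 0 < α := by linarith
  obtain ⟨η, hη, hη1, hlt⟩ : ∃ η : ℝ, 0 < η ∧ η ≤ 1 ∧ α < (2:ℝ) ^ (1 - η) := by
    have h1 : 0 < Real.logb 2 α := Real.logb_pos (by norm_num) hα1
    have h2 : Real.logb 2 α < 1 := by
      rw [Real.logb_lt_iff_lt_rpow (by norm_num) hα0]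
      simpa using hα2
    refine ⟨(1 - Real.logb 2 α) / 2, by linarith, by linarith, ?_⟩
    rw [← Real.logb_lt_iff_lt_rpow (by norm_num) hα0]
    linarith
  refine ⟨η, hη, hη1, ?_⟩
  have e1 := eventually_const_mul_pow_le (b := (2:ℝ) ^ (1 - η) / α) (C := 3)
    (by rwa [one_lt_div hα0]) (by norm_num) 1
  have e2 := eventually_const_mul_pow_le (b := (2:ℝ) ^ (1 / 32 : ℝ)) (C := 3)
    (Real.one_lt_rpow (by norm_num) (by norm_num)) (by norm_num) 2
  have e3 := eventually_const_mul_pow_le (b := (2:ℝ) ^ (η ^ 2 / 64)) (C := 8192)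
    (Real.one_lt_rpow (by norm_num) (by positivity)) (by norm_num) 12
  filter_upwards [e1, e2, e3, eventually_ge_atTop 12, eventually_ge_atTop ⌈3 / η⌉₊]
    with d h1 h2 h3 h4 h5
  have hd12 : (12:ℝ) ≤ d := by exact_mod_cast h4
  refine ⟨h4, ?_, ?_, ?_, ?_⟩
  · have := (Nat.le_ceil _).trans (Nat.cast_le (α := ℝ).2 h5)
    rw [div_le_iff₀ hη] at this
    linarith
  · rw [Real.rpow_mul (by norm_num), Real.rpow_natCast]
    rw [div_pow, le_div_iff₀ (by positivity)] at h1
    linarith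
  · rwa [Real.rpow_mul (by norm_num), Real.rpow_natCast]
  · rw [Real.rpow_mul (by norm_num), Real.rpow_natCast]
    refine le_trans ?_ h3
    push_cast
    calc 2 * (((d:ℝ) + 1) ^ 6) ^ 2 ≤ 2 * ((2 * (d:ℝ)) ^ 6) ^ 2 := by gcongr; linarith
      _ = _ := by ring

end CubeLemmas

theorem sum_over_nice_sets_small (α : ℝ) (hα1 : 1 < α) (hα2 : α < 2) :
    ∃ c > (0:ℝ), ∃ d₀ : ℕ, ∀ d : ℕ, d₀ ≤ d →
      (∑ᶠ (A : Set (Fin d → Bool))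
          (_ : A ⊆ evenV d ∧ (A.ncard : ℝ) < α ^ d ∧ twoLinked A ∧ 2 ≤ A.ncard),
        (2:ℝ) ^ (((bset d A).ncard : ℤ) - ((nbhd d A).ncard : ℤ))) ≤
        Real.exp (-c * d) := by

  obtain ⟨η, hη, hη1, hlarge⟩ := eventually_largeDim hα1 hα2
  obtain ⟨d₀, hd₀⟩ := Filter.eventually_atTop.1 hlarge
  refine ⟨1 / 4, by norm_num, d₀, fun d hd => ?_⟩
  have hL := hd₀ d hd
  classical
  set 𝒜 : Finset (Finset (Fin d → Bool)) := Finset.univ.filter fun A : Finset (Fin d → Bool) =>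
    (A : Set (Fin d → Bool)) ⊆ evenV d ∧ (A.card : ℝ) < α ^ d ∧
      twoLinked (A : Set (Fin d → Bool)) ∧ 2 ≤ A.card with h𝒜
  have hsum : (∑ᶠ (A : Set (Fin d → Bool))
      (_ : A ⊆ evenV d ∧ (A.ncard : ℝ) < α ^ d ∧ twoLinked A ∧ 2 ≤ A.ncard),
      (2:ℝ) ^ (((bset d A).ncard : ℤ) - ((nbhd d A).ncard : ℤ))) =
      ∑ A ∈ 𝒜, (2:ℝ) ^ (((interiorVerts A).card : ℤ) - ((nbrs A).card : ℤ)) := by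
    rw [← finsum_comp_equiv (Fintype.finsetEquivSet (α := Fin d → Bool)),
      ← finsum_mem_finset_eq_sum]
    refine finsum_congr fun A => ?_
    simp [h𝒜, bset_coe, nbhd_coe, Set.ncard_coe_finset]
  rw [hsum]
  refine (sum_nice_le hα1 hη hη1 hL fun A hA => (Finset.mem_filter.1 hA).2).trans ?_
  have hd12 : (12:ℝ) ≤ d := by exact_mod_cast hL.twelve_le
  have hl := Real.log_two_gt_d9
  calc 2 * (2:ℝ) ^ (-(1 / 2 * d : ℝ)) = Real.exp (Real.log 2 * (1 - 1 / 2 * d)) := by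
        rw [← Real.rpow_def_of_pos (by norm_num), sub_eq_add_neg,
          Real.rpow_add (by norm_num), Real.rpow_one]
    _ ≤ _ := Real.exp_le_exp.2 (by nlinarith)
end
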